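/- Let a ∈ C^∞(S²). For any ε > 0 there exists δ > 0 such that for any s ∈ [ε,∞) with s not an integer, and any function f ∈ ℋ^s(S²), the function a·(fσ*fσ*fσ)|_{S²} belongs to ℋ^t(S²) for every non-integer t ∈ [0, s+δ]. -/

import Mathlib

open MeasureTheory Metric Filter
open scoped ENNReal RealInnerProductSpace

noncomputable section

/-- `ℝ³`, i.e. three-dimensional Euclidean space. -/
abbrev E3 : Type := EuclideanSpace ℝ (Fin 3)

/-- The unit sphere `S² ⊂ ℝ³`. -/
def sph : Set E3 := Metric.sphere 0 1

/-- Surface measure `σ` on the unit sphere `S²`, realized as the two-dimensional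
Hausdorff measure on `ℝ³` restricted to the sphere. -/
def sphMeasure : Measure E3 := (μH[2]).restrict sph

/-- `Q` is (a representative of) the density, with respect to Lebesgue measure on `ℝ³`,
of the convolution `fσ * gσ` of the two finite measures `f dσ` and `g dσ`:
`Q ∈ L¹(ℝ³)` and `∫ φ Q = ∬ φ(x+y) f(x) g(y) dσ dσ` for all test functions `φ`. -/
def IsConvPairDensity (f g Q : E3 → ℂ) : Prop :=
  Integrable Q volume ∧
  ∀ φ : E3 → ℂ, Continuous φ → HasCompactSupport φ →
    ∫ z, φ z * Q z = ∫ x, ∫ y, φ (x + y) * (f x * g y) ∂sphMeasure ∂sphMeasure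

/-- A fixed metric on the orthogonal group `O(3)` (realized as the group of linear isometric
equivalences of `ℝ³`): the operator-norm distance `|Θ - I|`. -/
def O3dist (Θ : E3 ≃ₗᵢ[ℝ] E3) : ℝ :=
  ‖Θ.toLinearIsometry.toContinuousLinearMap - ContinuousLinearMap.id ℝ E3‖

/-- The difference operator `(Θ - I) f = f ∘ Θ - f` for `Θ ∈ O(3)`. -/
def rotDiff (Θ : E3 ≃ₗᵢ[ℝ] E3) (f : E3 → ℂ) : E3 → ℂ := fun x => f (Θ x) - f x

/-- The norm of the space `ℋ^s(S²)`:
`‖f‖_{ℋ^s} = ‖f‖_{L²(σ)} + sup_{Θ ≠ I} |Θ-I|^{-s} ‖(Θ-I)^n f‖_{L²(σ)}` with `n = ⌊s⌋ + 1`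
(for `0 < s < 1` this is literally `sup_{Θ≠I} |Θ-I|^{-s} ‖f∘Θ - f‖_{L²}`; for higher
non-integer `s` the higher-order differences give the classical equivalent description
of the Hölder-type classes `ℋ^s = C^s_Θ L²_x`). `f ∈ ℋ^s(S²)` iff this is finite. -/
def scriptHNorm (s : ℝ) (f : E3 → ℂ) : ℝ≥0∞ :=
  eLpNorm f 2 sphMeasure +
    ⨆ (Θ : E3 ≃ₗᵢ[ℝ] E3) (_ : Θ ≠ LinearIsometryEquiv.refl ℝ E3),
      ENNReal.ofReal (O3dist Θ ^ (-s)) *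
        eLpNorm ((rotDiff Θ)^[Nat.floor s + 1] f) 2 sphMeasure

/-- Forget the `i`-th coordinate of a vector of `ℝ³`. -/
def dropCoord (i : Fin 3) (x : E3) : Fin 2 → ℝ := fun j => x (i.succAbove j)

lemma norm_sq_eq_coord (i : Fin 3) (x : E3) :
    ‖x‖ ^ 2 = x i ^ 2 + ∑ j, dropCoord i x j ^ 2 := by
  rw [EuclideanSpace.real_norm_sq_eq, Fin.sum_univ_succAbove _ i]
  rfl

lemma norm_eq_one_of_mem_sph {x : E3} (hx : x ∈ sph) : ‖x‖ = 1 := by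
  simpa [sph] using hx

lemma abs_coord_le_norm (x : E3) (i : Fin 3) : |x i| ≤ ‖x‖ := by
  simpa using PiLp.norm_apply_le x i

lemma dist_le_of_chart {i : Fin 3} {x y : E3} (hx : x ∈ sph) (hy : y ∈ sph)
    (hxy : 1 ≤ |x i + y i|) : dist x y ≤ 6 * dist (dropCoord i x) (dropCoord i y) := by
  set d := dist (dropCoord i x) (dropCoord i y) with hd
  have hd0 : 0 ≤ d := dist_nonneg
  have hj : ∀ j, |dropCoord i x j - dropCoord i y j| ≤ d := fun j => by
    simpa [Real.dist_eq] using dist_le_pi_dist (dropCoord i x) (dropCoord i y) j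
  have hnx := norm_eq_one_of_mem_sph hx
  have hny := norm_eq_one_of_mem_sph hy
  have hbx : ∀ j, |dropCoord i x j| ≤ 1 := fun j => hnx ▸ abs_coord_le_norm x (i.succAbove j)
  have hby : ∀ j, |dropCoord i y j| ≤ 1 := fun j => hny ▸ abs_coord_le_norm y (i.succAbove j)
  have hsx := norm_sq_eq_coord i x
  have hsy := norm_sq_eq_coord i y
  have hs := norm_sq_eq_coord i (x - y)
  rw [hnx, Fin.sum_univ_two] at hsx
  rw [hny, Fin.sum_univ_two] at hsy
  have hsub : ∀ j, dropCoord i (x - y) j = dropCoord i x j - dropCoord i y j := fun j => rfl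
  rw [Fin.sum_univ_two, hsub, hsub] at hs
  have hprod : ∀ j, |(dropCoord i x j) ^ 2 - (dropCoord i y j) ^ 2| ≤ 2 * d := fun j => by
    rw [sq_sub_sq, abs_mul]
    have h1 := hj j
    have h2 : |dropCoord i x j + dropCoord i y j| ≤ 2 :=
      (abs_add_le _ _).trans (by linarith [hbx j, hby j])
    exact mul_le_mul h2 h1 (abs_nonneg _) (by norm_num)
  have hi : |x i - y i| ≤ 4 * d := by
    have h1 : |x i ^ 2 - y i ^ 2| ≤ 4 * d := by
      have : x i ^ 2 - y i ^ 2 = -((dropCoord i x 0) ^ 2 - (dropCoord i y 0) ^ 2)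
          - ((dropCoord i x 1) ^ 2 - (dropCoord i y 1) ^ 2) := by linarith
      rw [this]
      refine (abs_sub _ _).trans ?_
      rw [abs_neg]
      linarith [hprod 0, hprod 1]
    rw [sq_sub_sq, abs_mul] at h1
    nlinarith [abs_nonneg (x i - y i)]
  rw [dist_eq_norm]
  refine abs_le_of_sq_le_sq' ?_ (by positivity) |>.2
  rw [hs]
  have e0 : (dropCoord i x 0 - dropCoord i y 0) ^ 2 ≤ d ^ 2 :=
    sq_le_sq' (abs_le.1 (hj 0)).1 (abs_le.1 (hj 0)).2
  have e1 : (dropCoord i x 1 - dropCoord i y 1) ^ 2 ≤ d ^ 2 :=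
    sq_le_sq' (abs_le.1 (hj 1)).1 (abs_le.1 (hj 1)).2
  have e2 : (x i - y i) ^ 2 ≤ (4 * d) ^ 2 := sq_le_sq' (abs_le.1 hi).1 (abs_le.1 hi).2
  have e3 : (x - y) i = x i - y i := rfl
  rw [e3]
  nlinarith

lemma hausdorffMeasure_le_of_chart (i : Fin 3) {A : Set E3} (hA : A ⊆ sph)
    (hs : ∀ x ∈ A, ∀ y ∈ A, 1 ≤ |x i + y i|) :
    μH[2] A ≤ 36 * volume (dropCoord i '' A) := by
  have hg : ∀ p ∈ dropCoord i '' A, Function.invFunOn (dropCoord i) A p ∈ A ∧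
      dropCoord i (Function.invFunOn (dropCoord i) A p) = p := fun p hp =>
    ⟨Function.invFunOn_mem hp, Function.invFunOn_eq hp⟩
  have hL : LipschitzOnWith 6 (Function.invFunOn (dropCoord i) A) (dropCoord i '' A) := by
    refine LipschitzOnWith.of_dist_le_mul fun p hp q hq => ?_
    have := dist_le_of_chart (hA (hg p hp).1) (hA (hg q hq).1)
      (hs _ (hg p hp).1 _ (hg q hq).1)
    rwa [(hg p hp).2, (hg q hq).2] at this
  have hsub : A ⊆ Function.invFunOn (dropCoord i) A '' (dropCoord i '' A) := fun x hx => by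
    have hp : dropCoord i x ∈ dropCoord i '' A := ⟨x, hx, rfl⟩
    refine ⟨dropCoord i x, hp, ?_⟩
    have := dist_le_of_chart (hA (hg _ hp).1) (hA hx) (hs _ (hg _ hp).1 _ hx)
    rw [(hg _ hp).2, dist_self, mul_zero] at this
    exact dist_le_zero.1 this
  have hvol : (μH[2] : Measure (Fin 2 → ℝ)) = volume := by
    have := hausdorffMeasure_pi_real (ι := Fin 2)
    simpa using this
  calc μH[2] A ≤ μH[2] (Function.invFunOn (dropCoord i) A '' (dropCoord i '' A)) :=
        measure_mono hsub
    _ ≤ ((6 : NNReal) : ℝ≥0∞) ^ (2 : ℝ) * μH[2] (dropCoord i '' A) :=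
        hL.hausdorffMeasure_image_le (by norm_num)
    _ = 36 * volume (dropCoord i '' A) := by
        rw [hvol]
        congr 1
        norm_num [ENNReal.rpow_ofNat]

/-- A subset of the sphere all of whose coordinate projections have area at most `V` has
surface measure at most `216 V`. -/
lemma sphMeasure_le_of_proj {A : Set E3} (hA : A ⊆ sph) {V : ℝ≥0∞}
    (hV : ∀ i, volume (dropCoord i '' (A ∩ {x | 1 / 2 ≤ |x i|})) ≤ V) :
    sphMeasure A ≤ 216 * V := by
  have hcov : A ⊆ ⋃ i : Fin 3, ((A ∩ {x | 1 / 2 ≤ x i}) ∪ (A ∩ {x | x i ≤ -(1 / 2)})) := by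
    intro x hx
    have hn := EuclideanSpace.real_norm_sq_eq x
    rw [norm_eq_one_of_mem_sph (hA hx), Fin.sum_univ_three] at hn
    have : ∃ i, 1 / 2 ≤ |x i| := by
      by_contra! h
      have key : ∀ i, x i ^ 2 ≤ 1 / 4 := fun i => by
        have := h i
        rw [abs_lt] at this
        nlinarith
      linarith [key 0, key 1, key 2]
    obtain ⟨i, hi⟩ := this
    refine Set.mem_iUnion.2 ⟨i, ?_⟩
    rcases le_abs.1 hi with h | h
    · exact Or.inl ⟨hx, h⟩
    · exact Or.inr ⟨hx, by simp only [Set.mem_ofPred_eq]; linarith⟩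
  have hpiece : ∀ i : Fin 3,
      μH[2] ((A ∩ {x | 1 / 2 ≤ x i}) ∪ (A ∩ {x | x i ≤ -(1 / 2)})) ≤ 72 * V := by
    intro i
    have h1 : μH[2] (A ∩ {x | 1 / 2 ≤ x i}) ≤ 36 * V := by
      refine (hausdorffMeasure_le_of_chart i (Set.inter_subset_left.trans hA) ?_).trans ?_
      · rintro x ⟨-, hx⟩ y ⟨-, hy⟩
        simp only [Set.mem_ofPred_eq] at hx hy
        exact le_abs.2 (Or.inl (by linarith))
      · gcongr
        refine (measure_mono (Set.image_mono ?_)).trans (hV i)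
        rintro x ⟨hx, hx'⟩
        simp only [Set.mem_ofPred_eq] at hx'
        exact ⟨hx, show (1 / 2 : ℝ) ≤ |x i| from le_abs.2 (Or.inl hx')⟩
    have h2 : μH[2] (A ∩ {x | x i ≤ -(1 / 2)}) ≤ 36 * V := by
      refine (hausdorffMeasure_le_of_chart i (Set.inter_subset_left.trans hA) ?_).trans ?_
      · rintro x ⟨-, hx⟩ y ⟨-, hy⟩
        simp only [Set.mem_ofPred_eq] at hx hy
        exact le_abs.2 (Or.inr (by linarith))
      · gcongr
        refine (measure_mono (Set.image_mono ?_)).trans (hV i)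
        rintro x ⟨hx, hx'⟩
        simp only [Set.mem_ofPred_eq] at hx'
        exact ⟨hx, show (1 / 2 : ℝ) ≤ |x i| from le_abs.2 (Or.inr (by linarith))⟩
    calc _ ≤ 36 * V + 36 * V := (measure_union_le _ _).trans (add_le_add h1 h2)
      _ = 72 * V := by rw [← add_mul]; norm_num
  calc sphMeasure A ≤ μH[2] A := Measure.restrict_le_self A
    _ ≤ ∑ i : Fin 3, μH[2] ((A ∩ {x | 1 / 2 ≤ x i}) ∪ (A ∩ {x | x i ≤ -(1 / 2)})) :=
        (measure_mono hcov).trans (measure_iUnion_fintype_le _ _)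
    _ ≤ ∑ _i : Fin 3, 72 * V := Finset.sum_le_sum fun i _ => hpiece i
    _ = 216 * V := by
        rw [Finset.sum_const, Finset.card_univ, Fintype.card_fin, nsmul_eq_mul, ← mul_assoc]
        norm_num

lemma measurableSet_sph : MeasurableSet sph := isClosed_sphere.measurableSet

lemma sphMeasure_inter_sph (A : Set E3) : sphMeasure A = sphMeasure (A ∩ sph) := by
  rw [sphMeasure, Measure.restrict_apply' measurableSet_sph,
    Measure.restrict_apply' measurableSet_sph, Set.inter_assoc, Set.inter_self]

lemma sphMeasure_closedBall_le (w : E3) {r : ℝ} (hr : 0 ≤ r) :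
    sphMeasure (closedBall w r) ≤ ENNReal.ofReal (864 * r ^ 2) := by
  rw [sphMeasure_inter_sph]
  refine (sphMeasure_le_of_proj (V := ENNReal.ofReal (4 * r ^ 2)) Set.inter_subset_right
    fun i => ?_).trans ?_
  · calc volume (dropCoord i '' _) ≤ volume (closedBall (dropCoord i w) r) := by
          refine measure_mono ?_
          rintro _ ⟨x, ⟨⟨hx, -⟩, -⟩, rfl⟩
          rw [mem_closedBall, dist_pi_le_iff hr]
          intro j
          rw [mem_closedBall, dist_eq_norm] at hx
          exact (abs_coord_le_norm (x - w) (i.succAbove j)).trans hx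
      _ = ENNReal.ofReal (4 * r ^ 2) := by
          rw [Real.volume_pi_closedBall _ hr, Fintype.card_fin]
          ring_nf
  · rw [← ENNReal.ofReal_ofNat 216, ← ENNReal.ofReal_mul (by norm_num)]
    apply le_of_eq
    ring_nf

instance : IsFiniteMeasure sphMeasure where
  measure_univ_lt_top := by
    rw [sphMeasure_inter_sph, Set.univ_inter]
    exact (measure_mono (sphere_subset_closedBall)).trans_lt
      ((sphMeasure_closedBall_le 0 zero_le_one).trans_lt ENNReal.ofReal_lt_top)

lemma ae_mem_sph : ∀ᵐ x ∂sphMeasure, x ∈ sph :=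
  ae_restrict_mem measurableSet_sph

lemma measurePreserving_sph (Θ : E3 ≃ₗᵢ[ℝ] E3) : MeasurePreserving Θ sphMeasure sphMeasure := by
  have h := (Θ.toIsometryEquiv.measurePreserving_hausdorffMeasure 2).restrict_preimage
    (s := sph) measurableSet_sph
  have hs : Θ.toIsometryEquiv ⁻¹' sph = sph := by
    ext x
    simp [sph]
  rw [hs] at h
  exact h

lemma exists_isometry_apply_eq {v w : E3} (h : ‖v‖ = ‖w‖) : ∃ Θ : E3 ≃ₗᵢ[ℝ] E3, Θ v = w :=
  ⟨_, Submodule.reflection_sub h⟩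

lemma volume_annulus_le {c l : ℝ} (hc : 0 ≤ c) (hl : 0 ≤ l) :
    volume {p : Fin 2 → ℝ | |p 0 ^ 2 + p 1 ^ 2 - c| ≤ 2 * l} ≤ ENNReal.ofReal (16 * l) := by
  set r := √(max 0 (c - 2 * l))
  set R := √(c + 2 * l)
  have hr2 : r ^ 2 = max 0 (c - 2 * l) := Real.sq_sqrt (le_max_left _ _)
  have hR2 : R ^ 2 = c + 2 * l := Real.sq_sqrt (by positivity)
  have hrR : r ≤ R := Real.sqrt_le_sqrt (max_le (by positivity) (by linarith))
  have hsub : {p : Fin 2 → ℝ | |p 0 ^ 2 + p 1 ^ 2 - c| ≤ 2 * l} ⊆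
      WithLp.toLp 2 ⁻¹' (closedBall (0 : EuclideanSpace ℝ (Fin 2)) R \ ball 0 r) := by
    intro p hp
    rw [Set.mem_ofPred_eq, abs_le] at hp
    have hn : ‖(WithLp.toLp 2 p : EuclideanSpace ℝ (Fin 2))‖ ^ 2 = p 0 ^ 2 + p 1 ^ 2 := by
      rw [EuclideanSpace.real_norm_sq_eq, Fin.sum_univ_two]
    simp only [Set.mem_preimage, Set.mem_sdiff, mem_closedBall, dist_zero_right, mem_ball, not_lt]
    constructor
    · exact Real.le_sqrt_of_sq_le (by rw [hn]; linarith)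
    · refine Real.sqrt_le_iff.2 ⟨norm_nonneg _, ?_⟩
      rw [hn]
      exact max_le (by positivity) (by linarith)
  refine (measure_mono hsub).trans ?_
  rw [(PiLp.volume_preserving_toLp (Fin 2)).measure_preimage
    (measurableSet_closedBall.diff measurableSet_ball).nullMeasurableSet,
    measure_sdiff (ball_subset_closedBall.trans (closedBall_subset_closedBall hrR))
      measurableSet_ball.nullMeasurableSet measure_ball_lt_top.ne,
    EuclideanSpace.volume_closedBall_fin_two, EuclideanSpace.volume_ball_fin_two,
    ← ENNReal.ofReal_pow (Real.sqrt_nonneg _), ← ENNReal.ofReal_pow (Real.sqrt_nonneg _),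
    ← ENNReal.ofReal_mul (by positivity), ← ENNReal.ofReal_mul (by positivity),
    ← ENNReal.ofReal_sub _ (by positivity)]
  refine ENNReal.ofReal_le_ofReal ?_
  rw [hr2, hR2, ← sub_mul]
  have h1 : c + 2 * l - max 0 (c - 2 * l) ≤ 4 * l := by
    linarith [le_max_right 0 (c - 2 * l)]
  have h2 := Real.pi_le_four
  nlinarith [Real.pi_pos]

lemma volume_strip_le {j : Fin 2} {h l : ℝ} (hl : 0 ≤ l) :
    volume {p : Fin 2 → ℝ | |p j - h| ≤ l ∧ ∀ k, |p k| ≤ 1} ≤ ENNReal.ofReal (16 * l) := by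
  have hsub : {p : Fin 2 → ℝ | |p j - h| ≤ l ∧ ∀ k, |p k| ≤ 1} ⊆
      Set.Icc (fun k => if k = j then h - l else -1) (fun k => if k = j then h + l else 1) := by
    intro p hp
    rw [Set.mem_ofPred_eq, abs_le] at hp
    constructor <;> intro k <;> have hk := abs_le.1 (hp.2 k) <;> dsimp only <;> split_ifs with hkj
    · subst hkj; linarith
    · linarith
    · subst hkj; linarith
    · linarith
  refine (measure_mono hsub).trans ?_
  rw [Real.volume_Icc_pi, Fin.prod_univ_two]
  have hj : j = 0 ∨ j = 1 := by lia
  rcases hj with rfl | rfl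
  · simp only [if_true, if_neg (show (1 : Fin 2) ≠ 0 by decide)]
    rw [← ENNReal.ofReal_mul (by linarith)]
    exact ENNReal.ofReal_le_ofReal (by linarith)
  · simp only [if_true, if_neg (show (0 : Fin 2) ≠ 1 by decide)]
    rw [← ENNReal.ofReal_mul (by linarith)]
    exact ENNReal.ofReal_le_ofReal (by linarith)

lemma sphMeasure_coord_band_le {B : Set E3} (hB : B ⊆ sph) {l h : ℝ} (hl : 0 ≤ l)
    (hh : |h| ≤ 1) (hBl : ∀ x ∈ B, |x 2 - h| ≤ l) :
    sphMeasure B ≤ ENNReal.ofReal (3456 * l) := by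
  refine (sphMeasure_le_of_proj (V := ENNReal.ofReal (16 * l)) hB fun i => ?_).trans ?_
  · have hco : ∀ x ∈ B, ∀ k, |x k| ≤ 1 := fun x hx k =>
      norm_eq_one_of_mem_sph (hB hx) ▸ abs_coord_le_norm x k
    by_cases hi : i = 2
    · subst hi
      refine (measure_mono ?_).trans (volume_annulus_le (c := 1 - h ^ 2) ?_ hl)
      · rintro _ ⟨x, ⟨hx, -⟩, rfl⟩
        have h1 := norm_sq_eq_coord 2 x
        rw [norm_eq_one_of_mem_sph (hB hx), Fin.sum_univ_two] at h1
        have h2 : dropCoord 2 x 0 ^ 2 + dropCoord 2 x 1 ^ 2 - (1 - h ^ 2)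
            = -((x 2 + h) * (x 2 - h)) := by linarith
        rw [Set.mem_ofPred_eq, h2, abs_neg, abs_mul]
        refine mul_le_mul ((abs_add_le _ _).trans ?_) (hBl x hx) (abs_nonneg _) (by norm_num)
        linarith [hco x hx 2]
      · have := abs_le.1 hh
        nlinarith
    · obtain ⟨j, hj⟩ : ∃ j, i.succAbove j = 2 := Fin.exists_succAbove_eq (Ne.symm hi)
      refine (measure_mono ?_).trans (volume_strip_le (j := j) (h := h) hl)
      rintro _ ⟨x, ⟨hx, -⟩, rfl⟩
      refine ⟨?_, fun k => hco x hx _⟩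
      rw [dropCoord, hj]
      exact hBl x hx
  · rw [← ENNReal.ofReal_ofNat 216, ← ENNReal.ofReal_mul (by norm_num)]
    apply le_of_eq
    ring_nf

/-- Spherical bands `{x | |⟨e,x⟩ - h| ≤ l}` have measure `O(l)`. -/
lemma sphMeasure_band_le {e : E3} (he : ‖e‖ = 1) (h : ℝ) {l : ℝ} (hl : 0 ≤ l) :
    sphMeasure {x | |⟪e, x⟫ - h| ≤ l} ≤ ENNReal.ofReal (6912 * l) := by
  rw [sphMeasure_inter_sph]
  rcases Set.eq_empty_or_nonempty ({x | |⟪e, x⟫ - h| ≤ l} ∩ sph) with h0 | ⟨b, hb, hbs⟩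
  · simp [h0]
  obtain ⟨Θ, hΘ⟩ := exists_isometry_apply_eq (v := EuclideanSpace.single (2 : Fin 3) (1 : ℝ))
    (w := e) (by simp [he])
  have hpre := (show MeasurePreserving Θ.toHomeomorph.toMeasurableEquiv sphMeasure sphMeasure from
    measurePreserving_sph Θ).measure_preimage_equiv ({x | |⟪e, x⟫ - h| ≤ l} ∩ sph)
  rw [← hpre]
  have hin : ∀ y, ⟪e, Θ y⟫ = y 2 := fun y => by
    rw [← hΘ, Θ.inner_map_map, EuclideanSpace.inner_single_left]
    simp
  have hbn := norm_eq_one_of_mem_sph hbs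
  refine (sphMeasure_coord_band_le (l := 2 * l) (h := ⟪e, b⟫) ?_ (by positivity) ?_ ?_).trans
    (le_of_eq (by ring_nf))
  · rintro x ⟨-, hx⟩
    have : ‖Θ x‖ = 1 := norm_eq_one_of_mem_sph hx
    simpa [sph] using this
  · simpa [he, hbn] using abs_real_inner_le_norm e b
  · rintro x ⟨hx, -⟩
    have hx' : |⟪e, Θ x⟫ - h| ≤ l := hx
    have hb' : |⟪e, b⟫ - h| ≤ l := hb
    rw [hin] at hx'
    calc |x 2 - ⟪e, b⟫| = |(x 2 - h) - (⟪e, b⟫ - h)| := by ring_nf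
      _ ≤ _ := (abs_sub _ _).trans (by linarith)

/-- The measure of the set of pairs of points of the sphere whose sum lies in a `κ`-ball. -/
lemma prod_sphMeasure_add_le {z : E3} (hz : z ≠ 0) {κ : ℝ} (hκ0 : 0 ≤ κ) (hκ1 : κ ≤ 1) :
    ∃ N : Set E3, MeasurableSet N ∧ sphMeasure N ≤ ENNReal.ofReal (20736 * κ / ‖z‖) ∧
      ∀ x ∈ sph, ∀ y ∈ sph, ‖z - x - y‖ ≤ κ → x ∈ N := by
  have hz0 : 0 < ‖z‖ := norm_pos_iff.2 hz
  refine ⟨{x | |⟪(‖z‖⁻¹ • z), x⟫ - ‖z‖ / 2| ≤ 3 * κ / ‖z‖}, ?_, ?_, ?_⟩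
  · exact measurableSet_le (by fun_prop) measurable_const
  · refine (sphMeasure_band_le ?_ _ (by positivity)).trans (le_of_eq (by ring_nf))
    rw [norm_smul, norm_inv, norm_norm, inv_mul_cancel₀ hz0.ne']
  · intro x hx y hy hxy
    have hnx := norm_eq_one_of_mem_sph hx
    have hny := norm_eq_one_of_mem_sph hy
    have h1 : ‖z - x‖ ^ 2 = ‖z‖ ^ 2 - 2 * ⟪z, x⟫ + 1 := by
      rw [norm_sub_sq_real, hnx]; ring
    have h2 : |‖z - x‖ - 1| ≤ κ := by
      rw [← hny]
      exact (abs_norm_sub_norm_le _ _).trans hxy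
    have h3 : |‖z - x‖ ^ 2 - 1| ≤ 3 * κ := by
      rw [abs_le] at h2 ⊢
      constructor <;> nlinarith [norm_nonneg (z - x)]
    rw [Set.mem_ofPred_eq, real_inner_smul_left]
    have h4 : ‖z‖⁻¹ * ⟪z, x⟫ - ‖z‖ / 2 = -((‖z - x‖ ^ 2 - 1) / (2 * ‖z‖)) := by
      rw [h1]; field_simp; ring
    rw [h4, abs_neg, abs_div, abs_of_pos (by positivity : (0 : ℝ) < 2 * ‖z‖)]
    have h5 : 0 ≤ 3 * κ := by positivity
    gcongr
    linarith

/-- The mass that the convolution `σ * σ` gives to a ball of radius `κ` around `z`. -/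
lemma lintegral_sphMeasure_closedBall_le {z : E3} (hz : z ≠ 0) {κ : ℝ} (hκ0 : 0 ≤ κ)
    (hκ1 : κ ≤ 1) :
    ∫⁻ x, sphMeasure (closedBall (z - x) κ) ∂sphMeasure ≤
      ENNReal.ofReal (20000000 * κ ^ 3 / ‖z‖) := by
  obtain ⟨N, hN, hNm, hNx⟩ := prod_sphMeasure_add_le hz hκ0 hκ1
  calc ∫⁻ x, sphMeasure (closedBall (z - x) κ) ∂sphMeasure
      ≤ ∫⁻ x, N.indicator (fun _ => ENNReal.ofReal (864 * κ ^ 2)) x ∂sphMeasure := by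
        refine lintegral_mono_ae ?_
        filter_upwards [ae_mem_sph] with x hx
        by_cases hxN : x ∈ N
        · rw [Set.indicator_of_mem hxN]
          exact sphMeasure_closedBall_le _ hκ0
        · rw [sphMeasure_inter_sph]
          have : closedBall (z - x) κ ∩ sph = ∅ := by
            refine Set.eq_empty_of_forall_notMem ?_
            rintro y ⟨hy, hys⟩
            rw [mem_closedBall, dist_comm, dist_eq_norm] at hy
            exact hxN (hNx x hx y hys hy)
          rw [this, measure_empty]
          exact zero_le
    _ = ENNReal.ofReal (864 * κ ^ 2) * sphMeasure N := by
        rw [lintegral_indicator hN, setLIntegral_const]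
    _ ≤ ENNReal.ofReal (864 * κ ^ 2) * ENNReal.ofReal (20736 * κ / ‖z‖) := by gcongr
    _ ≤ _ := by
        rw [← ENNReal.ofReal_mul (by positivity)]
        refine ENNReal.ofReal_le_ofReal ?_
        have : 0 ≤ κ ^ 3 / ‖z‖ := by positivity
        calc 864 * κ ^ 2 * (20736 * κ / ‖z‖) = 17915904 * (κ ^ 3 / ‖z‖) := by ring
          _ ≤ 20000000 * (κ ^ 3 / ‖z‖) := by gcongr; norm_num
          _ = _ := by ring

instance : NullSingletonClass sphMeasure where
  measure_singleton w := by
    have := sphMeasure_closedBall_le w le_rfl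
    simpa using this

/-- The Newtonian potential of the surface measure restricted to a ball of radius `η`. -/
lemma setLIntegral_inv_norm_le (w : E3) {η : ℝ} (hη : 0 < η) :
    ∫⁻ y in closedBall w η, ENNReal.ofReal (‖w - y‖⁻¹) ∂sphMeasure ≤
      ENNReal.ofReal (3456 * η) := by
  set g : ℕ → E3 → ℝ≥0∞ := fun k => (closedBall w (η * (1 / 2) ^ k)).indicator
    (fun _ => ENNReal.ofReal (2 ^ (k + 1) / η)) with hg
  have hpt : ∀ y ∈ closedBall w η, ENNReal.ofReal (‖w - y‖⁻¹) ≤ ∑' k, g k y := by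
    intro y hy
    rw [mem_closedBall, dist_comm, dist_eq_norm] at hy
    rcases eq_or_lt_of_le (norm_nonneg (w - y)) with h0 | h0
    · rw [← h0]; simp
    · obtain ⟨k, hk1, hk2⟩ := exists_nat_pow_near_of_lt_one (x := ‖w - y‖ / η) (y := 1 / 2)
        (by positivity) ((div_le_one hη).2 hy) (by norm_num) (by norm_num)
      refine le_trans ?_ (ENNReal.le_tsum k)
      have hmem : y ∈ closedBall w (η * (1 / 2) ^ k) := by
        rw [mem_closedBall, dist_comm, dist_eq_norm, mul_comm]
        exact (div_le_iff₀ hη).1 hk2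
      rw [hg]
      simp only [Set.indicator_of_mem hmem]
      refine ENNReal.ofReal_le_ofReal ?_
      rw [lt_div_iff₀ hη] at hk1
      rw [inv_le_comm₀ h0 (by positivity), inv_div]
      refine le_trans (le_of_eq ?_) hk1.le
      rw [one_div, inv_pow]
      field_simp
  calc ∫⁻ y in closedBall w η, ENNReal.ofReal (‖w - y‖⁻¹) ∂sphMeasure
      ≤ ∫⁻ y in closedBall w η, ∑' k, g k y ∂sphMeasure :=
        setLIntegral_mono' measurableSet_closedBall hpt
    _ ≤ ∫⁻ y, ∑' k, g k y ∂sphMeasure := setLIntegral_le_lintegral _ _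
    _ = ∑' k, ∫⁻ y, g k y ∂sphMeasure := by
        refine lintegral_tsum fun k => ?_
        exact (measurable_const.indicator measurableSet_closedBall).aemeasurable
    _ ≤ ∑' k : ℕ, ENNReal.ofReal (1728 * η * (1 / 2) ^ k) := by
        refine ENNReal.tsum_le_tsum fun k => ?_
        rw [hg]
        simp only
        rw [lintegral_indicator measurableSet_closedBall, setLIntegral_const]
        refine (mul_le_mul_right (sphMeasure_closedBall_le w (by positivity)) _).trans ?_
        rw [← ENNReal.ofReal_mul (by positivity)]
        refine ENNReal.ofReal_le_ofReal (le_of_eq ?_)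
        have : (2 : ℝ) ^ k * (1 / 2) ^ k = 1 := by rw [← mul_pow]; norm_num
        rw [div_mul_eq_mul_div, div_eq_iff hη.ne']
        linear_combination (1728 * η ^ 2 * (1 / 2) ^ k) * this
    _ = ENNReal.ofReal (3456 * η) := by
        rw [← ENNReal.ofReal_tsum_of_nonneg (fun k => by positivity)
          (summable_geometric_two.mul_left _), tsum_mul_left, tsum_geometric_two]
        ring_nf

/-- Normalising constant of the standard radial bump. -/
def bumpMass : ℝ := ∫ x : E3, Real.smoothTransition (1 - ‖x‖ ^ 2)

/-- The standard radial bump at scale `κ`, an approximate identity as `κ → 0`. -/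
@[irreducible] def bump (κ : ℝ) (x : E3) : ℝ :=
  κ⁻¹ ^ 3 * bumpMass⁻¹ * Real.smoothTransition (1 - ‖κ⁻¹ • x‖ ^ 2)

lemma contDiff_bump (κ : ℝ) : ContDiff ℝ (⊤ : ℕ∞) (bump κ) := by
  unfold bump
  refine contDiff_const.mul (Real.smoothTransition.contDiff.comp ?_)
  exact contDiff_const.sub ((contDiff_const_smul (κ⁻¹)).norm_sq ℝ)

lemma continuous_bump (κ : ℝ) : Continuous (bump κ) := (contDiff_bump κ).continuous

lemma bumpMass_nonneg : 0 ≤ bumpMass :=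
  integral_nonneg fun _ => Real.smoothTransition.nonneg _

lemma bump_nonneg {κ : ℝ} (hκ : 0 ≤ κ) (x : E3) : 0 ≤ bump κ x := by
  have := bumpMass_nonneg
  have := Real.smoothTransition.nonneg (1 - ‖κ⁻¹ • x‖ ^ 2)
  unfold bump
  positivity

lemma bump_le {κ : ℝ} (hκ : 0 ≤ κ) (x : E3) : bump κ x ≤ κ⁻¹ ^ 3 * bumpMass⁻¹ := by
  have := bumpMass_nonneg
  unfold bump
  exact mul_le_of_le_one_right (by positivity) (Real.smoothTransition.le_one _)

lemma bump_eq_zero {κ : ℝ} (hκ : 0 < κ) {x : E3} (hx : κ ≤ ‖x‖) : bump κ x = 0 := by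
  unfold bump
  rw [Real.smoothTransition.zero_of_nonpos, mul_zero]
  rw [norm_smul, norm_inv, Real.norm_of_nonneg hκ.le, mul_pow, inv_pow, sub_nonpos,
    ← div_eq_inv_mul, one_le_div (by positivity)]
  gcongr

lemma bump_isometry (κ : ℝ) (Θ : E3 ≃ₗᵢ[ℝ] E3) (x : E3) : bump κ (Θ x) = bump κ x := by
  unfold bump
  rw [← map_smul, Θ.norm_map]

lemma bump_neg (κ : ℝ) (x : E3) : bump κ (-x) = bump κ x := by
  unfold bump
  rw [smul_neg, norm_neg]

lemma hasCompactSupport_bump {κ : ℝ} (hκ : 0 < κ) : HasCompactSupport (bump κ) := by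
  refine HasCompactSupport.of_support_subset_isCompact (isCompact_closedBall 0 κ) ?_
  intro x hx
  rw [mem_closedBall, dist_zero_right]
  by_contra! h
  exact hx (bump_eq_zero hκ h.le)

lemma bumpMass_pos : 0 < bumpMass := by
  have hc : Continuous fun x : E3 => Real.smoothTransition (1 - ‖x‖ ^ 2) :=
    Real.smoothTransition.continuous.comp (by fun_prop)
  refine hc.integral_pos_of_hasCompactSupport_nonneg_nonzero ?_
    (fun x => Real.smoothTransition.nonneg _) (x := 0) ?_
  · refine HasCompactSupport.of_support_subset_isCompact (isCompact_closedBall 0 1) ?_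
    intro x hx
    rw [mem_closedBall, dist_zero_right]
    by_contra! h
    exact hx (Real.smoothTransition.zero_of_nonpos (by nlinarith))
  · simp

lemma integral_bump {κ : ℝ} (hκ : 0 < κ) : ∫ x, bump κ x = 1 := by
  unfold bump
  rw [integral_const_mul]
  have := Measure.integral_comp_smul (volume : Measure E3)
    (fun x => Real.smoothTransition (1 - ‖x‖ ^ 2)) κ⁻¹
  rw [this]
  simp only [finrank_euclideanSpace, Fintype.card_fin, smul_eq_mul]
  rw [abs_of_pos (by positivity)]
  change _ * (_ * bumpMass) = 1
  have := bumpMass_pos.ne'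
  field_simp

/-- Schur's test for nonnegative kernels. -/
lemma schur_test {α β : Type*} [MeasurableSpace α] [MeasurableSpace β] {μ : Measure α}
    {ν : Measure β} [SFinite μ] [SFinite ν] {K : α → β → ℝ≥0∞}
    (hK : Measurable (Function.uncurry K)) {C₁ C₂ : ℝ≥0∞}
    (h₁ : ∀ᵐ x ∂μ, ∫⁻ y, K x y ∂ν ≤ C₁) (h₂ : ∀ᵐ y ∂ν, ∫⁻ x, K x y ∂μ ≤ C₂)
    {F : α → ℝ≥0∞} {G : β → ℝ≥0∞} (hF : Measurable F) (hG : Measurable G) :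
    ∫⁻ x, ∫⁻ y, K x y * (F x * G y) ∂ν ∂μ ≤
      C₁ ^ (1 / 2 : ℝ) * C₂ ^ (1 / 2 : ℝ) *
        ((∫⁻ x, F x ^ (2 : ℝ) ∂μ) ^ (1 / 2 : ℝ) * (∫⁻ y, G y ^ (2 : ℝ) ∂ν) ^ (1 / 2 : ℝ)) := by
  have hKm : Measurable fun p : α × β => K p.1 p.2 := hK
  set A : α × β → ℝ≥0∞ := fun p => K p.1 p.2 ^ (1 / 2 : ℝ) * F p.1
  set B : α × β → ℝ≥0∞ := fun p => K p.1 p.2 ^ (1 / 2 : ℝ) * G p.2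
  have hA : Measurable A := (hKm.pow_const _).mul (hF.comp measurable_fst)
  have hB : Measurable B := (hKm.pow_const _).mul (hG.comp measurable_snd)
  have hA2 : ∀ p, A p ^ (2 : ℝ) = K p.1 p.2 * F p.1 ^ (2 : ℝ) := fun p => by
    rw [ENNReal.mul_rpow_of_nonneg _ _ (by norm_num), ← ENNReal.rpow_mul]
    norm_num
  have hB2 : ∀ p, B p ^ (2 : ℝ) = K p.1 p.2 * G p.2 ^ (2 : ℝ) := fun p => by
    rw [ENNReal.mul_rpow_of_nonneg _ _ (by norm_num), ← ENNReal.rpow_mul]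
    norm_num
  have hAB : ∀ p : α × β, K p.1 p.2 * (F p.1 * G p.2) = (A * B) p := fun p => by
    have : K p.1 p.2 = K p.1 p.2 ^ (1 / 2 : ℝ) * K p.1 p.2 ^ (1 / 2 : ℝ) := by
      rw [← ENNReal.rpow_add_of_nonneg _ _ (by norm_num) (by norm_num)]
      norm_num
    calc K p.1 p.2 * (F p.1 * G p.2)
        = (K p.1 p.2 ^ (1 / 2 : ℝ) * K p.1 p.2 ^ (1 / 2 : ℝ)) * (F p.1 * G p.2) := by rw [← this]
      _ = (A * B) p := by simp only [A, B, Pi.mul_apply]; ring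
  have hAi : ∫⁻ p, A p ^ (2 : ℝ) ∂(μ.prod ν) ≤ C₁ * ∫⁻ x, F x ^ (2 : ℝ) ∂μ := by
    rw [lintegral_prod _ (hA.pow_const _).aemeasurable, ← lintegral_const_mul _ (hF.pow_const _)]
    refine lintegral_mono_ae ?_
    filter_upwards [h₁] with x hx
    simp only [hA2]
    rw [lintegral_mul_const _ (show Measurable (fun y => K x y) from
      hKm.comp measurable_prodMk_left)]
    gcongr
  have hBi : ∫⁻ p, B p ^ (2 : ℝ) ∂(μ.prod ν) ≤ C₂ * ∫⁻ y, G y ^ (2 : ℝ) ∂ν := by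
    rw [lintegral_prod_symm _ (hB.pow_const _).aemeasurable,
      ← lintegral_const_mul _ (hG.pow_const _)]
    refine lintegral_mono_ae ?_
    filter_upwards [h₂] with y hy
    simp only [hB2]
    rw [lintegral_mul_const _ (show Measurable (fun x => K x y) from
      hKm.comp measurable_prodMk_right)]
    gcongr
  have hKFG : Measurable fun p : α × β => K p.1 p.2 * (F p.1 * G p.2) := by
    simp only [hAB]; exact hA.mul hB
  calc ∫⁻ x, ∫⁻ y, K x y * (F x * G y) ∂ν ∂μ
      = ∫⁻ p, (A * B) p ∂(μ.prod ν) := by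
        rw [lintegral_prod _ (hA.mul hB).aemeasurable]
        simp only [← hAB]
    _ ≤ (∫⁻ p, A p ^ (2 : ℝ) ∂(μ.prod ν)) ^ (1 / 2 : ℝ) *
        (∫⁻ p, B p ^ (2 : ℝ) ∂(μ.prod ν)) ^ (1 / 2 : ℝ) :=
        ENNReal.lintegral_mul_le_Lp_mul_Lq _ Real.HolderConjugate.two_two hA.aemeasurable
          hB.aemeasurable
    _ ≤ (C₁ * ∫⁻ x, F x ^ (2 : ℝ) ∂μ) ^ (1 / 2 : ℝ) *
        (C₂ * ∫⁻ y, G y ^ (2 : ℝ) ∂ν) ^ (1 / 2 : ℝ) := by gcongr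
    _ = _ := by
        rw [ENNReal.mul_rpow_of_nonneg _ _ (by norm_num),
          ENNReal.mul_rpow_of_nonneg _ _ (by norm_num)]
        ring

/-- The constant in the pointwise bound for `σ * σ` mollified by a bump. -/
def pairConst : ℝ := 20000000 * bumpMass⁻¹

lemma pairConst_pos : 0 < pairConst := mul_pos (by norm_num) (inv_pos.2 bumpMass_pos)

lemma measurable_bump (κ : ℝ) : Measurable (bump κ) := (continuous_bump κ).measurable

lemma lintegral_bump_pair_le {z : E3} (hz : z ≠ 0) {κ : ℝ} (hκ0 : 0 < κ) (hκ1 : κ ≤ 1) :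
    ∫⁻ x, ∫⁻ y, ENNReal.ofReal (bump κ (z - x - y)) ∂sphMeasure ∂sphMeasure ≤
      ENNReal.ofReal (pairConst / ‖z‖) := by
  have hm := bumpMass_pos
  have hpt : ∀ x, ∫⁻ y, ENNReal.ofReal (bump κ (z - x - y)) ∂sphMeasure ≤
      ENNReal.ofReal (κ⁻¹ ^ 3 * bumpMass⁻¹) * sphMeasure (closedBall (z - x) κ) := by
    intro x
    rw [← setLIntegral_const, ← lintegral_indicator measurableSet_closedBall]
    refine lintegral_mono fun y => ?_
    by_cases hy : y ∈ closedBall (z - x) κ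
    · rw [Set.indicator_of_mem hy]
      exact ENNReal.ofReal_le_ofReal (bump_le hκ0.le _)
    · rw [mem_closedBall, dist_comm, dist_eq_norm, not_le] at hy
      simp [bump_eq_zero hκ0 hy.le]
  calc ∫⁻ x, ∫⁻ y, ENNReal.ofReal (bump κ (z - x - y)) ∂sphMeasure ∂sphMeasure
      ≤ ∫⁻ x, ENNReal.ofReal (κ⁻¹ ^ 3 * bumpMass⁻¹) * sphMeasure (closedBall (z - x) κ)
          ∂sphMeasure := lintegral_mono hpt
    _ = ENNReal.ofReal (κ⁻¹ ^ 3 * bumpMass⁻¹) *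
          ∫⁻ x, sphMeasure (closedBall (z - x) κ) ∂sphMeasure :=
        lintegral_const_mul' _ _ ENNReal.ofReal_ne_top
    _ ≤ ENNReal.ofReal (κ⁻¹ ^ 3 * bumpMass⁻¹) * ENNReal.ofReal (20000000 * κ ^ 3 / ‖z‖) := by
        gcongr
        exact lintegral_sphMeasure_closedBall_le hz hκ0.le hκ1
    _ = _ := by
        rw [← ENNReal.ofReal_mul (by positivity), pairConst]
        congr 1
        field_simp

lemma lintegral_sph_neg {F : E3 → ℝ≥0∞} (hF : Measurable F) :
    ∫⁻ x, F (-x) ∂sphMeasure = ∫⁻ x, F x ∂sphMeasure :=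
  (measurePreserving_sph (LinearIsometryEquiv.neg ℝ)).lintegral_comp hF

lemma lintegral_bump_pair_sub_le {z : E3} (hz : z ≠ 0) {κ : ℝ} (hκ0 : 0 < κ) (hκ1 : κ ≤ 1) :
    ∫⁻ x, ∫⁻ y, ENNReal.ofReal (bump κ (x - y - z)) ∂sphMeasure ∂sphMeasure ≤
      ENNReal.ofReal (pairConst / ‖z‖) := by
  refine le_trans (le_of_eq (lintegral_congr fun x => ?_)) (lintegral_bump_pair_le hz hκ0 hκ1)
  have hm : Measurable fun y => ENNReal.ofReal (bump κ (z - x - y)) :=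
    ((measurable_bump κ).comp (by fun_prop)).ennreal_ofReal
  rw [← lintegral_sph_neg hm]
  refine lintegral_congr fun y => ?_
  rw [← bump_neg]
  congr 2
  abel

/-- `L²` norm of a nonnegative function on the sphere. -/
def nrm (F : E3 → ℝ≥0∞) : ℝ≥0∞ := (∫⁻ x, F x ^ (2 : ℝ) ∂sphMeasure) ^ (1 / 2 : ℝ)

lemma nrm_tensor {F G : E3 → ℝ≥0∞} (hF : Measurable F) (hG : Measurable G) :
    (∫⁻ p, (F p.1 * G p.2) ^ (2 : ℝ) ∂(sphMeasure.prod sphMeasure)) ^ (1 / 2 : ℝ) =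
      nrm F * nrm G := by
  have : ∀ p : E3 × E3, (F p.1 * G p.2) ^ (2 : ℝ) = F p.1 ^ (2 : ℝ) * G p.2 ^ (2 : ℝ) := fun p =>
    ENNReal.mul_rpow_of_nonneg _ _ (by norm_num)
  simp only [this]
  rw [lintegral_prod_mul (hF.pow_const _).aemeasurable (hG.pow_const _).aemeasurable,
    ENNReal.mul_rpow_of_nonneg _ _ (by norm_num)]
  rfl

lemma lintegral_pairs {W : E3 → E3 → E3 → E3 → ℝ≥0∞}
    (hW : Measurable fun r : (E3 × E3) × (E3 × E3) => W r.1.1 r.1.2 r.2.1 r.2.2) :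
    ∫⁻ p : E3 × E3, ∫⁻ q : E3 × E3, W p.1 p.2 q.1 q.2
        ∂(sphMeasure.prod sphMeasure) ∂(sphMeasure.prod sphMeasure) =
      ∫⁻ x₁, ∫⁻ x₂, ∫⁻ x₃, ∫⁻ x₄, W x₁ x₂ x₃ x₄
        ∂sphMeasure ∂sphMeasure ∂sphMeasure ∂sphMeasure := by
  have h1 : Measurable fun p : E3 × E3 => ∫⁻ q : E3 × E3, W p.1 p.2 q.1 q.2
      ∂(sphMeasure.prod sphMeasure) := hW.lintegral_prod_right'
  rw [lintegral_prod _ h1.aemeasurable]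
  refine lintegral_congr fun x₁ => lintegral_congr fun x₂ => ?_
  have h2 : Measurable fun q : E3 × E3 => W x₁ x₂ q.1 q.2 :=
    hW.comp (measurable_const.prodMk measurable_id : Measurable fun q : E3 × E3 => ((x₁, x₂), q))
  rw [lintegral_prod _ h2.aemeasurable]

/-- The kernel `bump κ (x₁ - x₂ - x₃ - x₄)` restricted to `1 ≤ ‖x₁ - x₂‖`. -/
@[irreducible] def sepKernel (κ : ℝ) (p q : E3 × E3) : ℝ≥0∞ :=
  if 1 ≤ ‖p.1 - p.2‖ then ENNReal.ofReal (bump κ (p.1 - p.2 - q.1 - q.2)) else 0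

lemma measurable_sepKernel (κ : ℝ) : Measurable (Function.uncurry (sepKernel κ)) := by
  unfold sepKernel
  refine Measurable.ite (measurableSet_le measurable_const (by fun_prop)) ?_ measurable_const
  exact ((measurable_bump κ).comp (by fun_prop)).ennreal_ofReal

/-- The part of the quadrilinear form where `x₁` and `x₂` are separated. -/
lemma separated_form_le {κ : ℝ} (hκ0 : 0 < κ) (hκ1 : κ ≤ 1 / 10) {F₁ F₂ F₃ F₄ : E3 → ℝ≥0∞}
    (h₁ : Measurable F₁) (h₂ : Measurable F₂) (h₃ : Measurable F₃) (h₄ : Measurable F₄) :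
    ∫⁻ x₁, ∫⁻ x₂, ∫⁻ x₃, ∫⁻ x₄, sepKernel κ (x₁, x₂) (x₃, x₄) *
        (F₁ x₁ * F₂ x₂ * (F₃ x₃ * F₄ x₄))
        ∂sphMeasure ∂sphMeasure ∂sphMeasure ∂sphMeasure ≤
      ENNReal.ofReal (2 * pairConst) * (nrm F₁ * nrm F₂ * (nrm F₃ * nrm F₄)) := by
  have hKm := measurable_sepKernel κ
  have hK₁ : ∀ p, ∫⁻ q, sepKernel κ p q ∂(sphMeasure.prod sphMeasure) ≤
      ENNReal.ofReal (2 * pairConst) := by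
    intro p
    rw [lintegral_prod _ hKm.of_uncurry_left.aemeasurable]
    by_cases hp : 1 ≤ ‖p.1 - p.2‖
    · simp only [sepKernel, if_pos hp]
      have hp0 : p.1 - p.2 ≠ 0 := norm_pos_iff.1 (by linarith)
      refine (lintegral_bump_pair_le hp0 hκ0 (by linarith)).trans ?_
      refine ENNReal.ofReal_le_ofReal ?_
      have := pairConst_pos
      rw [div_le_iff₀ (by linarith)]
      nlinarith
    · simp [sepKernel, if_neg hp]
  have hK₂ : ∀ q, ∫⁻ p, sepKernel κ p q ∂(sphMeasure.prod sphMeasure) ≤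
      ENNReal.ofReal (2 * pairConst) := by
    intro q
    rw [lintegral_prod _ hKm.of_uncurry_right.aemeasurable]
    by_cases hq : 1 / 2 ≤ ‖q.1 + q.2‖
    · calc _ ≤ ∫⁻ x, ∫⁻ y, ENNReal.ofReal (bump κ (x - y - (q.1 + q.2)))
              ∂sphMeasure ∂sphMeasure := by
            refine lintegral_mono fun x => lintegral_mono fun y => ?_
            simp only [sepKernel]
            split_ifs
            · rw [sub_sub (x - y)]
            · exact zero_le
        _ ≤ ENNReal.ofReal (pairConst / ‖q.1 + q.2‖) :=
            lintegral_bump_pair_sub_le (norm_pos_iff.1 (by linarith)) hκ0 (by linarith)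
        _ ≤ _ := by
            refine ENNReal.ofReal_le_ofReal ?_
            have := pairConst_pos
            rw [div_le_iff₀ (by linarith)]
            nlinarith
    · have : ∀ p, sepKernel κ p q = 0 := by
        intro p
        simp only [sepKernel]
        split_ifs with hp
        · rw [bump_eq_zero hκ0, ENNReal.ofReal_zero]
          have := norm_sub_norm_le (p.1 - p.2) (q.1 + q.2)
          rw [← sub_sub] at this
          linarith
        · rfl
      simp [this]
  have hS := schur_test (μ := sphMeasure.prod sphMeasure) (ν := sphMeasure.prod sphMeasure) hKm
    (Eventually.of_forall hK₁) (Eventually.of_forall hK₂)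
    (F := fun p => F₁ p.1 * F₂ p.2) (G := fun q => F₃ q.1 * F₄ q.2)
    ((h₁.comp measurable_fst).mul (h₂.comp measurable_snd))
    ((h₃.comp measurable_fst).mul (h₄.comp measurable_snd))
  rw [← ENNReal.rpow_add_of_nonneg _ _ (by norm_num) (by norm_num), nrm_tensor h₁ h₂,
    nrm_tensor h₃ h₄] at hS
  norm_num only [ENNReal.rpow_one] at hS
  refine le_trans (le_of_eq ?_) hS
  refine (lintegral_pairs (W := fun x₁ x₂ x₃ x₄ => sepKernel κ (x₁, x₂) (x₃, x₄) *
    (F₁ x₁ * F₂ x₂ * (F₃ x₃ * F₄ x₄))) ?_).symm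
  exact hKm.mul (by fun_prop)

/-- On the support of the quadrilinear form some `x_j` is far from `x₁`. -/
lemma exists_separated {κ : ℝ} (hκ1 : κ ≤ 1 / 10) {x₁ x₂ x₃ x₄ : E3} (h₁ : x₁ ∈ sph)
    (h₂ : x₂ ∈ sph) (h₃ : x₃ ∈ sph) (h₄ : x₄ ∈ sph) (h : ‖x₁ - x₂ - x₃ - x₄‖ ≤ κ) :
    1 ≤ ‖x₁ - x₂‖ ∨ 1 ≤ ‖x₁ - x₃‖ ∨ 1 ≤ ‖x₁ - x₄‖ := by
  by_contra! hc
  have n₁ := norm_eq_one_of_mem_sph h₁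
  have e : ∀ y ∈ sph, ‖x₁ - y‖ < 1 → 1 / 2 < ⟪x₁, y⟫ := fun y hy hlt => by
    have hs := norm_sub_sq_real x₁ y
    rw [n₁, norm_eq_one_of_mem_sph hy] at hs
    have := norm_nonneg (x₁ - y)
    nlinarith
  have e2 := e _ h₂ hc.1
  have e3 := e _ h₃ hc.2.1
  have e4 := e _ h₄ hc.2.2
  have hi : ⟪x₁, x₁ - x₂ - x₃ - x₄⟫ = 1 - ⟪x₁, x₂⟫ - ⟪x₁, x₃⟫ - ⟪x₁, x₄⟫ := by
    simp only [inner_sub_right, real_inner_self_eq_norm_sq, n₁]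
    ring
  have := abs_le.1 ((abs_real_inner_le_norm x₁ (x₁ - x₂ - x₃ - x₄)).trans
    (le_of_eq_of_le (by rw [n₁, one_mul]) h))
  linarith

/-- The nonnegative quadrilinear form with kernel `bump κ (x₁ - x₂ - x₃ - x₄)`. -/
def quadForm (κ : ℝ) (F₁ F₂ F₃ F₄ : E3 → ℝ≥0∞) : ℝ≥0∞ :=
  ∫⁻ x₁, ∫⁻ x₂, ∫⁻ x₃, ∫⁻ x₄, ENNReal.ofReal (bump κ (x₁ - x₂ - x₃ - x₄)) *
    (F₁ x₁ * F₂ x₂ * (F₃ x₃ * F₄ x₄)) ∂sphMeasure ∂sphMeasure ∂sphMeasure ∂sphMeasure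

lemma lintegral_swap_inner {W : E3 → E3 → E3 → ℝ≥0∞}
    (hW : Measurable fun p : E3 × E3 × E3 => W p.1 p.2.1 p.2.2) (x : E3) :
    ∫⁻ y, ∫⁻ z, W x y z ∂sphMeasure ∂sphMeasure = ∫⁻ y, ∫⁻ z, W x z y ∂sphMeasure ∂sphMeasure := by
  refine lintegral_lintegral_swap ?_
  exact (hW.comp (measurable_const.prodMk measurable_id)).aemeasurable

lemma lintegral_swap_outer {W : E3 → E3 → E3 → ℝ≥0∞}
    (hW : Measurable fun p : E3 × E3 × E3 => W p.1 p.2.1 p.2.2) :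
    ∫⁻ x, ∫⁻ y, ∫⁻ z, W x y z ∂sphMeasure ∂sphMeasure ∂sphMeasure =
      ∫⁻ x, ∫⁻ y, ∫⁻ z, W y x z ∂sphMeasure ∂sphMeasure ∂sphMeasure := by
  refine lintegral_lintegral_swap ?_
  have h : Measurable fun p : (E3 × E3) × E3 => W p.1.1 p.1.2 p.2 :=
    hW.comp (by fun_prop : Measurable fun p : (E3 × E3) × E3 => (p.1.1, p.1.2, p.2))
  exact h.lintegral_prod_right'.aemeasurable

lemma Measurable.sepKernel {α : Type*} [MeasurableSpace α] {f g : α → E3 × E3} (κ : ℝ)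
    (hf : Measurable f) (hg : Measurable g) : Measurable fun a => sepKernel κ (f a) (g a) :=
  (measurable_sepKernel κ).comp (hf.prodMk hg)

/-- Integrand of the part of the quadrilinear form where `x₁` and `x₂` are separated. -/
def sepIntegrand (κ : ℝ) (F₁ F₂ F₃ F₄ : E3 → ℝ≥0∞) (x₁ x₂ x₃ x₄ : E3) : ℝ≥0∞ :=
  sepKernel κ (x₁, x₂) (x₃, x₄) * (F₁ x₁ * F₂ x₂ * (F₃ x₃ * F₄ x₄))

lemma measurable_sepIntegrand (κ : ℝ) {F₁ F₂ F₃ F₄ : E3 → ℝ≥0∞}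
    (h₁ : Measurable F₁) (h₂ : Measurable F₂) (h₃ : Measurable F₃) (h₄ : Measurable F₄) :
    Measurable fun p : E3 × E3 × E3 × E3 =>
      sepIntegrand κ F₁ F₂ F₃ F₄ p.1 p.2.1 p.2.2.1 p.2.2.2 := by
  refine Measurable.mul (Measurable.sepKernel κ ?_ ?_) ?_ <;> fun_prop

lemma measurable_fiber {W : E3 → E3 → E3 → E3 → ℝ≥0∞}
    (hW : Measurable fun p : E3 × E3 × E3 × E3 => W p.1 p.2.1 p.2.2.1 p.2.2.2) (x₁ : E3) :
    Measurable fun p : E3 × E3 × E3 => W x₁ p.1 p.2.1 p.2.2 :=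
  hW.comp (measurable_const.prodMk measurable_id :
    Measurable fun p : E3 × E3 × E3 => (x₁, p))

lemma lintegral_four {W : E3 → E3 → E3 → E3 → ℝ≥0∞}
    (hW : Measurable fun p : E3 × E3 × E3 × E3 => W p.1 p.2.1 p.2.2.1 p.2.2.2) :
    ∫⁻ p : E3 × E3 × E3 × E3, W p.1 p.2.1 p.2.2.1 p.2.2.2
        ∂(sphMeasure.prod (sphMeasure.prod (sphMeasure.prod sphMeasure))) =
      ∫⁻ x₁, ∫⁻ x₂, ∫⁻ x₃, ∫⁻ x₄, W x₁ x₂ x₃ x₄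
        ∂sphMeasure ∂sphMeasure ∂sphMeasure ∂sphMeasure := by
  rw [lintegral_prod _ hW.aemeasurable]
  refine lintegral_congr fun x₁ => ?_
  rw [lintegral_prod _ (measurable_fiber hW x₁).aemeasurable]
  refine lintegral_congr fun x₂ => ?_
  have h : Measurable fun p : E3 × E3 => W x₁ x₂ p.1 p.2 := (measurable_fiber hW x₁).comp
    (measurable_const.prodMk measurable_id : Measurable fun p : E3 × E3 => (x₂, p))
  rw [lintegral_prod _ h.aemeasurable]

lemma quadForm_le {κ : ℝ} (hκ0 : 0 < κ) (hκ1 : κ ≤ 1 / 10) {F₁ F₂ F₃ F₄ : E3 → ℝ≥0∞}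
    (h₁ : Measurable F₁) (h₂ : Measurable F₂) (h₃ : Measurable F₃) (h₄ : Measurable F₄) :
    quadForm κ F₁ F₂ F₃ F₄ ≤
      ENNReal.ofReal (6 * pairConst) * (nrm F₁ * nrm F₂ * (nrm F₃ * nrm F₄)) := by
  have m₂ := measurable_sepIntegrand κ h₁ h₂ h₃ h₄
  have m₃ := measurable_sepIntegrand κ h₁ h₃ h₂ h₄
  have m₄ := measurable_sepIntegrand κ h₁ h₄ h₂ h₃
  set W₃ : E3 → E3 → E3 → E3 → ℝ≥0∞ := fun x₁ x₂ x₃ x₄ => sepIntegrand κ F₁ F₃ F₂ F₄ x₁ x₃ x₂ x₄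
    with hW₃
  set W₄ : E3 → E3 → E3 → E3 → ℝ≥0∞ := fun x₁ x₂ x₃ x₄ => sepIntegrand κ F₁ F₄ F₂ F₃ x₁ x₄ x₂ x₃
    with hW₄
  have m₃' : Measurable fun p : E3 × E3 × E3 × E3 => W₃ p.1 p.2.1 p.2.2.1 p.2.2.2 :=
    m₃.comp (by fun_prop : Measurable fun p : E3 × E3 × E3 × E3 =>
      (p.1, p.2.2.1, p.2.1, p.2.2.2))
  have m₄' : Measurable fun p : E3 × E3 × E3 × E3 => W₄ p.1 p.2.1 p.2.2.1 p.2.2.2 :=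
    m₄.comp (by fun_prop : Measurable fun p : E3 × E3 × E3 × E3 =>
      (p.1, p.2.2.2, p.2.1, p.2.2.1))
  have key : quadForm κ F₁ F₂ F₃ F₄ ≤
      ∫⁻ p : E3 × E3 × E3 × E3, (sepIntegrand κ F₁ F₂ F₃ F₄ p.1 p.2.1 p.2.2.1 p.2.2.2 +
        W₃ p.1 p.2.1 p.2.2.1 p.2.2.2 + W₄ p.1 p.2.1 p.2.2.1 p.2.2.2)
        ∂(sphMeasure.prod (sphMeasure.prod (sphMeasure.prod sphMeasure))) := by
    rw [quadForm, lintegral_four (W := fun x₁ x₂ x₃ x₄ => sepIntegrand κ F₁ F₂ F₃ F₄ x₁ x₂ x₃ x₄ +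
        W₃ x₁ x₂ x₃ x₄ + W₄ x₁ x₂ x₃ x₄) ((m₂.add m₃').add m₄')]
    refine lintegral_mono_ae ?_
    filter_upwards [ae_mem_sph] with x₁ s₁
    refine lintegral_mono_ae ?_
    filter_upwards [ae_mem_sph] with x₂ s₂
    refine lintegral_mono_ae ?_
    filter_upwards [ae_mem_sph] with x₃ s₃
    refine lintegral_mono_ae ?_
    filter_upwards [ae_mem_sph] with x₄ s₄
    by_cases hs : ‖x₁ - x₂ - x₃ - x₄‖ ≤ κ
    · rcases exists_separated hκ1 s₁ s₂ s₃ s₄ hs with h | h | h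
      · refine le_trans (le_of_eq ?_) ((le_add_of_nonneg_right zero_le).trans
          (le_add_of_nonneg_right zero_le))
        simp only [sepIntegrand, sepKernel, if_pos h]
      · refine le_trans (le_of_eq ?_) ((le_add_of_nonneg_left zero_le).trans
          (le_add_of_nonneg_right zero_le))
        simp only [hW₃, sepIntegrand, sepKernel, if_pos h, sub_right_comm x₁ x₃ x₂]
        ring
      · refine le_trans (le_of_eq ?_) (le_add_of_nonneg_left zero_le)
        simp only [hW₄, sepIntegrand, sepKernel, if_pos h]
        rw [sub_right_comm x₁ x₄ x₂, sub_right_comm (x₁ - x₂) x₄ x₃]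
        ring
    · rw [bump_eq_zero hκ0 (le_of_not_ge hs)]
      simp
  have e₃ : ∫⁻ p : E3 × E3 × E3 × E3, W₃ p.1 p.2.1 p.2.2.1 p.2.2.2
      ∂(sphMeasure.prod (sphMeasure.prod (sphMeasure.prod sphMeasure))) ≤
      ENNReal.ofReal (2 * pairConst) * (nrm F₁ * nrm F₃ * (nrm F₂ * nrm F₄)) := by
    refine le_trans (le_of_eq ?_) (separated_form_le hκ0 hκ1 h₁ h₃ h₂ h₄)
    rw [lintegral_four m₃']
    exact lintegral_congr fun x₁ => lintegral_swap_outer (measurable_fiber m₃' x₁)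
  have e₄ : ∫⁻ p : E3 × E3 × E3 × E3, W₄ p.1 p.2.1 p.2.2.1 p.2.2.2
      ∂(sphMeasure.prod (sphMeasure.prod (sphMeasure.prod sphMeasure))) ≤
      ENNReal.ofReal (2 * pairConst) * (nrm F₁ * nrm F₄ * (nrm F₂ * nrm F₃)) := by
    refine le_trans (le_of_eq ?_) (separated_form_le hκ0 hκ1 h₁ h₄ h₂ h₃)
    rw [lintegral_four m₄']
    refine lintegral_congr fun x₁ => ?_
    calc _ = ∫⁻ x₂, ∫⁻ x₃, ∫⁻ x₄, W₄ x₁ x₂ x₄ x₃ ∂sphMeasure ∂sphMeasure ∂sphMeasure :=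
          lintegral_congr fun x₂ => lintegral_swap_inner (measurable_fiber m₄' x₁) x₂
      _ = _ := by
          refine lintegral_swap_outer (W := fun x₂ x₃ x₄ => W₄ x₁ x₂ x₄ x₃) ?_
          exact (measurable_fiber m₄ x₁).comp (by fun_prop : Measurable fun p : E3 × E3 × E3 =>
            (p.2.1, p.1, p.2.2))
  have e₂ : ∫⁻ p : E3 × E3 × E3 × E3, sepIntegrand κ F₁ F₂ F₃ F₄ p.1 p.2.1 p.2.2.1 p.2.2.2
      ∂(sphMeasure.prod (sphMeasure.prod (sphMeasure.prod sphMeasure))) ≤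
      ENNReal.ofReal (2 * pairConst) * (nrm F₁ * nrm F₂ * (nrm F₃ * nrm F₄)) := by
    refine le_trans (le_of_eq ?_) (separated_form_le hκ0 hκ1 h₁ h₂ h₃ h₄)
    rw [lintegral_four m₂]
    rfl
  refine key.trans ?_
  rw [lintegral_add_right _ m₄', lintegral_add_right _ m₃']
  refine (add_le_add (add_le_add e₂ e₃) e₄).trans (le_of_eq ?_)
  have h6 : ENNReal.ofReal (6 * pairConst) = 3 * ENNReal.ofReal (2 * pairConst) := by
    rw [← ENNReal.ofReal_ofNat 3, ← ENNReal.ofReal_mul (by norm_num)]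
    ring_nf
  rw [h6]
  ring

lemma nrm_sq (F : E3 → ℝ≥0∞) : nrm F * nrm F = ∫⁻ x, F x ^ (2 : ℝ) ∂sphMeasure := by
  rw [nrm, ← ENNReal.rpow_add_of_nonneg _ _ (by norm_num) (by norm_num)]
  norm_num

lemma nrm_mono {F G : E3 → ℝ≥0∞} (h : ∀ᵐ x ∂sphMeasure, F x ≤ G x) : nrm F ≤ nrm G := by
  unfold nrm
  gcongr ?_ ^ _
  refine lintegral_mono_ae ?_
  filter_upwards [h] with x hx
  gcongr

lemma nrm_enorm (f : E3 → ℂ) : nrm (fun x => ‖f x‖ₑ) = eLpNorm f 2 sphMeasure := by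
  rw [eLpNorm_eq_lintegral_rpow_enorm_toReal (by norm_num) (by norm_num), nrm]
  norm_num

lemma nrm_le_of_sq_le {F : E3 → ℝ≥0∞} (hF : nrm F ≠ ⊤) {A : ℝ≥0∞}
    (h : ∫⁻ x, F x ^ (2 : ℝ) ∂sphMeasure ≤ A * nrm F) : nrm F ≤ A := by
  rw [← nrm_sq] at h
  by_cases h0 : nrm F = 0
  · simp [h0]
  · exact (ENNReal.mul_le_mul_iff_left h0 hF).1 h

lemma nrm_lt_top_of_le {F : E3 → ℝ≥0∞} {A : ℝ≥0∞} (hA : A ≠ ⊤)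
    (h : ∀ᵐ x ∂sphMeasure, F x ≤ A) : nrm F < ⊤ := by
  refine (nrm_mono h).trans_lt ?_
  rw [nrm, lintegral_const]
  exact ENNReal.rpow_lt_top_of_nonneg (by norm_num)
    (ENNReal.mul_ne_top (ENNReal.rpow_ne_top_of_nonneg (by norm_num) hA) (measure_ne_top _ _))

/-- The threefold surface measure. -/
def sph3 : Measure (E3 × E3 × E3) := sphMeasure.prod (sphMeasure.prod sphMeasure)

instance : IsFiniteMeasure sph3 := by unfold sph3; infer_instance

/-- The mollified threefold convolution of nonnegative densities. -/
def absTri (κ : ℝ) (F G H : E3 → ℝ≥0∞) (x : E3) : ℝ≥0∞ :=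
  ∫⁻ p, ENNReal.ofReal (bump κ (x - p.1 - p.2.1 - p.2.2)) * (F p.1 * (G p.2.1 * H p.2.2)) ∂sph3

lemma measurable_absTri (κ : ℝ) {F G H : E3 → ℝ≥0∞} (hF : Measurable F) (hG : Measurable G)
    (hH : Measurable H) : Measurable (absTri κ F G H) := by
  unfold absTri
  refine Measurable.lintegral_prod_right' (f := fun q : E3 × E3 × E3 × E3 =>
    ENNReal.ofReal (bump κ (q.1 - q.2.1 - q.2.2.1 - q.2.2.2)) *
      (F q.2.1 * (G q.2.2.1 * H q.2.2.2))) ?_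
  have := measurable_bump κ
  fun_prop

lemma lintegral_sph3_mul {F G H : E3 → ℝ≥0∞} (hF : Measurable F) (hG : Measurable G)
    (hH : Measurable H) : ∫⁻ p, F p.1 * (G p.2.1 * H p.2.2) ∂sph3 =
      (∫⁻ x, F x ∂sphMeasure) * ((∫⁻ x, G x ∂sphMeasure) * ∫⁻ x, H x ∂sphMeasure) := by
  unfold sph3
  rw [lintegral_prod_mul hF.aemeasurable
    (g := fun q : E3 × E3 => G q.1 * H q.2) (by fun_prop),
    lintegral_prod_mul hG.aemeasurable hH.aemeasurable]

lemma lintegral_le_nrm {F : E3 → ℝ≥0∞} (hF : Measurable F) :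
    ∫⁻ x, F x ∂sphMeasure ≤ nrm F * nrm (fun _ => 1) := by
  have := ENNReal.lintegral_mul_le_Lp_mul_Lq sphMeasure (p := 2) (q := 2)
    (by constructor <;> norm_num) hF.aemeasurable (g := fun _ => 1) (by fun_prop)
  simpa [nrm] using this

lemma nrm_one_lt_top : nrm (fun _ => 1) < ⊤ := nrm_lt_top_of_le (A := 1) (by simp) (by simp)

lemma absTri_le {κ : ℝ} (hκ0 : 0 < κ) {F G H : E3 → ℝ≥0∞} (hF : Measurable F)
    (hG : Measurable G) (hH : Measurable H) (x : E3) :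
    absTri κ F G H x ≤ ENNReal.ofReal (κ⁻¹ ^ 3 * bumpMass⁻¹) *
      ((∫⁻ x, F x ∂sphMeasure) * ((∫⁻ x, G x ∂sphMeasure) * ∫⁻ x, H x ∂sphMeasure)) := by
  rw [← lintegral_sph3_mul hF hG hH, ← lintegral_const_mul' _ _ (by simp)]
  unfold absTri
  gcongr with p
  exact bump_le hκ0.le _

lemma nrm_absTri_lt_top {κ : ℝ} (hκ0 : 0 < κ) {F G H : E3 → ℝ≥0∞} (hF : Measurable F)
    (hG : Measurable G) (hH : Measurable H) (hF' : nrm F ≠ ⊤) (hG' : nrm G ≠ ⊤)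
    (hH' : nrm H ≠ ⊤) : nrm (absTri κ F G H) < ⊤ := by
  have key : ∀ {F : E3 → ℝ≥0∞}, Measurable F → nrm F ≠ ⊤ → ∫⁻ x, F x ∂sphMeasure ≠ ⊤ :=
    fun hF hF' => ((lintegral_le_nrm hF).trans_lt
      (ENNReal.mul_lt_top hF'.lt_top nrm_one_lt_top)).ne
  exact nrm_lt_top_of_le (ENNReal.mul_ne_top (by simp) (ENNReal.mul_ne_top (key hF hF')
    (ENNReal.mul_ne_top (key hG hG') (key hH hH'))))
    (Eventually.of_forall fun x => absTri_le hκ0 hF hG hH x)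

lemma lintegral_mul_absTri (κ : ℝ) (E : E3 → ℝ≥0∞) {F G H : E3 → ℝ≥0∞} (hF : Measurable F)
    (hG : Measurable G) (hH : Measurable H) :
    ∫⁻ x, E x * absTri κ F G H x ∂sphMeasure = quadForm κ E F G H := by
  have hb := measurable_bump κ
  unfold quadForm absTri
  refine lintegral_congr fun x => ?_
  rw [← lintegral_const_mul _ (by fun_prop)]
  have m : Measurable fun p : E3 × E3 × E3 => E x *
      (ENNReal.ofReal (bump κ (x - p.1 - p.2.1 - p.2.2)) * (F p.1 * (G p.2.1 * H p.2.2))) := by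
    fun_prop
  unfold sph3
  rw [lintegral_prod _ m.aemeasurable]
  refine lintegral_congr fun y => ?_
  have m2 : Measurable fun p : E3 × E3 => E x *
      (ENNReal.ofReal (bump κ (x - y - p.1 - p.2)) * (F y * (G p.1 * H p.2))) := by
    fun_prop
  rw [lintegral_prod _ m2.aemeasurable]
  refine lintegral_congr fun z => lintegral_congr fun w => ?_
  ring

lemma nrm_absTri_le {κ : ℝ} (hκ0 : 0 < κ) (hκ1 : κ ≤ 1 / 10) {F G H : E3 → ℝ≥0∞}
    (hF : Measurable F) (hG : Measurable G) (hH : Measurable H) (hF' : nrm F ≠ ⊤)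
    (hG' : nrm G ≠ ⊤) (hH' : nrm H ≠ ⊤) :
    nrm (absTri κ F G H) ≤ ENNReal.ofReal (6 * pairConst) * (nrm F * (nrm G * nrm H)) := by
  refine nrm_le_of_sq_le (nrm_absTri_lt_top hκ0 hF hG hH hF' hG' hH').ne ?_
  have hm := measurable_absTri κ hF hG hH
  calc ∫⁻ x, absTri κ F G H x ^ (2 : ℝ) ∂sphMeasure
      = quadForm κ (absTri κ F G H) F G H := by
        rw [← lintegral_mul_absTri κ _ hF hG hH]
        refine lintegral_congr fun x => ?_
        rw [ENNReal.rpow_two, sq]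
    _ ≤ _ := quadForm_le hκ0 hκ1 hm hF hG hH
    _ = _ := by ring

/-- The Hilbert space of square-integrable functions on the sphere. -/
abbrev HH : Type := Lp ℂ 2 sphMeasure

/-- The mollified threefold convolution of complex densities. -/
def tri (κ : ℝ) (f g h : E3 → ℂ) (x : E3) : ℂ :=
  ∫ p, (bump κ (x - p.1 - p.2.1 - p.2.2) : ℂ) * (f p.1 * (g p.2.1 * h p.2.2)) ∂sph3

lemma integrable_sph3_mul {f g h : E3 → ℂ} (hf : Integrable f sphMeasure)
    (hg : Integrable g sphMeasure) (hh : Integrable h sphMeasure) :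
    Integrable (fun p : E3 × E3 × E3 => f p.1 * (g p.2.1 * h p.2.2)) sph3 :=
  hf.mul_prod (hg.mul_prod hh)

lemma norm_bump_le {κ : ℝ} (hκ : 0 < κ) (x : E3) :
    ‖(bump κ x : ℂ)‖ ≤ κ⁻¹ ^ 3 * bumpMass⁻¹ := by
  rw [Complex.norm_real, Real.norm_of_nonneg (bump_nonneg hκ.le x)]
  exact bump_le hκ.le x

lemma continuous_bumpC (κ : ℝ) : Continuous fun x => (bump κ x : ℂ) :=
  Complex.continuous_ofReal.comp (continuous_bump κ)

lemma integrable_tri {κ : ℝ} (hκ : 0 < κ) {f g h : E3 → ℂ} (hf : Integrable f sphMeasure)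
    (hg : Integrable g sphMeasure) (hh : Integrable h sphMeasure) (x : E3) :
    Integrable (fun p : E3 × E3 × E3 =>
      (bump κ (x - p.1 - p.2.1 - p.2.2) : ℂ) * (f p.1 * (g p.2.1 * h p.2.2))) sph3 := by
  refine (integrable_sph3_mul hf hg hh).bdd_mul (c := κ⁻¹ ^ 3 * bumpMass⁻¹) ?_
    (Eventually.of_forall fun p => norm_bump_le hκ _)
  exact ((continuous_bumpC κ).comp (by fun_prop)).aestronglyMeasurable

lemma continuous_tri {κ : ℝ} (hκ : 0 < κ) {f g h : E3 → ℂ} (hf : Integrable f sphMeasure)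
    (hg : Integrable g sphMeasure) (hh : Integrable h sphMeasure) : Continuous (tri κ f g h) := by
  refine continuous_of_dominated (bound := fun p => κ⁻¹ ^ 3 * bumpMass⁻¹ *
    ‖f p.1 * (g p.2.1 * h p.2.2)‖) (fun x => (integrable_tri hκ hf hg hh x).1) ?_ ?_ ?_
  · refine fun x => Eventually.of_forall fun p => ?_
    rw [norm_mul]
    gcongr
    exact norm_bump_le hκ _
  · exact (integrable_sph3_mul hf hg hh).norm.const_mul _
  · refine Eventually.of_forall fun p => ?_
    exact ((continuous_bumpC κ).comp (by fun_prop)).mul continuous_const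

lemma enorm_tri_le {κ : ℝ} (hκ : 0 < κ) (f g h : E3 → ℂ) (x : E3) :
    ‖tri κ f g h x‖ₑ ≤ absTri κ (fun x => ‖f x‖ₑ) (fun x => ‖g x‖ₑ) (fun x => ‖h x‖ₑ) x := by
  refine (enorm_integral_le_lintegral_enorm _).trans (le_of_eq ?_)
  refine lintegral_congr fun p => ?_
  rw [enorm_mul, enorm_mul, enorm_mul]
  congr 1
  rw [← ofReal_norm, Complex.norm_real, Real.norm_of_nonneg (bump_nonneg hκ.le _)]

lemma HH.integrable (f : HH) : Integrable f sphMeasure :=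
  (Lp.memLp f).integrable (by norm_num)

lemma HH.nrm_eq (f : HH) : nrm (fun x => ‖f x‖ₑ) = ‖f‖ₑ := by
  rw [nrm_enorm, Lp.enorm_def]

lemma HH.measurable_enorm (f : HH) : Measurable fun x => ‖f x‖ₑ :=
  (Lp.stronglyMeasurable f).measurable.enorm

lemma HH.eLpNorm_tri_le {κ : ℝ} (hκ0 : 0 < κ) (hκ1 : κ ≤ 1 / 10) (f g h : HH) :
    eLpNorm (tri κ f g h) 2 sphMeasure ≤
      ENNReal.ofReal (6 * pairConst) * (‖f‖ₑ * (‖g‖ₑ * ‖h‖ₑ)) := by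
  rw [← nrm_enorm, ← f.nrm_eq, ← g.nrm_eq, ← h.nrm_eq]
  refine (nrm_mono (Eventually.of_forall fun x => enorm_tri_le hκ0 f g h x)).trans ?_
  refine nrm_absTri_le hκ0 hκ1 f.measurable_enorm g.measurable_enorm h.measurable_enorm ?_ ?_ ?_
  · rw [f.nrm_eq]; exact enorm_ne_top
  · rw [g.nrm_eq]; exact enorm_ne_top
  · rw [h.nrm_eq]; exact enorm_ne_top

lemma memLp_tri {κ : ℝ} (hκ : 0 < κ) {f g h : E3 → ℂ} (hf : Integrable f sphMeasure)
    (hg : Integrable g sphMeasure) (hh : Integrable h sphMeasure) :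
    MemLp (tri κ f g h) 2 sphMeasure := by
  refine MemLp.of_bound (continuous_tri hκ hf hg hh).aestronglyMeasurable
    (κ⁻¹ ^ 3 * bumpMass⁻¹ * ∫ p, ‖f p.1 * (g p.2.1 * h p.2.2)‖ ∂sph3)
    (Eventually.of_forall fun x => ?_)
  rw [← integral_const_mul]
  refine norm_integral_le_of_norm_le ((integrable_sph3_mul hf hg hh).norm.const_mul _) ?_
  refine Eventually.of_forall fun p => ?_
  rw [norm_mul]
  gcongr
  exact norm_bump_le hκ _

/-- The mollified threefold convolution as a map on `L²(σ)`. -/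
def triLp {κ : ℝ} (hκ : 0 < κ) (f g h : HH) : HH :=
  (memLp_tri hκ f.integrable g.integrable h.integrable).toLp

lemma triLp_coe {κ : ℝ} (hκ : 0 < κ) (f g h : HH) :
    triLp hκ f g h =ᵐ[sphMeasure] tri κ f g h := MemLp.coeFn_toLp _

lemma norm_triLp_le {κ : ℝ} (hκ : 0 < κ) (hκ1 : κ ≤ 1 / 10) (f g h : HH) :
    ‖triLp hκ f g h‖ ≤ 6 * pairConst * (‖f‖ * (‖g‖ * ‖h‖)) := by
  have := HH.eLpNorm_tri_le hκ hκ1 f g h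
  rw [triLp, Lp.norm_toLp]
  refine ENNReal.toReal_le_of_le_ofReal (by have := pairConst_pos; positivity) (this.trans ?_)
  rw [ENNReal.ofReal_mul (p := 6 * pairConst) (by have := pairConst_pos; positivity),
    ENNReal.ofReal_mul (norm_nonneg _), ENNReal.ofReal_mul (norm_nonneg _),
    ofReal_norm, ofReal_norm, ofReal_norm]

lemma ae_sph3 {P Q R : E3 → Prop} (hP : ∀ᵐ x ∂sphMeasure, P x) (hQ : ∀ᵐ x ∂sphMeasure, Q x)
    (hR : ∀ᵐ x ∂sphMeasure, R x) : ∀ᵐ p ∂sph3, P p.1 ∧ Q p.2.1 ∧ R p.2.2 := by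
  have h1 : Measure.QuasiMeasurePreserving (Prod.fst : E3 × E3 × E3 → E3) sph3 sphMeasure :=
    Measure.quasiMeasurePreserving_fst
  have h2 : Measure.QuasiMeasurePreserving (fun p : E3 × E3 × E3 => p.2.1) sph3 sphMeasure :=
    Measure.quasiMeasurePreserving_fst.comp Measure.quasiMeasurePreserving_snd
  have h3 : Measure.QuasiMeasurePreserving (fun p : E3 × E3 × E3 => p.2.2) sph3 sphMeasure :=
    Measure.quasiMeasurePreserving_snd.comp Measure.quasiMeasurePreserving_snd
  filter_upwards [h1.ae hP, h2.ae hQ, h3.ae hR] with p a b c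
  exact ⟨a, b, c⟩

lemma tri_congr_ae (κ : ℝ) {f g h f' g' h' : E3 → ℂ} (hf : f =ᵐ[sphMeasure] f')
    (hg : g =ᵐ[sphMeasure] g') (hh : h =ᵐ[sphMeasure] h') : tri κ f g h = tri κ f' g' h' := by
  funext x
  refine integral_congr_ae ?_
  filter_upwards [ae_sph3 hf hg hh] with p hp
  simp only [hp.1, hp.2.1, hp.2.2]

lemma tri_sub_left {κ : ℝ} (hκ : 0 < κ) {f f' g h : E3 → ℂ} (hf : Integrable f sphMeasure)
    (hf' : Integrable f' sphMeasure)
    (hg : Integrable g sphMeasure) (hh : Integrable h sphMeasure) (x : E3) :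
    tri κ (fun x => f x - f' x) g h x = tri κ f g h x - tri κ f' g h x := by
  unfold tri
  rw [← integral_sub (integrable_tri hκ hf hg hh x) (integrable_tri hκ hf' hg hh x)]
  congr 1
  funext p
  ring

lemma tri_rotate (κ : ℝ) (f g h : E3 → ℂ) : tri κ f g h = tri κ g h f := by
  funext x
  have h1 : MeasurePreserving (MeasurableEquiv.prodComm : E3 × (E3 × E3) ≃ᵐ (E3 × E3) × E3)
      sph3 ((sphMeasure.prod sphMeasure).prod sphMeasure) := Measure.measurePreserving_swap
  have h2 : MeasurePreserving (MeasurableEquiv.prodAssoc : (E3 × E3) × E3 ≃ᵐ E3 × E3 × E3)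
      ((sphMeasure.prod sphMeasure).prod sphMeasure) sph3 :=
    measurePreserving_prodAssoc sphMeasure sphMeasure sphMeasure
  symm
  unfold tri
  rw [← (h2.comp h1).integral_comp (MeasurableEquiv.measurableEmbedding
    (MeasurableEquiv.prodComm.trans MeasurableEquiv.prodAssoc))]
  congr 1
  funext p
  simp only [Function.comp, MeasurableEquiv.prodComm, MeasurableEquiv.prodAssoc,
    MeasurableEquiv.coe_mk, Equiv.prodComm_apply, Equiv.prodAssoc_apply, Prod.swap]
  rw [show x - p.2.1 - p.2.2 - p.1 = x - p.1 - p.2.1 - p.2.2 by abel]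
  ring

lemma tri_swap (κ : ℝ) (f g h : E3 → ℂ) : tri κ f g h = tri κ f h g := by
  funext x
  have h1 : MeasurePreserving (MeasurableEquiv.prodCongr (MeasurableEquiv.refl E3)
      (MeasurableEquiv.prodComm : E3 × E3 ≃ᵐ E3 × E3)) sph3 sph3 :=
    (MeasurePreserving.id sphMeasure).prod Measure.measurePreserving_swap
  unfold tri
  rw [← h1.integral_comp']
  congr 1
  funext p
  simp only [MeasurableEquiv.prodComm, MeasurableEquiv.prodCongr, MeasurableEquiv.refl,
    MeasurableEquiv.coe_mk, Equiv.prodComm_apply, Equiv.prodCongr_apply, Prod.swap, Prod.map,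
    Equiv.refl_apply]
  rw [show x - p.1 - p.2.2 - p.2.1 = x - p.1 - p.2.1 - p.2.2 by abel]
  ring

lemma tri_comp (κ : ℝ) (Θ : E3 ≃ₗᵢ[ℝ] E3) (f g h : E3 → ℂ) (x : E3) :
    tri κ (f ∘ Θ) (g ∘ Θ) (h ∘ Θ) x = tri κ f g h (Θ x) := by
  have h0 := measurePreserving_sph Θ
  have h1 : MeasurePreserving (MeasurableEquiv.prodCongr Θ.toMeasurableEquiv
      (MeasurableEquiv.prodCongr Θ.toMeasurableEquiv Θ.toMeasurableEquiv)) sph3 sph3 :=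
    h0.prod (h0.prod h0)
  symm
  unfold tri
  rw [← h1.integral_comp']
  congr 1
  funext p
  rw [← bump_isometry κ Θ (x - p.1 - p.2.1 - p.2.2), map_sub, map_sub, map_sub]
  rfl

/-- The rotation operator `f ↦ f ∘ Θ` on `L²(σ)`. -/
def rot (Θ : E3 ≃ₗᵢ[ℝ] E3) : HH →L[ℂ] HH :=
  (Lp.compMeasurePreservingₗᵢ ℂ Θ (measurePreserving_sph Θ)).toContinuousLinearMap

lemma rot_coe (Θ : E3 ≃ₗᵢ[ℝ] E3) (f : HH) : rot Θ f =ᵐ[sphMeasure] f ∘ Θ :=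
  Lp.coeFn_compMeasurePreserving f (measurePreserving_sph Θ)

lemma norm_rot (Θ : E3 ≃ₗᵢ[ℝ] E3) (f : HH) : ‖rot Θ f‖ = ‖f‖ :=
  (Lp.compMeasurePreservingₗᵢ ℂ Θ (measurePreserving_sph Θ)).norm_map f

lemma comp_ae_eq (Θ : E3 ≃ₗᵢ[ℝ] E3) {f g : E3 → ℂ} (h : f =ᵐ[sphMeasure] g) :
    f ∘ Θ =ᵐ[sphMeasure] g ∘ Θ :=
  (measurePreserving_sph Θ).quasiMeasurePreserving.ae_eq_comp h

lemma rot_trans (Θ Ψ : E3 ≃ₗᵢ[ℝ] E3) (f : HH) : rot (Θ.trans Ψ) f = rot Θ (rot Ψ f) := by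
  apply Lp.ext
  refine (rot_coe _ f).trans (((rot_coe Θ _).trans (comp_ae_eq Θ (rot_coe Ψ f))).symm)

lemma triLp_sub_left {κ : ℝ} (hκ : 0 < κ) (f f' g h : HH) :
    triLp hκ (f - f') g h = triLp hκ f g h - triLp hκ f' g h := by
  apply Lp.ext
  refine (triLp_coe _ _ _ _).trans ?_
  rw [tri_congr_ae κ (Lp.coeFn_sub f f') (ae_eq_refl g) (ae_eq_refl h)]
  filter_upwards [triLp_coe hκ f g h, triLp_coe hκ f' g h,
    Lp.coeFn_sub (triLp hκ f g h) (triLp hκ f' g h)] with x h1 h2 h3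
  rw [h3, Pi.sub_apply, h1, h2]
  exact tri_sub_left hκ f.integrable f'.integrable g.integrable h.integrable x

lemma triLp_rotate {κ : ℝ} (hκ : 0 < κ) (f g h : HH) : triLp hκ f g h = triLp hκ g h f := by
  apply Lp.ext
  refine (triLp_coe _ _ _ _).trans ?_
  rw [tri_rotate]
  exact (triLp_coe _ _ _ _).symm

lemma triLp_swap {κ : ℝ} (hκ : 0 < κ) (f g h : HH) : triLp hκ f g h = triLp hκ f h g := by
  apply Lp.ext
  refine (triLp_coe _ _ _ _).trans ?_
  rw [tri_swap]
  exact (triLp_coe _ _ _ _).symm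

lemma triLp_sub_mid {κ : ℝ} (hκ : 0 < κ) (f g g' h : HH) :
    triLp hκ f (g - g') h = triLp hκ f g h - triLp hκ f g' h := by
  simp only [triLp_rotate hκ f, triLp_sub_left]

lemma triLp_sub_right {κ : ℝ} (hκ : 0 < κ) (f g h h' : HH) :
    triLp hκ f g (h - h') = triLp hκ f g h - triLp hκ f g h' := by
  simp only [triLp_swap hκ f g, triLp_sub_mid]

lemma rot_triLp {κ : ℝ} (hκ : 0 < κ) (Θ : E3 ≃ₗᵢ[ℝ] E3) (f g h : HH) :
    rot Θ (triLp hκ f g h) = triLp hκ (rot Θ f) (rot Θ g) (rot Θ h) := by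
  apply Lp.ext
  refine (rot_coe _ _).trans ((comp_ae_eq Θ (triLp_coe _ _ _ _)).trans ?_)
  refine EventuallyEq.trans ?_ (triLp_coe _ _ _ _).symm
  rw [tri_congr_ae κ (rot_coe Θ f) (rot_coe Θ g) (rot_coe Θ h)]
  exact Eventually.of_forall fun x => (tri_comp κ Θ f g h x).symm

/-- The orthogonal group as a topological group. -/
abbrev GG : Type := unitary (E3 →L[ℝ] E3)

instance : ContinuousStar (E3 →L[ℝ] E3) where
  continuous_star := ContinuousLinearMap.adjoint.continuous

instance : CompactSpace GG := by
  refine isCompact_iff_compactSpace.1 (Metric.isCompact_of_isClosed_isBounded isClosed_unitary ?_)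
  refine (isBounded_closedBall (x := (0 : E3 →L[ℝ] E3)) (r := 1)).subset fun U hU => ?_
  simp [CStarRing.norm_of_mem_unitary hU]

/-- A right-invariant measure on the orthogonal group. -/
def haarG : Measure GG := (Measure.haar : Measure GG).inv

instance : haarG.IsMulRightInvariant := by unfold haarG; infer_instance

instance : IsFiniteMeasure haarG where
  measure_univ_lt_top := by
    rw [haarG, Measure.inv_apply]
    exact measure_lt_top _ _

lemma haarG_univ_pos : 0 < haarG Set.univ := by
  rw [haarG, Measure.inv_apply, Set.inv_univ]
  exact isOpen_univ.measure_pos _ Set.univ_nonempty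

/-- The isometry attached to an element of the orthogonal group. -/
def isoG (Ψ : GG) : E3 ≃ₗᵢ[ℝ] E3 := Unitary.linearIsometryEquiv Ψ

lemma O3dist_isoG (Ψ : GG) : O3dist (isoG Ψ) = ‖(Ψ : E3 →L[ℝ] E3) - 1‖ := rfl

/-- The element of the orthogonal group attached to an isometry. -/
def toG (Θ : E3 ≃ₗᵢ[ℝ] E3) : GG := Unitary.linearIsometryEquiv.symm Θ

lemma toG_apply (Θ : E3 ≃ₗᵢ[ℝ] E3) (x : E3) : (toG Θ : E3 →L[ℝ] E3) x = Θ x := rfl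

lemma norm_toG_sub_one (Θ : E3 ≃ₗᵢ[ℝ] E3) : ‖(toG Θ : E3 →L[ℝ] E3) - 1‖ = O3dist Θ := rfl

lemma continuous_actG : Continuous fun p : GG × E3 => (p.1 : E3 →L[ℝ] E3) p.2 :=
  (continuous_subtype_val.comp continuous_fst).clm_apply continuous_snd

lemma lintegral_haarG_act_mul {F : E3 → ℝ≥0∞} (hF : Measurable F) {x : E3} (hx : x ∈ sph) :
    (∫⁻ Ψ : GG, F ((Ψ : E3 →L[ℝ] E3) x) ∂haarG) * sphMeasure Set.univ =
      haarG Set.univ * ∫⁻ y, F y ∂sphMeasure := by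
  have hm : Measurable fun p : E3 × GG => F ((p.2 : E3 →L[ℝ] E3) p.1) :=
    hF.comp (continuous_actG.measurable.comp measurable_swap)
  have h1 : ∫⁻ y, ∫⁻ Ψ : GG, F ((Ψ : E3 →L[ℝ] E3) y) ∂haarG ∂sphMeasure =
      ∫⁻ _, ∫⁻ Ψ : GG, F ((Ψ : E3 →L[ℝ] E3) x) ∂haarG ∂sphMeasure := by
    refine lintegral_congr_ae ?_
    filter_upwards [ae_mem_sph] with y hy
    obtain ⟨Θ, hΘ⟩ := exists_isometry_apply_eq (v := x) (w := y)
      (by rw [norm_eq_one_of_mem_sph hx, norm_eq_one_of_mem_sph hy])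
    rw [← lintegral_mul_right_eq_self (μ := haarG)
      (fun Ψ : GG => F ((Ψ : E3 →L[ℝ] E3) x)) (toG Θ)]
    refine lintegral_congr fun Ψ => ?_
    simp [toG_apply, hΘ]
  rw [lintegral_lintegral_swap hm.aemeasurable, lintegral_const] at h1
  rw [← h1, mul_comm, ← lintegral_const]
  refine lintegral_congr fun Ψ => ?_
  exact (measurePreserving_sph (isoG Ψ)).lintegral_comp hF

lemma haarG_ball_le (A : E3 →L[ℝ] E3) (r : ℝ) :
    haarG {Ψ : GG | ‖(Ψ : E3 →L[ℝ] E3) - A‖ < r} ≤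
      haarG {Ψ : GG | ‖(Ψ : E3 →L[ℝ] E3) - 1‖ < 2 * r} := by
  by_cases h : ∃ Φ : GG, ‖(Φ : E3 →L[ℝ] E3) - A‖ < r
  · obtain ⟨Φ, hΦ⟩ := h
    have h1 : {Ψ : GG | ‖(Ψ : E3 →L[ℝ] E3) - A‖ < r} ⊆
        {Ψ : GG | ‖(Ψ : E3 →L[ℝ] E3) - Φ‖ < 2 * r} := by
      intro Ψ hΨ
      have : (Ψ : E3 →L[ℝ] E3) - Φ = (Ψ - A) - (Φ - A) := by abel
      simp only [Set.mem_ofPred_eq] at hΨ ⊢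
      rw [this]
      exact (norm_sub_le _ _).trans_lt (by linarith)
    refine (measure_mono h1).trans (le_of_eq ?_)
    rw [← measure_preimage_mul_right haarG Φ]
    congr 1
    ext Ψ
    simp only [Set.mem_ofPred_eq, Set.mem_preimage, Submonoid.coe_mul]
    rw [show (Ψ : E3 →L[ℝ] E3) * Φ - Φ = (Ψ - 1) * Φ by rw [sub_mul, one_mul],
      CStarRing.norm_mul_coe_unitary]
  · have : {Ψ : GG | ‖(Ψ : E3 →L[ℝ] E3) - A‖ < r} = ∅ := by
      ext Ψ; simp only [Set.mem_ofPred_eq, Set.mem_empty_iff_false, iff_false]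
      exact fun h' => h ⟨Ψ, h'⟩
    simp [this]

lemma exists_haarG_ball_ge : ∃ c : ℝ, 0 < c ∧ ∃ d : ℕ, ∀ r : ℝ, 0 < r → r ≤ 1 →
    ENNReal.ofReal (c * r ^ d) ≤ haarG {Ψ : GG | ‖(Ψ : E3 →L[ℝ] E3) - 1‖ < 2 * r} := by
  set ν : Measure (E3 →L[ℝ] E3) := Measure.addHaar
  set d := Module.finrank ℝ (E3 →L[ℝ] E3)
  set V := ν (ball 0 1)
  have hV0 : V ≠ 0 := (isOpen_ball.measure_pos ν (nonempty_ball.2 one_pos)).ne'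
  have hVt : V ≠ ⊤ := measure_ball_lt_top.ne
  have hB0 : ν (ball 0 2) ≠ 0 := (isOpen_ball.measure_pos ν (nonempty_ball.2 two_pos)).ne'
  have hBt : ν (ball 0 2) ≠ ⊤ := measure_ball_lt_top.ne
  set c₀ := haarG Set.univ * V / ν (ball 0 2)
  have hc₀ : c₀ ≠ ⊤ := ENNReal.div_ne_top (ENNReal.mul_ne_top (measure_ne_top _ _) hVt) hB0
  have hc₀' : c₀ ≠ 0 := by
    simp only [c₀, ne_eq, ENNReal.div_eq_zero_iff, mul_eq_zero, not_or]
    exact ⟨⟨haarG_univ_pos.ne', hV0⟩, hBt⟩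
  refine ⟨c₀.toReal, ENNReal.toReal_pos hc₀' hc₀, d, fun r hr hr1 => ?_⟩
  rw [ENNReal.ofReal_mul ENNReal.toReal_nonneg, ENNReal.ofReal_toReal hc₀]
  have hopen : IsOpen {p : GG × (E3 →L[ℝ] E3) | ‖(p.1 : E3 →L[ℝ] E3) - p.2‖ < r} :=
    isOpen_lt (by fun_prop) continuous_const
  have e1 : (haarG.prod ν) {p : GG × (E3 →L[ℝ] E3) | ‖(p.1 : E3 →L[ℝ] E3) - p.2‖ < r} =
      haarG Set.univ * (ENNReal.ofReal (r ^ d) * V) := by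
    rw [Measure.prod_apply hopen.measurableSet, mul_comm (haarG Set.univ), ← lintegral_const]
    refine lintegral_congr fun Ψ => ?_
    rw [← Measure.addHaar_ball ν (Ψ : E3 →L[ℝ] E3) hr.le]
    congr 1
    ext A
    simp [dist_eq_norm, norm_sub_rev]
  have e2 : (haarG.prod ν) {p : GG × (E3 →L[ℝ] E3) | ‖(p.1 : E3 →L[ℝ] E3) - p.2‖ < r} ≤
      haarG {Ψ : GG | ‖(Ψ : E3 →L[ℝ] E3) - 1‖ < 2 * r} * ν (ball 0 2) := by
    rw [Measure.prod_apply_symm hopen.measurableSet, ← setLIntegral_const,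
      ← lintegral_indicator measurableSet_ball]
    refine lintegral_mono fun A => ?_
    by_cases hA : A ∈ ball (0 : E3 →L[ℝ] E3) 2
    · simp only [Set.indicator_of_mem hA]
      exact haarG_ball_le A r
    · simp only [Set.indicator_of_notMem hA, nonpos_iff_eq_zero]
      convert measure_empty (μ := haarG)
      ext Ψ
      simp only [Set.mem_preimage, Set.mem_ofPred_eq, Set.mem_empty_iff_false, iff_false, not_lt]
      rw [mem_ball_zero_iff, not_lt] at hA
      have h1 : ‖(Ψ : E3 →L[ℝ] E3)‖ = 1 := CStarRing.norm_coe_unitary Ψ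
      have := norm_sub_norm_le A (Ψ : E3 →L[ℝ] E3)
      rw [norm_sub_rev] at this
      linarith
  rw [e1] at e2
  simp only [c₀]
  rw [ENNReal.div_eq_inv_mul, mul_assoc, ENNReal.inv_mul_le_iff hB0 hBt]
  calc _ = haarG Set.univ * (ENNReal.ofReal (r ^ d) * V) := by ring
    _ ≤ _ := e2
    _ = _ := mul_comm _ _

/-- The unnormalized cutoff on the orthogonal group at scale `l`. -/
@[irreducible] def cutG (l : ℝ) (Ψ : GG) : ℝ := max 0 (l - ‖(Ψ : E3 →L[ℝ] E3) - 1‖)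

lemma cutG_nonneg (l : ℝ) (Ψ : GG) : 0 ≤ cutG l Ψ := by
  unfold cutG; exact le_max_left _ _

lemma cutG_le_abs (l : ℝ) (Ψ : GG) : cutG l Ψ ≤ |l| := by
  unfold cutG
  exact max_le (abs_nonneg _) ((sub_le_self _ (norm_nonneg _)).trans (le_abs_self _))

lemma cutG_le {l : ℝ} (hl : 0 ≤ l) (Ψ : GG) : cutG l Ψ ≤ l :=
  (cutG_le_abs l Ψ).trans (abs_of_nonneg hl).le

lemma continuous_cutG (l : ℝ) : Continuous (cutG l) := by unfold cutG; fun_prop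

lemma abs_cutG_sub_le (l : ℝ) (Ψ Φ : GG) :
    |cutG l Ψ - cutG l Φ| ≤ ‖(Ψ : E3 →L[ℝ] E3) - Φ‖ := by
  unfold cutG
  rw [max_comm 0, max_comm 0]
  refine (abs_max_sub_max_le_abs _ _ _).trans ?_
  rw [sub_sub_sub_cancel_left, abs_sub_comm]
  refine (abs_norm_sub_norm_le _ _).trans (le_of_eq ?_)
  rw [sub_sub_sub_cancel_right]

lemma integrable_cutG (l : ℝ) : Integrable (cutG l) haarG :=
  (continuous_cutG l).integrable_of_hasCompactSupport (HasCompactSupport.of_compactSpace _)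

lemma integrable_cutG_smul (l : ℝ) {X : GG → ℂ} (hX : Integrable X haarG) {g : GG → GG}
    (hg : Continuous g) : Integrable (fun Ψ => cutG l (g Ψ) • X Ψ) haarG := by
  refine Integrable.bdd_smul (𝕜 := ℝ) (φ := fun Ψ => cutG l (g Ψ)) hX |l|
    ((continuous_cutG l).comp hg).aestronglyMeasurable (Eventually.of_forall fun Ψ => ?_)
  rw [Real.norm_of_nonneg (cutG_nonneg _ _)]
  exact cutG_le_abs _ _

lemma exists_integral_cutG_ge : ∃ c : ℝ, 0 < c ∧ ∃ d : ℕ, ∀ l : ℝ, 0 < l → l ≤ 1 →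
    c * l ^ d ≤ ∫ Ψ, cutG l Ψ ∂haarG := by
  obtain ⟨c, hc, d, h⟩ := exists_haarG_ball_ge
  refine ⟨c * (1 / 4) ^ d * (1 / 2), by positivity, d + 1, fun l hl hl1 => ?_⟩
  have h1 := h (l / 4) (by positivity) (by linarith)
  set B : Set GG := {Ψ : GG | ‖(Ψ : E3 →L[ℝ] E3) - 1‖ < 2 * (l / 4)}
  have hB : MeasurableSet B := (isOpen_lt (by fun_prop) continuous_const).measurableSet
  have h2 : c * (l / 4) ^ d ≤ haarG.real B :=
    (ENNReal.ofReal_le_iff_le_toReal (measure_ne_top _ _)).1 h1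
  calc c * (1 / 4) ^ d * (1 / 2) * l ^ (d + 1) = l / 2 * (c * (l / 4) ^ d) := by
        rw [div_pow, div_pow, one_pow]; ring
    _ ≤ l / 2 * haarG.real B := by gcongr
    _ = ∫ Ψ in B, l / 2 ∂haarG := by simp [mul_comm]
    _ ≤ ∫ Ψ in B, cutG l Ψ ∂haarG := by
        refine setIntegral_mono_on (by simp) (integrable_cutG l).integrableOn hB fun Ψ hΨ => ?_
        rw [cutG]
        refine le_max_of_le_right ?_
        have : ‖(Ψ : E3 →L[ℝ] E3) - 1‖ < 2 * (l / 4) := hΨ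
        linarith
    _ ≤ ∫ Ψ, cutG l Ψ ∂haarG :=
        setIntegral_le_integral (integrable_cutG l) (Eventually.of_forall (cutG_nonneg l))

/-- Averages of `f` over rotations at scale `l`. -/
def moll (l : ℝ) (f : E3 → ℂ) (x : E3) : ℂ :=
  (∫ Ψ, cutG l Ψ ∂haarG)⁻¹ • ∫ Ψ : GG, cutG l Ψ • f ((Ψ : E3 →L[ℝ] E3) x) ∂haarG

lemma stronglyMeasurable_moll (l : ℝ) {f : E3 → ℂ} (hf : StronglyMeasurable f) :
    StronglyMeasurable (moll l f) := by
  have h : StronglyMeasurable fun p : E3 × GG => cutG l p.2 • f ((p.2 : E3 →L[ℝ] E3) p.1) :=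
    ((continuous_cutG l).stronglyMeasurable.comp_measurable measurable_snd).smul
    (hf.comp_measurable (continuous_actG.measurable.comp measurable_swap))
  exact (h.integral_prod_right' (ν := haarG)).const_smul (∫ Ψ, cutG l Ψ ∂haarG)⁻¹

lemma lintegral_act_le {F : E3 → ℝ≥0∞} (hF : Measurable F) {x : E3} (hx : x ∈ sph)
    (h0 : sphMeasure Set.univ ≠ 0) :
    ∫⁻ Ψ : GG, F ((Ψ : E3 →L[ℝ] E3) x) ∂haarG =
      haarG Set.univ / sphMeasure Set.univ * ∫⁻ y, F y ∂sphMeasure := by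
  have := lintegral_haarG_act_mul hF hx
  rw [ENNReal.div_eq_inv_mul, mul_assoc, ← this, mul_comm, mul_assoc,
    ENNReal.mul_inv_cancel h0 (measure_ne_top _ _), mul_one]

lemma exists_l1_act_bound (h0 : sphMeasure Set.univ ≠ 0) : ∃ C : ℝ, 0 ≤ C ∧ ∀ f : HH, ∀ x ∈ sph,
    Integrable (fun Ψ : GG => f ((Ψ : E3 →L[ℝ] E3) x)) haarG ∧
      ∫ Ψ : GG, ‖f ((Ψ : E3 →L[ℝ] E3) x)‖ ∂haarG ≤ C * ‖f‖ := by
  set K := haarG Set.univ / sphMeasure Set.univ * nrm (fun _ => 1)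
  have hK : K ≠ ⊤ := ENNReal.mul_ne_top (ENNReal.div_ne_top (measure_ne_top _ _) h0)
    nrm_one_lt_top.ne
  refine ⟨K.toReal, ENNReal.toReal_nonneg, fun f x hx => ?_⟩
  have hsm : StronglyMeasurable fun Ψ : GG => f ((Ψ : E3 →L[ℝ] E3) x) :=
    (Lp.stronglyMeasurable f).comp_measurable
      (continuous_actG.comp (by fun_prop : Continuous fun Ψ : GG => (Ψ, x))).measurable
  have hle : ∫⁻ Ψ : GG, ‖f ((Ψ : E3 →L[ℝ] E3) x)‖ₑ ∂haarG ≤ K * ‖f‖ₑ := by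
    rw [lintegral_act_le (F := fun y => ‖f y‖ₑ) f.measurable_enorm hx h0, ← f.nrm_eq]
    calc _ ≤ haarG Set.univ / sphMeasure Set.univ *
          (nrm (fun y => ‖f y‖ₑ) * nrm (fun _ => 1)) := by
          gcongr
          exact lintegral_le_nrm f.measurable_enorm
      _ = _ := by ring
  refine ⟨⟨hsm.aestronglyMeasurable, hle.trans_lt (ENNReal.mul_lt_top hK.lt_top enorm_lt_top)⟩, ?_⟩
  rw [integral_norm_eq_lintegral_enorm hsm.aestronglyMeasurable]
  refine (ENNReal.toReal_mono (ENNReal.mul_ne_top hK enorm_ne_top) hle).trans (le_of_eq ?_)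
  rw [ENNReal.toReal_mul, toReal_enorm]

lemma moll_comp (l : ℝ) (f : E3 → ℂ) (Θ : E3 ≃ₗᵢ[ℝ] E3) (x : E3) :
    moll l f (Θ x) = (∫ Ψ, cutG l Ψ ∂haarG)⁻¹ •
      ∫ Ψ : GG, cutG l (Ψ * (toG Θ)⁻¹) • f ((Ψ : E3 →L[ℝ] E3) x) ∂haarG := by
  rw [moll]
  congr 1
  rw [← integral_mul_right_eq_self (μ := haarG)
    (fun Ψ : GG => cutG l (Ψ * (toG Θ)⁻¹) • f ((Ψ : E3 →L[ℝ] E3) x)) (toG Θ)]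
  simp [toG_apply]

lemma abs_cutG_mul_sub_le (l : ℝ) (Θ : E3 ≃ₗᵢ[ℝ] E3) (Ψ : GG) :
    |cutG l (Ψ * (toG Θ)⁻¹) - cutG l Ψ| ≤ O3dist Θ := by
  refine (abs_cutG_sub_le _ _ _).trans (le_of_eq ?_)
  rw [← norm_toG_sub_one, ← CStarRing.norm_mul_coe_unitary _ (toG Θ), sub_mul,
    ← Submonoid.coe_mul, ← Submonoid.coe_mul, inv_mul_cancel_right, norm_sub_rev,
    Submonoid.coe_mul]
  rw [show (Ψ : E3 →L[ℝ] E3) * toG Θ - Ψ = Ψ * (toG Θ - 1) by rw [mul_sub, mul_one],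
      CStarRing.norm_coe_unitary_mul]

set_option maxHeartbeats 2000000 in
lemma eLpNorm_moll_sub_le {l : ℝ} (hZ : 0 < ∫ Ψ, cutG l Ψ ∂haarG)
    (h0 : sphMeasure Set.univ ≠ 0) (f : HH) {E : ℝ}
    (hE : ∀ Θ, O3dist Θ ≤ l → ‖rot Θ f - f‖ ≤ E) :
    eLpNorm (fun x => moll l f x - f x) 2 sphMeasure ≤ ENNReal.ofReal E := by
  obtain ⟨C, hC, hInt⟩ := exists_l1_act_bound h0
  set Z := ∫ Ψ, cutG l Ψ ∂haarG with hZdef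
  set k : GG → ℝ≥0∞ := fun Ψ => ENNReal.ofReal (Z⁻¹ * cutG l Ψ) with hk
  have hkm : Measurable k := by
    have := (continuous_cutG l).measurable
    fun_prop
  have hk1 : ∫⁻ Ψ, k Ψ ∂haarG = 1 := by
    rw [hk, ← ofReal_integral_eq_lintegral_ofReal ((integrable_cutG l).const_mul _)
      (Eventually.of_forall fun Ψ => mul_nonneg (inv_nonneg.2 hZ.le) (cutG_nonneg _ _)),
      integral_const_mul, ← hZdef, inv_mul_cancel₀ hZ.ne', ENNReal.ofReal_one]
  set P : Measure GG := haarG.withDensity k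
  have hP : P Set.univ = 1 := by simp [P, hk1]
  have : IsProbabilityMeasure P := ⟨hP⟩
  have hm2 : Measurable fun p : E3 × GG => ‖f ((p.2 : E3 →L[ℝ] E3) p.1) - f p.1‖ₑ := by
    have hf := (Lp.stronglyMeasurable f).measurable
    exact ((hf.comp (continuous_actG.measurable.comp measurable_swap)).sub
      (hf.comp measurable_fst)).enorm
  have hm1 : ∀ x, Measurable fun Ψ : GG => ‖f ((Ψ : E3 →L[ℝ] E3) x) - f x‖ₑ := fun x =>
    hm2.comp (measurable_const.prodMk measurable_id)
  have hpt : ∀ x ∈ sph, ‖moll l f x - f x‖ₑ ^ (2 : ℝ) ≤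
      ∫⁻ Ψ : GG, ‖f ((Ψ : E3 →L[ℝ] E3) x) - f x‖ₑ ^ (2 : ℝ) ∂P := by
    intro x hx
    have hi := (hInt f x hx).1
    have hi' : Integrable (fun Ψ : GG => cutG l Ψ • f ((Ψ : E3 →L[ℝ] E3) x)) haarG :=
      integrable_cutG_smul l hi continuous_id
    have e1 : moll l f x - f x = ∫ Ψ : GG, (Z⁻¹ * cutG l Ψ) • (f ((Ψ : E3 →L[ℝ] E3) x) - f x)
        ∂haarG := by
      have : ∀ Ψ : GG, (Z⁻¹ * cutG l Ψ) • (f ((Ψ : E3 →L[ℝ] E3) x) - f x) =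
          Z⁻¹ • (cutG l Ψ • f ((Ψ : E3 →L[ℝ] E3) x)) - Z⁻¹ • (cutG l Ψ • f x) := fun Ψ => by
        rw [mul_smul, smul_sub, smul_sub]
      simp only [this]
      have j1 : Integrable (fun Ψ : GG => Z⁻¹ • (cutG l Ψ • f ((Ψ : E3 →L[ℝ] E3) x))) haarG :=
        hi'.smul Z⁻¹
      have j2 : Integrable (fun Ψ : GG => Z⁻¹ • (cutG l Ψ • f x)) haarG :=
        ((integrable_cutG l).smul_const (f x)).smul Z⁻¹
      rw [integral_sub j1 j2,
        integral_smul, integral_smul, integral_smul_const, ← hZdef, smul_smul Z⁻¹ Z,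
        inv_mul_cancel₀ hZ.ne', one_smul]
      rfl
    have e2 : ‖moll l f x - f x‖ₑ ≤ ∫⁻ Ψ : GG, ‖f ((Ψ : E3 →L[ℝ] E3) x) - f x‖ₑ ∂P := by
      rw [e1]
      refine (enorm_integral_le_lintegral_enorm _).trans (le_of_eq ?_)
      rw [lintegral_withDensity_eq_lintegral_mul _ hkm (hm1 x)]
      refine lintegral_congr fun Ψ => ?_
      rw [enorm_smul, Pi.mul_apply, hk]
      congr 1
      rw [← ofReal_norm, Real.norm_of_nonneg
        (mul_nonneg (inv_nonneg.2 hZ.le) (cutG_nonneg _ _))]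
    have e3 := ENNReal.lintegral_mul_le_Lp_mul_Lq P (p := 2) (q := 2)
      (by constructor <;> norm_num) (hm1 x).aemeasurable (g := fun _ => 1) (by fun_prop)
    simp only [Pi.mul_apply, mul_one, ENNReal.one_rpow, lintegral_const, hP] at e3
    calc _ ≤ _ := ENNReal.rpow_le_rpow (e2.trans e3) (by norm_num)
      _ = _ := by rw [← ENNReal.rpow_mul]; norm_num
  rw [← nrm_enorm, nrm]
  rw [show ENNReal.ofReal E = (ENNReal.ofReal E ^ (2 : ℝ)) ^ (1 / 2 : ℝ) by
    rw [← ENNReal.rpow_mul]; norm_num]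
  gcongr ?_ ^ _
  calc ∫⁻ x, ‖moll l f x - f x‖ₑ ^ (2 : ℝ) ∂sphMeasure
      ≤ ∫⁻ x, ∫⁻ Ψ : GG, ‖f ((Ψ : E3 →L[ℝ] E3) x) - f x‖ₑ ^ (2 : ℝ) ∂P ∂sphMeasure := by
        refine lintegral_mono_ae ?_
        filter_upwards [ae_mem_sph] with x hx using hpt x hx
    _ = ∫⁻ Ψ : GG, ∫⁻ x, ‖f ((Ψ : E3 →L[ℝ] E3) x) - f x‖ₑ ^ (2 : ℝ) ∂sphMeasure ∂P :=
        lintegral_lintegral_swap (hm2.pow_const _).aemeasurable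
    _ = ∫⁻ Ψ : GG, k Ψ * ∫⁻ x, ‖f ((Ψ : E3 →L[ℝ] E3) x) - f x‖ₑ ^ (2 : ℝ) ∂sphMeasure ∂haarG := by
        rw [lintegral_withDensity_eq_lintegral_mul _ hkm]
        · rfl
        · exact Measurable.lintegral_prod_left' (f := fun p : E3 × GG =>
            ‖f ((p.2 : E3 →L[ℝ] E3) p.1) - f p.1‖ₑ ^ (2 : ℝ)) (hm2.pow_const _)
    _ ≤ ∫⁻ Ψ : GG, k Ψ * ENNReal.ofReal E ^ (2 : ℝ) ∂haarG := by
        refine lintegral_mono fun Ψ => ?_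
        by_cases hΨ : O3dist (isoG Ψ) ≤ l
        · gcongr
          rw [← nrm_sq, ENNReal.rpow_two, sq]
          have : nrm (fun x => ‖f ((Ψ : E3 →L[ℝ] E3) x) - f x‖ₑ) ≤ ENNReal.ofReal E := by
            rw [nrm_enorm]
            have := hE _ hΨ
            rw [Lp.norm_def] at this
            have h' := ENNReal.le_ofReal_iff_toReal_le (Lp.eLpNorm_ne_top (rot (isoG Ψ) f - f))
              ((ENNReal.toReal_nonneg).trans this) |>.2 this
            have hae : (fun x => f ((Ψ : E3 →L[ℝ] E3) x) - f x) =ᵐ[sphMeasure]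
                ⇑(rot (isoG Ψ) f - f) := ?_
            · rw [eLpNorm_congr_ae hae]; exact h'
            symm
            filter_upwards [Lp.coeFn_sub (rot (isoG Ψ) f) f, rot_coe (isoG Ψ) f] with x h1 h2
            rw [h1, Pi.sub_apply, h2]
            rfl
          gcongr
        · have : k Ψ = 0 := by
            rw [O3dist_isoG] at hΨ
            have : cutG l Ψ = 0 := by rw [cutG]; exact max_eq_left (by linarith)
            simp [hk, this]
          simp [this]
    _ = _ := by rw [lintegral_mul_const _ hkm, hk1, one_mul]

lemma exists_mollification : ∃ C : ℝ, 0 ≤ C ∧ ∃ d : ℕ, ∀ l : ℝ, 0 < l → l ≤ 1 → ∀ f : HH,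
    ∃ u : E3 → ℂ, StronglyMeasurable u ∧ (∀ x ∈ sph, ‖u x‖ ≤ C * l⁻¹ ^ d * ‖f‖) ∧
      (∀ x ∈ sph, ∀ Θ, ‖u (Θ x) - u x‖ ≤ C * l⁻¹ ^ d * ‖f‖ * O3dist Θ) ∧
      ∀ E : ℝ, (∀ Θ, O3dist Θ ≤ l → ‖rot Θ f - f‖ ≤ E) →
        eLpNorm (fun x => u x - f x) 2 sphMeasure ≤ ENNReal.ofReal E := by
  by_cases h0 : sphMeasure Set.univ = 0
  · refine ⟨0, le_rfl, 0, fun l _ _ f => ⟨fun _ => 0, stronglyMeasurable_const, by simp, by simp,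
      fun E _ => ?_⟩⟩
    have hz : ∀ᵐ x ∂sphMeasure, (fun _ => (0 : ℂ)) x - f x = 0 := by
      rw [ae_iff]
      exact measure_mono_null (Set.subset_univ _) h0
    rw [eLpNorm_congr_ae hz]
    simp
  obtain ⟨c, hc, d, hZ⟩ := exists_integral_cutG_ge
  obtain ⟨C, hC, hInt⟩ := exists_l1_act_bound h0
  refine ⟨c⁻¹ * C, by positivity, d, fun l hl hl1 f => ⟨moll l f,
    stronglyMeasurable_moll l (Lp.stronglyMeasurable f), fun x hx => ?_, fun x hx Θ => ?_,
    fun E hE => eLpNorm_moll_sub_le ((by positivity : 0 < c * l ^ d).trans_le (hZ l hl hl1))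
      h0 f hE⟩⟩
  all_goals
    obtain ⟨hi, hb⟩ := hInt f x hx
    have hZ' := hZ l hl hl1
    have hZ0 : 0 < c * l ^ d := by positivity
    have hinv : (∫ Ψ, cutG l Ψ ∂haarG)⁻¹ ≤ c⁻¹ * l⁻¹ ^ d := by
      rw [inv_pow, ← mul_inv]; exact inv_anti₀ hZ0 hZ'
    have hinv0 : 0 ≤ (∫ Ψ, cutG l Ψ ∂haarG)⁻¹ := inv_nonneg.2 (hZ0.le.trans hZ')
  · rw [moll, norm_smul, Real.norm_of_nonneg hinv0]
    have : ‖∫ Ψ : GG, cutG l Ψ • f ((Ψ : E3 →L[ℝ] E3) x) ∂haarG‖ ≤ C * ‖f‖ := by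
      refine le_trans (norm_integral_le_of_norm_le hi.norm (Eventually.of_forall fun Ψ => ?_)) hb
      rw [norm_smul, Real.norm_of_nonneg (cutG_nonneg _ _)]
      exact mul_le_of_le_one_left (norm_nonneg _) ((cutG_le hl.le _).trans hl1)
    calc _ ≤ c⁻¹ * l⁻¹ ^ d * (C * ‖f‖) := by gcongr
      _ = _ := by ring
  · rw [moll_comp, moll, ← smul_sub, norm_smul, Real.norm_of_nonneg hinv0,
      ← integral_sub (integrable_cutG_smul l hi (g := fun Ψ => Ψ * (toG Θ)⁻¹) (by fun_prop))
        (integrable_cutG_smul l hi (g := fun Ψ => Ψ) (by fun_prop))]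
    have : ‖∫ Ψ : GG, (cutG l (Ψ * (toG Θ)⁻¹) • f ((Ψ : E3 →L[ℝ] E3) x) -
        cutG l Ψ • f ((Ψ : E3 →L[ℝ] E3) x)) ∂haarG‖ ≤ O3dist Θ * (C * ‖f‖) := by
      refine le_trans (norm_integral_le_of_norm_le (hi.norm.const_mul (O3dist Θ))
        (Eventually.of_forall fun Ψ => ?_)) ?_
      · rw [← sub_smul, norm_smul]
        gcongr
        exact abs_cutG_mul_sub_le l Θ Ψ
      · rw [integral_const_mul]
        gcongr
        exact norm_nonneg _
    calc _ ≤ c⁻¹ * l⁻¹ ^ d * (O3dist Θ * (C * ‖f‖)) := by gcongr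
      _ = _ := by ring

/-- Bounded functions on the sphere that are Lipschitz along rotations. -/
structure RLip (B L : ℝ) (c : E3 → ℂ) : Prop where
  meas : StronglyMeasurable c
  bound : ∀ x ∈ sph, ‖c x‖ ≤ B
  lip : ∀ x ∈ sph, ∀ Θ : E3 ≃ₗᵢ[ℝ] E3, ‖c (Θ x) - c x‖ ≤ L * O3dist Θ

lemma O3dist_nonneg (Θ : E3 ≃ₗᵢ[ℝ] E3) : 0 ≤ O3dist Θ := norm_nonneg _

lemma norm_apply_sub_le (Θ : E3 ≃ₗᵢ[ℝ] E3) (x : E3) : ‖Θ x - x‖ ≤ O3dist Θ * ‖x‖ :=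
  ContinuousLinearMap.le_opNorm
    (Θ.toLinearIsometry.toContinuousLinearMap - ContinuousLinearMap.id ℝ E3) x

lemma isometry_mem_sph (Θ : E3 ≃ₗᵢ[ℝ] E3) {x : E3} (hx : x ∈ sph) : Θ x ∈ sph := by
  simp only [sph, mem_sphere_zero_iff_norm, LinearIsometryEquiv.norm_map] at hx ⊢
  exact hx

lemma sph_nonempty : ∃ x : E3, x ∈ sph :=
  ⟨EuclideanSpace.single 0 1, by simp [sph]⟩

lemma RLip.bound_nonneg {B L : ℝ} {c : E3 → ℂ} (hc : RLip B L c) : 0 ≤ B := by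
  obtain ⟨x, hx⟩ := sph_nonempty
  exact (norm_nonneg _).trans (hc.bound x hx)

lemma RLip.mono {B L B' L' : ℝ} {c : E3 → ℂ} (hc : RLip B L c) (hB : B ≤ B') (hL : L ≤ L') :
    RLip B' L' c :=
  ⟨hc.meas, fun x hx => (hc.bound x hx).trans hB, fun x hx Θ =>
    (hc.lip x hx Θ).trans (mul_le_mul_of_nonneg_right hL (O3dist_nonneg Θ))⟩

lemma RLip.mul {B L B' L' : ℝ} {c c' : E3 → ℂ} (hc : RLip B L c) (hc' : RLip B' L' c') :
    RLip (B * B') (B * L' + L * B') (fun x => c x * c' x) := by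
  refine ⟨hc.meas.mul hc'.meas, fun x hx => ?_, fun x hx Θ => ?_⟩
  · rw [norm_mul]
    exact mul_le_mul (hc.bound x hx) (hc'.bound x hx) (norm_nonneg _) hc.bound_nonneg
  · have e : c (Θ x) * c' (Θ x) - c x * c' x =
        c (Θ x) * (c' (Θ x) - c' x) + (c (Θ x) - c x) * c' x := by ring
    rw [e, add_mul]
    refine (norm_add_le _ _).trans (add_le_add ?_ ?_)
    · rw [norm_mul, mul_assoc]
      exact mul_le_mul (hc.bound _ (isometry_mem_sph Θ hx)) (hc'.lip x hx Θ) (norm_nonneg _)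
        hc.bound_nonneg
    · rw [norm_mul, mul_right_comm]
      exact mul_le_mul (hc.lip x hx Θ) (hc'.bound x hx) (norm_nonneg _)
        ((norm_nonneg _).trans (hc.lip x hx Θ))

lemma RLip.of_lipschitz {B L : ℝ} {c : E3 → ℝ} (hm : Measurable c) (hB : ∀ x ∈ sph, |c x| ≤ B)
    (hL : ∀ x ∈ sph, ∀ y ∈ sph, |c x - c y| ≤ L * ‖x - y‖) (hL0 : 0 ≤ L) :
    RLip B L (fun x => (c x : ℂ)) := by
  refine ⟨(Complex.measurable_ofReal.comp hm).stronglyMeasurable, fun x hx => ?_,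
    fun x hx Θ => ?_⟩
  · rw [Complex.norm_real]; exact hB x hx
  · rw [← Complex.ofReal_sub, Complex.norm_real]
    refine (hL _ (isometry_mem_sph Θ hx) x hx).trans ?_
    have := norm_apply_sub_le Θ x
    rw [norm_eq_one_of_mem_sph hx, mul_one] at this
    gcongr

lemma rlip_inner (b : E3) : RLip ‖b‖ ‖b‖ (fun x => ((⟪b, x⟫ : ℝ) : ℂ)) := by
  refine RLip.of_lipschitz (by fun_prop) (fun x hx => ?_) (fun x _ y _ => ?_) (norm_nonneg _)
  · simpa [norm_eq_one_of_mem_sph hx] using abs_real_inner_le_norm b x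
  · rw [← inner_sub_right]; exact abs_real_inner_le_norm _ _

lemma RLip.integrable {B L : ℝ} {c : E3 → ℂ} (hc : RLip B L c) : Integrable c sphMeasure :=
  Integrable.of_bound hc.meas.aestronglyMeasurable B
    (ae_mem_sph.mono fun x hx => hc.bound x hx)

instance : NormedAlgebra ℚ (E3 →L[ℝ] E3) := NormedAlgebra.restrictScalars ℚ ℝ _

lemma norm_unitary_le (Ψ : GG) : ‖(Ψ : E3 →L[ℝ] E3)‖ ≤ 1 :=
  (CStarRing.norm_of_mem_unitary Ψ.2).le

/-- The one-parameter group generated by a skew-adjoint map. -/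
def flow {A : E3 →L[ℝ] E3} (hA : A ∈ skewAdjoint (E3 →L[ℝ] E3)) (t : ℝ) : GG :=
  ⟨NormedSpace.exp (t • A), NormedSpace.exp_mem_unitary_of_mem_skewAdjoint
    (skewAdjoint.smul_mem t hA)⟩

lemma hasDerivAt_flow {A : E3 →L[ℝ] E3} (hA : A ∈ skewAdjoint (E3 →L[ℝ] E3)) (t : ℝ) :
    HasDerivAt (fun t => (flow hA t : E3 →L[ℝ] E3)) (A * (flow hA t : E3 →L[ℝ] E3)) t :=
  hasDerivAt_exp_smul_const' A t

lemma flow_zero {A : E3 →L[ℝ] E3} (hA : A ∈ skewAdjoint (E3 →L[ℝ] E3)) :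
    (flow hA 0 : E3 →L[ℝ] E3) = 1 := by
  have : (0 : ℝ) • A = 0 := zero_smul ℝ A
  change NormedSpace.exp ((0 : ℝ) • A) = 1
  rw [this, NormedSpace.exp_zero]

lemma norm_flow_sub_one_le {A : E3 →L[ℝ] E3} (hA : A ∈ skewAdjoint (E3 →L[ℝ] E3)) (t : ℝ) :
    ‖(flow hA t : E3 →L[ℝ] E3) - 1‖ ≤ ‖A‖ * |t| := by
  have := convex_univ.norm_image_sub_le_of_norm_hasDerivWithin_le (𝕜 := ℝ)
    (f := fun t => (flow hA t : E3 →L[ℝ] E3)) (C := ‖A‖) (x := 0) (y := t)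
    (fun t _ => (hasDerivAt_flow hA t).hasDerivWithinAt) (fun t _ => ?_) trivial trivial
  · simpa [flow_zero] using this
  · refine (norm_mul_le _ _).trans ?_
    exact mul_le_of_le_one_right (norm_nonneg _) (norm_unitary_le _)

lemma integral_skew_deriv_le {A : E3 →L[ℝ] E3} (hA : A ∈ skewAdjoint (E3 →L[ℝ] E3))
    {F : E3 → ℝ} (hF : ContDiff ℝ 1 F) {B L : ℝ} {c : E3 → ℂ} (hc : RLip B L c) (hL : 0 ≤ L) :
    ‖∫ y, ((fderiv ℝ F y (A y) : ℝ) : ℂ) * c y ∂sphMeasure‖ ≤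
      L * ‖A‖ * ∫ y, |F y| ∂sphMeasure := by
  have hF' : Continuous fun y => fderiv ℝ F y := hF.continuous_fderiv (by norm_num)
  obtain ⟨M, hM⟩ := (isCompact_closedBall (0 : E3) 1).exists_bound_of_continuousOn
    hF'.norm.continuousOn
  obtain ⟨M0, hM0⟩ := (isCompact_closedBall (0 : E3) 1).exists_bound_of_continuousOn
    hF.continuous.continuousOn
  simp only [norm_norm] at hM
  have hB0 := hc.bound_nonneg
  have hs : ∀ (Ψ : GG) {y}, y ∈ sph → (Ψ : E3 →L[ℝ] E3) y ∈ closedBall (0 : E3) 1 := by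
    intro Ψ y hy
    exact sphere_subset_closedBall (isometry_mem_sph (isoG Ψ) hy)
  have hFi : Integrable (fun y => |F y|) sphMeasure := by
    refine Integrable.of_bound hF.continuous.abs.aestronglyMeasurable M0
      (ae_mem_sph.mono fun x hx => ?_)
    simpa using hM0 x (sphere_subset_closedBall hx)
  have hFm : ∀ Ψ : GG, Continuous fun y => ((F ((Ψ : E3 →L[ℝ] E3) y) : ℝ) : ℂ) := fun Ψ =>
    Complex.continuous_ofReal.comp (hF.continuous.comp (Ψ : E3 →L[ℝ] E3).continuous)
  have hFc : ∀ Ψ : GG, Integrable (fun y => ((F ((Ψ : E3 →L[ℝ] E3) y) : ℝ) : ℂ) * c y)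
      sphMeasure := fun Ψ => by
    refine hc.integrable.bdd_mul (c := M0) (hFm Ψ).aestronglyMeasurable
      (ae_mem_sph.mono fun y hy => ?_)
    rw [Complex.norm_real]
    exact hM0 _ (hs Ψ hy)
  have hder : ∀ (y : E3) (t : ℝ), HasDerivAt
      (fun t => ((F ((flow hA t : E3 →L[ℝ] E3) y) : ℝ) : ℂ) * c y)
      (((fderiv ℝ F ((flow hA t : E3 →L[ℝ] E3) y) (A ((flow hA t : E3 →L[ℝ] E3) y)) : ℝ) : ℂ)
        * c y) t := fun y t => by
    refine HasDerivAt.mul_const (HasDerivAt.ofReal_comp ?_) _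
    have h1 : HasDerivAt (fun t => (flow hA t : E3 →L[ℝ] E3) y)
        (A ((flow hA t : E3 →L[ℝ] E3) y)) t := by
      simpa using (hasDerivAt_flow hA t).clm_apply (hasDerivAt_const t y)
    exact ((hF.differentiable (by norm_num)) _).hasFDerivAt.comp_hasDerivAt t h1
  have hd := (hasDerivAt_integral_of_dominated_loc_of_deriv_le (μ := sphMeasure) (x₀ := (0 : ℝ))
    (s := Set.univ) (bound := fun _ => M * ‖A‖ * B)
    (F := fun t y => ((F ((flow hA t : E3 →L[ℝ] E3) y) : ℝ) : ℂ) * c y)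
    (F' := fun t y => ((fderiv ℝ F ((flow hA t : E3 →L[ℝ] E3) y)
      (A ((flow hA t : E3 →L[ℝ] E3) y)) : ℝ) : ℂ) * c y)
    Filter.univ_mem (Eventually.of_forall fun t => (hFc _).1) (hFc _) ?_ ?_
    (integrable_const _) (Eventually.of_forall fun y t _ => hder y t)).2
  rotate_left
  · refine AEStronglyMeasurable.mul ?_ hc.meas.aestronglyMeasurable
    have h2 : Continuous fun y => (flow hA 0 : E3 →L[ℝ] E3) y :=
      (flow hA 0 : E3 →L[ℝ] E3).continuous
    exact (Complex.continuous_ofReal.comp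
      ((hF'.comp h2).clm_apply (A.continuous.comp h2))).aestronglyMeasurable
  · refine ae_mem_sph.mono fun y hy t _ => ?_
    rw [norm_mul, Complex.norm_real]
    refine mul_le_mul ?_ (hc.bound y hy) (norm_nonneg _) ?_
    · refine (ContinuousLinearMap.le_opNorm _ _).trans ?_
      refine mul_le_mul (hM _ (hs _ hy)) ?_ (norm_nonneg _) ((norm_nonneg _).trans
        (hM _ (hs (flow hA t) hy)))
      refine (A.le_opNorm _).trans (mul_le_of_le_one_right (norm_nonneg _) ?_)
      simpa using hs (flow hA t) hy
    · exact mul_nonneg ((norm_nonneg _).trans (hM _ (hs (flow hA 0) hy))) (norm_nonneg _)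
  simp only [flow_zero, one_apply_eq_self] at hd
  have hb := hd.hasFDerivAt.le_of_lip' (C := L * ‖A‖ * ∫ y, |F y| ∂sphMeasure) ?_ ?_
  · have := (ContinuousLinearMap.le_opNorm _ (1 : ℝ)).trans
      (mul_le_mul_of_nonneg_right hb (norm_nonneg (1 : ℝ)))
    simpa using this
  · exact mul_nonneg (mul_nonneg hL (norm_nonneg _)) (integral_nonneg fun _ => abs_nonneg _)
  · refine Eventually.of_forall fun t => ?_
    set Ψ := isoG (flow hA t) with hΨ
    have hm := measurePreserving_sph Ψ
    have e1 : ∫ y, ((F ((flow hA t : E3 →L[ℝ] E3) y) : ℝ) : ℂ) * c y ∂sphMeasure =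
        ∫ y, (F y : ℂ) * c (Ψ.symm y) ∂sphMeasure := by
      rw [← hm.integral_comp Ψ.toHomeomorph.measurableEmbedding
        (fun y => (F y : ℂ) * c (Ψ.symm y))]
      refine integral_congr_ae (Eventually.of_forall fun y => ?_)
      simp only [Ψ.symm_apply_apply]
      rfl
    have i0 : Integrable (fun y => (F y : ℂ) * c y) sphMeasure := by
      simpa [flow_zero] using hFc (flow hA 0)
    have i1 : Integrable (fun y => (F y : ℂ) * c (Ψ.symm y)) sphMeasure := by
      rw [← hm.integrable_comp_emb Ψ.toHomeomorph.measurableEmbedding]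
      refine (hFc (flow hA t)).congr (Eventually.of_forall fun y => ?_)
      simp only [Function.comp_apply, Ψ.symm_apply_apply]
      rfl
    have e0 : ∫ y, ((F ((flow hA 0 : E3 →L[ℝ] E3) y) : ℝ) : ℂ) * c y ∂sphMeasure =
        ∫ y, (F y : ℂ) * c y ∂sphMeasure := by simp [flow_zero]
    rw [e1, e0, ← integral_sub i1 i0]
    have : L * ‖A‖ * (∫ y, |F y| ∂sphMeasure) * ‖t - 0‖ =
        ∫ y, L * (‖A‖ * |t|) * |F y| ∂sphMeasure := by
      rw [integral_const_mul, sub_zero, Real.norm_eq_abs]; ring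
    rw [this]
    refine norm_integral_le_of_norm_le (hFi.const_mul _) (ae_mem_sph.mono fun y hy => ?_)
    rw [← mul_sub, norm_mul, Complex.norm_real, mul_comm, Real.norm_eq_abs]
    gcongr
    have h := hc.lip (Ψ.symm y) (isometry_mem_sph _ hy) Ψ
    rw [Ψ.apply_symm_apply, ← norm_neg, neg_sub] at h
    refine h.trans ?_
    gcongr
    rw [hΨ, O3dist_isoG]
    exact norm_flow_sub_one_le hA t

/-- The skew-adjoint map `y ↦ ⟪e, y⟫ p - ⟪p, y⟫ e`. -/
def skewMap (e p : E3) : E3 →L[ℝ] E3 :=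
  (innerSL ℝ e).smulRight p - (innerSL ℝ p).smulRight e

lemma skewMap_apply (e p y : E3) : skewMap e p y = ⟪e, y⟫ • p - ⟪p, y⟫ • e := by
  simp [skewMap]

lemma skewMap_mem (e p : E3) : skewMap e p ∈ skewAdjoint (E3 →L[ℝ] E3) := by
  rw [skewAdjoint.mem_iff]
  symm
  rw [ContinuousLinearMap.star_eq_adjoint, ContinuousLinearMap.eq_adjoint_iff]
  intro x y
  simp only [neg_apply, skewMap_apply, inner_neg_left, inner_sub_left, inner_sub_right,
    inner_smul_left, inner_smul_right, real_inner_comm]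
  simp
  ring

lemma norm_skewMap_le (e p : E3) : ‖skewMap e p‖ ≤ 2 * (‖e‖ * ‖p‖) := by
  refine (norm_sub_le _ _).trans (le_of_eq ?_)
  rw [ContinuousLinearMap.norm_smulRight_apply, ContinuousLinearMap.norm_smulRight_apply,
    innerSL_apply_norm, innerSL_apply_norm]
  ring

lemma sum_skewMap (p : E3) {y : E3} (hy : y ∈ sph) :
    ∑ i, ⟪EuclideanSpace.basisFun (Fin 3) ℝ i, y⟫ •
      skewMap (EuclideanSpace.basisFun (Fin 3) ℝ i) p y = p - ⟪p, y⟫ • y := by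
  have h1 : ∑ i, ⟪EuclideanSpace.basisFun (Fin 3) ℝ i, y⟫ *
      ⟪EuclideanSpace.basisFun (Fin 3) ℝ i, y⟫ = 1 := by
    have := (EuclideanSpace.basisFun (Fin 3) ℝ).sum_sq_inner_right y
    rw [norm_eq_one_of_mem_sph hy, one_pow] at this
    rw [← this]
    exact Finset.sum_congr rfl fun i _ => (sq _).symm
  have h2 := (EuclideanSpace.basisFun (Fin 3) ℝ).sum_repr' y
  simp only [skewMap_apply, smul_sub, smul_smul, Finset.sum_sub_distrib]
  rw [← Finset.sum_smul, h1, one_smul]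
  congr 1
  conv_rhs => rw [← h2, Finset.smul_sum]
  refine Finset.sum_congr rfl fun i _ => ?_
  rw [smul_smul, mul_comm, h2]

lemma integral_tangential_le {F : E3 → ℝ} (hF : ContDiff ℝ 1 F) {B L : ℝ} {c : E3 → ℂ}
    (hc : RLip B L c) (hL : 0 ≤ L) (p : E3) :
    ‖∫ y, ((fderiv ℝ F y (p - ⟪p, y⟫ • y) : ℝ) : ℂ) * c y ∂sphMeasure‖ ≤
      6 * (B + L) * ‖p‖ * ∫ y, |F y| ∂sphMeasure := by
  set e := EuclideanSpace.basisFun (Fin 3) ℝ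
  have hF' : Continuous fun y => fderiv ℝ F y := hF.continuous_fderiv (by norm_num)
  have hB0 := hc.bound_nonneg
  have hJ : 0 ≤ ∫ y, |F y| ∂sphMeasure := integral_nonneg fun _ => abs_nonneg _
  have he : ∀ i, ‖e i‖ = 1 := fun i => e.norm_eq_one i
  have hci : ∀ i, RLip (1 * B) (1 * L + 1 * B) fun y => ((⟪e i, y⟫ : ℝ) : ℂ) * c y := fun i => by
    have := (rlip_inner (e i)).mul hc
    rwa [he] at this
  have hInt : ∀ i, Integrable (fun y => ((fderiv ℝ F y (skewMap (e i) p y) : ℝ) : ℂ) *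
      (((⟪e i, y⟫ : ℝ) : ℂ) * c y)) sphMeasure := fun i => by
    have hcont : Continuous fun y => fderiv ℝ F y (skewMap (e i) p y) :=
      hF'.clm_apply (skewMap (e i) p).continuous
    obtain ⟨M, hM⟩ := (isCompact_closedBall (0 : E3) 1).exists_bound_of_continuousOn
      hcont.continuousOn
    refine (hci i).integrable.bdd_mul (c := M)
      (Complex.continuous_ofReal.comp hcont).aestronglyMeasurable (ae_mem_sph.mono fun y hy => ?_)
    simpa [Complex.norm_real] using hM y (sphere_subset_closedBall hy)
  have hsum : ∫ y, ((fderiv ℝ F y (p - ⟪p, y⟫ • y) : ℝ) : ℂ) * c y ∂sphMeasure =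
      ∑ i, ∫ y, ((fderiv ℝ F y (skewMap (e i) p y) : ℝ) : ℂ) *
        (((⟪e i, y⟫ : ℝ) : ℂ) * c y) ∂sphMeasure := by
    rw [← integral_finsetSum _ fun i _ => hInt i]
    refine integral_congr_ae (ae_mem_sph.mono fun y hy => ?_)
    simp only
    rw [← sum_skewMap p hy, map_sum]
    simp only [map_smul, smul_eq_mul]
    push_cast
    rw [Finset.sum_mul]
    exact Finset.sum_congr rfl fun i _ => by ring
  rw [hsum]
  refine (norm_sum_le _ _).trans ?_
  have hi : ∀ i ∈ Finset.univ, ‖∫ y, ((fderiv ℝ F y (skewMap (e i) p y) : ℝ) : ℂ) *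
        (((⟪e i, y⟫ : ℝ) : ℂ) * c y) ∂sphMeasure‖ ≤
        (L + B) * (2 * ‖p‖) * ∫ y, |F y| ∂sphMeasure := fun i _ => by
    refine (integral_skew_deriv_le (skewMap_mem (e i) p) hF (hci i) (by linarith)).trans ?_
    have := norm_skewMap_le (e i) p
    rw [he, one_mul] at this
    rw [one_mul, one_mul]
    gcongr
  refine (Finset.sum_le_card_nsmul _ _ _ hi).trans (le_of_eq ?_)
  simp
  ring

/-- A truncated version of `1 / (1 - s²)`. -/
def invCut (τ s : ℝ) : ℝ := (max (1 - s ^ 2) τ)⁻¹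

lemma invCut_nonneg {τ : ℝ} (hτ : 0 < τ) (s : ℝ) : 0 ≤ invCut τ s :=
  inv_nonneg.2 (hτ.le.trans (le_max_right _ _))

lemma invCut_le {τ : ℝ} (hτ : 0 < τ) (s : ℝ) : invCut τ s ≤ τ⁻¹ :=
  inv_anti₀ hτ (le_max_right _ _)

lemma abs_invCut_sub_le {τ : ℝ} (hτ : 0 < τ) {s s' : ℝ} (hs : |s| ≤ 1) (hs' : |s'| ≤ 1) :
    |invCut τ s - invCut τ s'| ≤ 2 * τ⁻¹ ^ 2 * |s - s'| := by
  have h1 : 0 < max (1 - s ^ 2) τ := hτ.trans_le (le_max_right _ _)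
  have h2 : 0 < max (1 - s' ^ 2) τ := hτ.trans_le (le_max_right _ _)
  have e : invCut τ s - invCut τ s' =
      (max (1 - s' ^ 2) τ - max (1 - s ^ 2) τ) * (invCut τ s * invCut τ s') := by
    simp only [invCut]
    field_simp
  rw [e, abs_mul]
  have a1 : |max (1 - s' ^ 2) τ - max (1 - s ^ 2) τ| ≤ 2 * |s - s'| := by
    refine (abs_max_sub_max_le_abs _ _ _).trans ?_
    have : 1 - s' ^ 2 - (1 - s ^ 2) = (s + s') * (s - s') := by ring
    rw [this, abs_mul]
    gcongr
    exact (abs_add_le _ _).trans (by linarith)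
  have a2 : |invCut τ s * invCut τ s'| ≤ τ⁻¹ ^ 2 := by
    rw [abs_of_nonneg (mul_nonneg (invCut_nonneg hτ s) (invCut_nonneg hτ s')), sq]
    exact mul_le_mul (invCut_le hτ s) (invCut_le hτ s') (invCut_nonneg hτ s')
      (inv_nonneg.2 hτ.le)
  calc _ ≤ 2 * |s - s'| * τ⁻¹ ^ 2 := mul_le_mul a1 a2 (abs_nonneg _) (by positivity)
    _ = _ := by ring

lemma measurable_invCut (τ : ℝ) : Measurable (invCut τ) := by
  unfold invCut; fun_prop

lemma rlip_invCut {τ : ℝ} (hτ : 0 < τ) (hτ1 : τ ≤ 1) {w : E3} (hw : w ∈ sph) :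
    RLip (τ⁻¹ ^ 2) (2 * τ⁻¹ ^ 2) (fun x => ((invCut τ ⟪w, x⟫ : ℝ) : ℂ)) := by
  have hin : ∀ x ∈ sph, |⟪w, x⟫| ≤ 1 := fun x hx => by
    simpa [norm_eq_one_of_mem_sph hx, norm_eq_one_of_mem_sph hw] using abs_real_inner_le_norm w x
  refine RLip.of_lipschitz ((measurable_invCut τ).comp (by fun_prop)) (fun x hx => ?_)
    (fun x hx y hy => ?_) (by positivity)
  · rw [abs_of_nonneg (invCut_nonneg hτ _)]
    refine (invCut_le hτ _).trans ?_
    have : 1 ≤ τ⁻¹ := (one_le_inv₀ hτ).2 hτ1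
    nlinarith
  · refine (abs_invCut_sub_le hτ (hin x hx) (hin y hy)).trans ?_
    gcongr
    rw [← inner_sub_right]
    simpa [norm_eq_one_of_mem_sph hw] using abs_real_inner_le_norm w (x - y)

/-- Product surface measure on pairs. -/
def sph2 : Measure (E3 × E3) := sphMeasure.prod sphMeasure

instance : IsFiniteMeasure sph2 := by unfold sph2; infer_instance

instance : SFinite sph2 := by unfold sph2; infer_instance

lemma ae_sph2 : ∀ᵐ p ∂sph2, p.1 ∈ sph ∧ p.2 ∈ sph := by
  have h1 : Measure.QuasiMeasurePreserving (Prod.fst : E3 × E3 → E3) sph2 sphMeasure :=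
    Measure.quasiMeasurePreserving_fst
  have h2 : Measure.QuasiMeasurePreserving (Prod.snd : E3 × E3 → E3) sph2 sphMeasure :=
    Measure.quasiMeasurePreserving_snd
  filter_upwards [h1.ae ae_mem_sph, h2.ae ae_mem_sph] with p a b
  exact ⟨a, b⟩

/-- Total mass of the mollified convolution of surface measures. -/
def pairMass (κ : ℝ) (z : E3) : ℝ := ∫ p, bump κ (z - p.1 - p.2) ∂sph2

lemma continuous_bump_sub (κ : ℝ) (z : E3) :
    Continuous fun p : E3 × E3 => bump κ (z - p.1 - p.2) :=
  (continuous_bump κ).comp (by fun_prop)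

lemma integrable_bump_sub {κ : ℝ} (hκ : 0 < κ) (z : E3) :
    Integrable (fun p : E3 × E3 => bump κ (z - p.1 - p.2)) sph2 := by
  refine Integrable.of_bound (continuous_bump_sub κ z).aestronglyMeasurable (κ⁻¹ ^ 3 * bumpMass⁻¹)
    (Eventually.of_forall fun p => ?_)
  rw [Real.norm_of_nonneg (bump_nonneg hκ.le _)]
  exact bump_le hκ.le _

lemma pairMass_le {κ : ℝ} (hκ : 0 < κ) (hκ1 : κ ≤ 1) {z : E3} (hz : z ≠ 0) :
    pairMass κ z ≤ pairConst / ‖z‖ := by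
  have hm : Measurable fun p : E3 × E3 => ENNReal.ofReal (bump κ (z - p.1 - p.2)) :=
    (continuous_bump_sub κ z).measurable.ennreal_ofReal
  rw [pairMass, integral_eq_lintegral_of_nonneg_ae
    (Eventually.of_forall fun p => bump_nonneg hκ.le _)
    (continuous_bump_sub κ z).aestronglyMeasurable]
  refine ENNReal.toReal_le_of_le_ofReal (div_nonneg pairConst_pos.le (norm_nonneg _)) ?_
  rw [sph2, lintegral_prod _ hm.aemeasurable]
  exact lintegral_bump_pair_le hz hκ hκ1

lemma pairMass_nonneg {κ : ℝ} (hκ : 0 < κ) (z : E3) : 0 ≤ pairMass κ z :=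
  integral_nonneg fun _ => bump_nonneg hκ.le _

lemma norm_integral_sph2_le_right {κ : ℝ} (hκ : 0 < κ) {z : E3} {G : E3 × E3 → ℂ}
    (hG : Integrable G sph2) {K : ℝ}
    (h : ∀ c ∈ sph, ‖∫ a, G (a, c) ∂sphMeasure‖ ≤ K * ∫ a, bump κ (z - a - c) ∂sphMeasure) :
    ‖∫ p, G p ∂sph2‖ ≤ K * pairMass κ z := by
  have hi := integrable_bump_sub hκ z
  rw [sph2] at hG hi
  rw [pairMass, sph2, integral_prod_symm _ hG, integral_prod_symm _ hi, ← integral_const_mul]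
  exact norm_integral_le_of_norm_le (hi.integral_prod_right.const_mul K)
    (ae_mem_sph.mono fun c hc => h c hc)

lemma norm_integral_sph2_le_left {κ : ℝ} (hκ : 0 < κ) {z : E3} {G : E3 × E3 → ℂ}
    (hG : Integrable G sph2) {K : ℝ}
    (h : ∀ a ∈ sph, ‖∫ c, G (a, c) ∂sphMeasure‖ ≤ K * ∫ c, bump κ (z - a - c) ∂sphMeasure) :
    ‖∫ p, G p ∂sph2‖ ≤ K * pairMass κ z := by
  have hi := integrable_bump_sub hκ z
  rw [sph2] at hG hi
  rw [pairMass, sph2, integral_prod _ hG, integral_prod _ hi, ← integral_const_mul]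
  exact norm_integral_le_of_norm_le (hi.integral_prod_left.const_mul K)
    (ae_mem_sph.mono fun c hc => h c hc)

lemma fderiv_bump_eq_zero {κ : ℝ} (hκ : 0 < κ) {x : E3} (hx : κ ≤ ‖x‖) :
    fderiv ℝ (bump κ) x = 0 := by
  refine IsLocalMin.fderiv_eq_zero (Eventually.of_forall fun y => ?_)
  rw [bump_eq_zero hκ hx]
  exact bump_nonneg hκ.le y

/-- The derivative of the mollifier in the direction `b`. -/
def dbump (κ : ℝ) (x b : E3) : ℝ := fderiv ℝ (bump κ) x b

lemma continuous_fderiv_bump (κ : ℝ) : Continuous fun x => fderiv ℝ (bump κ) x :=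
  (contDiff_bump κ).continuous_fderiv (by simp)

lemma exists_dbump_bound {κ : ℝ} (hκ : 0 < κ) : ∃ M, 0 ≤ M ∧ ∀ x b, |dbump κ x b| ≤ M * ‖b‖ := by
  obtain ⟨M, hM⟩ := (continuous_fderiv_bump κ).bounded_above_of_compact_support
    ((hasCompactSupport_bump hκ).fderiv (𝕜 := ℝ))
  refine ⟨M, (norm_nonneg _).trans (hM 0), fun x b => ?_⟩
  exact ((fderiv ℝ (bump κ) x).le_opNorm b).trans
    (mul_le_mul_of_nonneg_right (hM x) (norm_nonneg _))

lemma integral_dbump_tangential_le {κ : ℝ} (hκ : 0 < κ) (w p : E3) {B L : ℝ} {c : E3 → ℂ}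
    (hc : RLip B L c) (hL : 0 ≤ L) :
    ‖∫ y, ((dbump κ (w - y) (p - ⟪p, y⟫ • y) : ℝ) : ℂ) * c y ∂sphMeasure‖ ≤
      6 * (B + L) * ‖p‖ * ∫ y, bump κ (w - y) ∂sphMeasure := by
  have hF : ContDiff ℝ 1 fun y => bump κ (w - y) :=
    ((contDiff_bump κ).of_le (by simp)).comp (contDiff_const.sub contDiff_id)
  have hd : ∀ y b, fderiv ℝ (fun y => bump κ (w - y)) y b = -dbump κ (w - y) b := fun y b => by
    have h1 : HasFDerivAt (bump κ) (fderiv ℝ (bump κ) (w - y)) (w - y) :=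
      (((contDiff_bump κ).differentiable (by simp)) _).hasFDerivAt
    have h2 : HasFDerivAt (fun y : E3 => w - y) (-ContinuousLinearMap.id ℝ E3) y :=
      (hasFDerivAt_id y).const_sub w
    have h3 : HasFDerivAt (fun y => bump κ (w - y))
      ((fderiv ℝ (bump κ) (w - y)).comp (-ContinuousLinearMap.id ℝ E3)) y := h1.comp y h2
    rw [h3.fderiv]
    simp [dbump]
  have := integral_tangential_le hF hc hL p
  simp only [hd] at this
  push_cast at this
  simp only [neg_mul, integral_neg, norm_neg] at this
  refine this.trans (le_of_eq ?_)
  congr 1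
  exact integral_congr_ae (Eventually.of_forall fun y => abs_of_nonneg (bump_nonneg hκ.le _))

lemma continuous_dbump (κ : ℝ) {X Y : E3 × E3 → E3} (hX : Continuous X) (hY : Continuous Y) :
    Continuous fun p => dbump κ (X p) (Y p) :=
  ((continuous_fderiv_bump κ).comp hX).clm_apply hY

lemma integrable_dbump_mul {κ : ℝ} (hκ : 0 < κ) {X Y : E3 × E3 → E3} (hX : Continuous X)
    (hY : Continuous Y) {C : ℝ} (hYC : ∀ p : E3 × E3, p.1 ∈ sph → p.2 ∈ sph → ‖Y p‖ ≤ C)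
    {D : ℝ} {c : E3 × E3 → ℂ} (hc : Measurable c)
    (hcD : ∀ p : E3 × E3, p.1 ∈ sph → p.2 ∈ sph → ‖c p‖ ≤ D) :
    Integrable (fun p => ((dbump κ (X p) (Y p) : ℝ) : ℂ) * c p) sph2 := by
  obtain ⟨M, hM0, hM⟩ := exists_dbump_bound hκ
  refine Integrable.of_bound (((Complex.continuous_ofReal.comp
    (continuous_dbump κ hX hY)).measurable.mul hc).aestronglyMeasurable) (M * C * D)
    (ae_sph2.mono fun p hp => ?_)
  rw [norm_mul, Complex.norm_real]
  have h1 := hYC p hp.1 hp.2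
  have h2 := hcD p hp.1 hp.2
  have : |dbump κ (X p) (Y p)| ≤ M * C := (hM _ _).trans (by gcongr)
  exact mul_le_mul this h2 (norm_nonneg _) ((abs_nonneg _).trans this)

lemma decomp_tangential (a c b : E3) :
    (1 - ⟪c, a⟫ ^ 2) • b = (1 - ⟪c, a⟫ ^ 2) • (b - ⟪b, a⟫ • a) +
      (⟪c, a⟫ * ⟪b, a⟫) • (c - ⟪c, a⟫ • a) + ⟪b, a⟫ • (a - ⟪a, c⟫ • c) := by
  rw [real_inner_comm c a]
  module

lemma norm_integral_dbump_le {κ τ : ℝ} (hκ : 0 < κ) (hτ : 0 < τ) (hτ1 : τ ≤ 1) {z : E3} (b : E3)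
    {B : ℝ} {u v : E3 → ℂ} (hu : RLip B B u) (hv : RLip B B v)
    (hz : ∀ a ∈ sph, ∀ c ∈ sph, ‖z - a - c‖ < κ → τ ≤ 1 - ⟪c, a⟫ ^ 2) :
    ‖∫ p, ((dbump κ (z - p.1 - p.2) b : ℝ) : ℂ) * (u p.1 * v p.2) ∂sph2‖ ≤
      72 * (τ⁻¹ ^ 2 * B ^ 2 * ‖b‖) * pairMass κ z := by
  have hB := hu.bound_nonneg
  have hPM := pairMass_nonneg hκ z
  have hti : 1 ≤ τ⁻¹ ^ 2 := one_le_pow₀ ((one_le_inv₀ hτ).2 hτ1)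
  have hX : Continuous fun p : E3 × E3 => z - p.1 - p.2 := by fun_prop
  have hum : Measurable u := hu.meas.measurable
  have hvm : Measurable v := hv.meas.measurable
  have him : Measurable fun p : E3 × E3 => invCut τ ⟪p.2, p.1⟫ :=
    (measurable_invCut τ).comp (by fun_prop)
  have hsub : ∀ p y : E3, ‖y‖ = 1 → ‖p - ⟪p, y⟫ • y‖ ≤ 2 * ‖p‖ := fun p y hy => by
    refine (norm_sub_le _ _).trans ?_
    rw [norm_smul, hy, mul_one, Real.norm_eq_abs]
    have := abs_real_inner_le_norm p y
    rw [hy] at this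
    linarith
  have hin : ∀ p y : E3, ‖y‖ = 1 → |⟪p, y⟫| ≤ ‖p‖ := fun p y hy => by
    simpa [hy] using abs_real_inner_le_norm p y
  set G₁ : E3 × E3 → ℂ := fun p => ((dbump κ (z - p.1 - p.2) (b - ⟪b, p.1⟫ • p.1) : ℝ) : ℂ) *
    (u p.1 * v p.2) with hG₁
  set G₂ : E3 × E3 → ℂ := fun p => ((dbump κ (z - p.1 - p.2) (p.2 - ⟪p.2, p.1⟫ • p.1) : ℝ) : ℂ) *
    ((((invCut τ ⟪p.2, p.1⟫ : ℝ) : ℂ) * ((⟪p.2, p.1⟫ : ℝ) : ℂ)) *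
      (((⟪b, p.1⟫ : ℝ) : ℂ) * u p.1) * v p.2) with hG₂
  set G₃ : E3 × E3 → ℂ := fun p => ((dbump κ (z - p.1 - p.2) (p.1 - ⟪p.1, p.2⟫ • p.2) : ℝ) : ℂ) *
    ((((invCut τ ⟪p.1, p.2⟫ : ℝ) : ℂ) * v p.2) * (((⟪b, p.1⟫ : ℝ) : ℂ) * u p.1)) with hG₃
  have i₁ : Integrable G₁ sph2 := by
    refine integrable_dbump_mul hκ hX (by fun_prop) (C := 2 * ‖b‖)
      (fun p h1 h2 => hsub b _ (norm_eq_one_of_mem_sph h1)) (D := B * B) (by fun_prop) ?_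
    intro p h1 h2
    rw [norm_mul]
    exact mul_le_mul (hu.bound _ h1) (hv.bound _ h2) (norm_nonneg _) hB
  have hcut : ∀ s, ‖((invCut τ s : ℝ) : ℂ)‖ ≤ τ⁻¹ := fun s => by
    rw [Complex.norm_real, Real.norm_of_nonneg (invCut_nonneg hτ s)]
    exact invCut_le hτ s
  have hbu : ∀ a ∈ sph, ‖((⟪b, a⟫ : ℝ) : ℂ) * u a‖ ≤ ‖b‖ * B := fun a ha => by
    rw [norm_mul, Complex.norm_real]
    exact mul_le_mul (hin b a (norm_eq_one_of_mem_sph ha)) (hu.bound a ha) (norm_nonneg _)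
      (norm_nonneg _)
  have i₂ : Integrable G₂ sph2 := by
    refine integrable_dbump_mul hκ hX (by fun_prop) (C := 2 * 1)
      (fun p h1 h2 => ?_) (D := τ⁻¹ * 1 * (‖b‖ * B) * B) ?_ ?_
    · have := hsub p.2 p.1 (norm_eq_one_of_mem_sph h1)
      rwa [norm_eq_one_of_mem_sph h2] at this
    · fun_prop
    · intro p h1 h2
      rw [norm_mul, norm_mul, norm_mul]
      have e1 := hcut ⟪p.2, p.1⟫
      have e2 := hin p.2 p.1 (norm_eq_one_of_mem_sph h1)
      rw [norm_eq_one_of_mem_sph h2] at e2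
      have e3 := hbu _ h1
      have e4 := hv.bound _ h2
      rw [Complex.norm_real ⟪p.2, p.1⟫, Real.norm_eq_abs]
      gcongr
  have i₃ : Integrable G₃ sph2 := by
    have him' : Measurable fun p : E3 × E3 => invCut τ ⟪p.1, p.2⟫ :=
      (measurable_invCut τ).comp (by fun_prop)
    refine integrable_dbump_mul hκ hX (by fun_prop) (C := 2 * 1)
      (fun p h1 h2 => ?_) (D := τ⁻¹ * B * (‖b‖ * B)) ?_ ?_
    · have := hsub p.1 p.2 (norm_eq_one_of_mem_sph h2)
      rwa [norm_eq_one_of_mem_sph h1] at this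
    · fun_prop
    · intro p h1 h2
      rw [norm_mul, norm_mul]
      have e1 := hcut ⟪p.1, p.2⟫
      have e3 := hbu _ h1
      have e4 := hv.bound _ h2
      gcongr
  have hsum : ∫ p, ((dbump κ (z - p.1 - p.2) b : ℝ) : ℂ) * (u p.1 * v p.2) ∂sph2 =
      ∫ p, G₁ p ∂sph2 + ∫ p, G₂ p ∂sph2 + ∫ p, G₃ p ∂sph2 := by
    have i₁₂ : Integrable (fun p => G₁ p + G₂ p) sph2 := i₁.add i₂
    rw [← integral_add i₁ i₂, ← integral_add i₁₂ i₃]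
    refine integral_congr_ae (ae_sph2.mono fun p hp => ?_)
    simp only [hG₁, hG₂, hG₃]
    by_cases hs : ‖z - p.1 - p.2‖ < κ
    · have h1 := hz _ hp.1 _ hp.2 hs
      have h0 : 1 - ⟪p.2, p.1⟫ ^ 2 ≠ 0 := (hτ.trans_le h1).ne'
      have hinv : invCut τ ⟪p.2, p.1⟫ = (1 - ⟪p.2, p.1⟫ ^ 2)⁻¹ := by
        rw [invCut, max_eq_left h1]
      have hd := congrArg (dbump κ (z - p.1 - p.2)) (decomp_tangential p.1 p.2 b)
      simp only [dbump, map_add, map_smul, smul_eq_mul] at hd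
      have hd2 : dbump κ (z - p.1 - p.2) b =
          dbump κ (z - p.1 - p.2) (b - ⟪b, p.1⟫ • p.1) +
          dbump κ (z - p.1 - p.2) (p.2 - ⟪p.2, p.1⟫ • p.1) *
            (invCut τ ⟪p.2, p.1⟫ * ⟪p.2, p.1⟫ * ⟪b, p.1⟫) +
          dbump κ (z - p.1 - p.2) (p.1 - ⟪p.1, p.2⟫ • p.2) *
            (invCut τ ⟪p.2, p.1⟫ * ⟪b, p.1⟫) := by
        rw [hinv]
        simp only [dbump]
        field_simp
        linear_combination hd
      rw [hd2, real_inner_comm p.2 p.1]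
      push_cast
      ring
    · have := fderiv_bump_eq_zero hκ (le_of_not_gt hs)
      simp [dbump, this]
  rw [hsum]
  have b₁ : ‖∫ p, G₁ p ∂sph2‖ ≤ 12 * (τ⁻¹ ^ 2 * B ^ 2 * ‖b‖) * pairMass κ z := by
    refine norm_integral_sph2_le_right hκ i₁ fun c hc => ?_
    have e : ∫ a, G₁ (a, c) ∂sphMeasure =
        (∫ a, ((dbump κ (z - c - a) (b - ⟪b, a⟫ • a) : ℝ) : ℂ) * u a ∂sphMeasure) * v c := by
      rw [← integral_mul_const]
      refine integral_congr_ae (Eventually.of_forall fun a => ?_)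
      simp only [hG₁, sub_right_comm z a c]
      ring
    rw [e, norm_mul]
    have h1 := integral_dbump_tangential_le hκ (z - c) b hu hB
    have hJ : 0 ≤ ∫ a, bump κ (z - c - a) ∂sphMeasure :=
      integral_nonneg fun _ => bump_nonneg hκ.le _
    simp only [sub_right_comm z _ c]
    calc _ ≤ (6 * (B + B) * ‖b‖ * ∫ a, bump κ (z - c - a) ∂sphMeasure) * B :=
          mul_le_mul h1 (hv.bound c hc) (norm_nonneg _) (by positivity)
      _ = 12 * (1 * B ^ 2 * ‖b‖) * ∫ a, bump κ (z - c - a) ∂sphMeasure := by ring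
      _ ≤ _ := by gcongr
  have b₂ : ‖∫ p, G₂ p ∂sph2‖ ≤ 36 * (τ⁻¹ ^ 2 * B ^ 2 * ‖b‖) * pairMass κ z := by
    refine norm_integral_sph2_le_right hκ i₂ fun c hc => ?_
    have hk := ((rlip_invCut hτ hτ1 hc).mul (rlip_inner c)).mul ((rlip_inner b).mul hu)
    have e : ∫ a, G₂ (a, c) ∂sphMeasure =
        (∫ a, ((dbump κ (z - c - a) (c - ⟪c, a⟫ • a) : ℝ) : ℂ) *
          ((((invCut τ ⟪c, a⟫ : ℝ) : ℂ) * ((⟪c, a⟫ : ℝ) : ℂ)) *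
            (((⟪b, a⟫ : ℝ) : ℂ) * u a)) ∂sphMeasure) * v c := by
      rw [← integral_mul_const]
      refine integral_congr_ae (Eventually.of_forall fun a => ?_)
      simp only [hG₂, sub_right_comm z a c]
      ring
    rw [e, norm_mul]
    have h1 := integral_dbump_tangential_le hκ (z - c) c hk (by positivity)
    have hJ : 0 ≤ ∫ a, bump κ (z - c - a) ∂sphMeasure :=
      integral_nonneg fun _ => bump_nonneg hκ.le _
    simp only [sub_right_comm z _ c]
    refine (mul_le_mul h1 (hv.bound c hc) (norm_nonneg _) (by positivity)).trans (le_of_eq ?_)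
    rw [norm_eq_one_of_mem_sph hc]
    ring
  have b₃ : ‖∫ p, G₃ p ∂sph2‖ ≤ 24 * (τ⁻¹ ^ 2 * B ^ 2 * ‖b‖) * pairMass κ z := by
    refine norm_integral_sph2_le_left hκ i₃ fun a ha => ?_
    have hk := (rlip_invCut hτ hτ1 ha).mul hv
    have e : ∫ c, G₃ (a, c) ∂sphMeasure =
        (∫ c, ((dbump κ (z - a - c) (a - ⟪a, c⟫ • c) : ℝ) : ℂ) *
          (((invCut τ ⟪a, c⟫ : ℝ) : ℂ) * v c) ∂sphMeasure) * (((⟪b, a⟫ : ℝ) : ℂ) * u a) := by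
      rw [← integral_mul_const]
      refine integral_congr_ae (Eventually.of_forall fun c => ?_)
      simp only [hG₃]
      ring
    rw [e, norm_mul]
    have h1 := integral_dbump_tangential_le hκ (z - a) a hk (by positivity)
    have hJ : 0 ≤ ∫ c, bump κ (z - a - c) ∂sphMeasure :=
      integral_nonneg fun _ => bump_nonneg hκ.le _
    refine (mul_le_mul h1 (hbu a ha) (norm_nonneg _) (by positivity)).trans (le_of_eq ?_)
    rw [norm_eq_one_of_mem_sph ha]
    ring
  calc _ ≤ _ := (norm_add_le _ _).trans (add_le_add_left (norm_add_le _ _) _)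
    _ ≤ _ := by linarith

/-- The mollified convolution of two densities. -/
def pairConv (κ : ℝ) (u v : E3 → ℂ) (z : E3) : ℂ :=
  ∫ p, (bump κ (z - p.1 - p.2) : ℂ) * (u p.1 * v p.2) ∂sph2

lemma norm_pairConv_le {κ : ℝ} (hκ : 0 < κ) {B : ℝ} (z : E3)
    {u v : E3 → ℂ} (hu : RLip B B u) (hv : RLip B B v) :
    ‖pairConv κ u v z‖ ≤ B ^ 2 * pairMass κ z := by
  rw [pairMass, ← integral_const_mul]
  refine norm_integral_le_of_norm_le ((integrable_bump_sub hκ z).const_mul _)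
    (ae_sph2.mono fun p hp => ?_)
  rw [norm_mul, norm_mul, Complex.norm_real, Real.norm_of_nonneg (bump_nonneg hκ.le _), mul_comm,
    sq]
  gcongr
  · exact bump_nonneg hκ.le _
  · exact hu.bound_nonneg
  · exact hu.bound _ hp.1
  · exact hv.bound _ hp.2

lemma RLip.integrable_mul {B L B' L' : ℝ} {u v : E3 → ℂ} (hu : RLip B L u) (hv : RLip B' L' v) :
    Integrable (fun p : E3 × E3 => u p.1 * v p.2) sph2 :=
  hu.integrable.mul_prod hv.integrable

lemma integrable_pairConv {κ : ℝ} (hκ : 0 < κ) {w : E3 × E3 → ℂ} (hw : Integrable w sph2) (z : E3) :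
    Integrable (fun p : E3 × E3 => (bump κ (z - p.1 - p.2) : ℂ) * w p) sph2 := by
  refine hw.bdd_mul (c := κ⁻¹ ^ 3 * bumpMass⁻¹) ?_ (Eventually.of_forall fun p => norm_bump_le hκ _)
  exact ((continuous_bumpC κ).comp (by fun_prop)).aestronglyMeasurable

lemma hasDerivAt_pairConv {κ : ℝ} (hκ : 0 < κ) {B : ℝ}
    {u v : E3 → ℂ} (hu : RLip B B u) (hv : RLip B B v) (z b : E3) (t : ℝ) :
    HasDerivAt (fun t : ℝ => pairConv κ u v (z + t • b))
      (∫ p, ((dbump κ (z + t • b - p.1 - p.2) b : ℝ) : ℂ) * (u p.1 * v p.2) ∂sph2) t := by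
  obtain ⟨M, hM0, hM⟩ := exists_dbump_bound hκ
  have hw := hu.integrable_mul hv
  have hder : ∀ (p : E3 × E3) (t : ℝ), HasDerivAt
      (fun t : ℝ => (bump κ (z + t • b - p.1 - p.2) : ℂ) * (u p.1 * v p.2))
      (((dbump κ (z + t • b - p.1 - p.2) b : ℝ) : ℂ) * (u p.1 * v p.2)) t := fun p t => by
    refine HasDerivAt.mul_const (HasDerivAt.ofReal_comp ?_) _
    have h1 : HasDerivAt (fun t : ℝ => z + t • b - p.1 - p.2) b t := by
      simpa using (((((hasDerivAt_id t).smul_const b).const_add z).sub_const p.1).sub_const p.2)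
    exact (((contDiff_bump κ).differentiable (by simp)) _).hasFDerivAt.comp_hasDerivAt t h1
  refine (hasDerivAt_integral_of_dominated_loc_of_deriv_le (μ := sph2) (x₀ := t)
    (s := Set.univ) (bound := fun p => M * ‖b‖ * ‖u p.1 * v p.2‖)
    (F := fun (t : ℝ) p => (bump κ (z + t • b - p.1 - p.2) : ℂ) * (u p.1 * v p.2))
    (F' := fun (t : ℝ) p => ((dbump κ (z + t • b - p.1 - p.2) b : ℝ) : ℂ) * (u p.1 * v p.2))
    Filter.univ_mem (Eventually.of_forall fun t => (integrable_pairConv hκ hw _).1)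
    (integrable_pairConv hκ hw _) ?_ ?_
    (hw.norm.const_mul _) (Eventually.of_forall fun y t _ => hder y t)).2
  · refine AEStronglyMeasurable.mul ?_ hw.1
    exact (Complex.continuous_ofReal.comp (continuous_dbump κ (X := fun p => z + t • b - p.1 - p.2)
      (by fun_prop) continuous_const)).aestronglyMeasurable
  · refine Eventually.of_forall fun p t _ => ?_
    rw [norm_mul, Complex.norm_real]
    gcongr
    exact hM _ _

/-- If `a + c` stays away from the origin and from the sphere of radius two then `a` and `c` are
transversal. -/
lemma transversal_of_norm_add {a c : E3} (ha : a ∈ sph) (hc : c ∈ sph) {η : ℝ} (hη : 0 < η)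
    (h1 : η / 2 ≤ ‖a + c‖) (h2 : ‖a + c‖ ^ 2 ≤ 4 - η ^ 2 / 2) :
    η ^ 4 / 32 ≤ 1 - ⟪c, a⟫ ^ 2 := by
  have hs := norm_add_sq_real a c
  rw [norm_eq_one_of_mem_sph ha, norm_eq_one_of_mem_sph hc, real_inner_comm] at hs
  have e1 : η ^ 2 / 4 ≤ ‖a + c‖ ^ 2 := by nlinarith
  have e : 1 - ⟪c, a⟫ ^ 2 = ‖a + c‖ ^ 2 * (4 - ‖a + c‖ ^ 2) / 4 := by
    rw [hs]; ring
  rw [e]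
  nlinarith [mul_le_mul e1 (by linarith : η ^ 2 / 2 ≤ 4 - ‖a + c‖ ^ 2) (by positivity)
    (by positivity)]

lemma pairConv_sub_le {κ η θ : ℝ} (hκ : 0 < κ) (hκ1 : κ ≤ 1) (hη : 0 < η) (hη1 : η ≤ 1)
    (hθ : 0 ≤ θ) (hθη : θ + κ ≤ η ^ 2 / 16) {B : ℝ} {u v : E3 → ℂ} (hu : RLip B B u)
    (hv : RLip B B v) {z b : E3} (hb : ‖b‖ ≤ θ) (hz1 : η ≤ ‖z‖) (hz2 : ‖z‖ ^ 2 ≤ 4 - η ^ 2) :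
    ‖pairConv κ u v (z + b) - pairConv κ u v z‖ ≤
      72 * ((η ^ 4 / 32)⁻¹ ^ 2 * B ^ 2 * θ) * (2 * pairConst / η) := by
  have hz3 : ‖z‖ ≤ 2 := by nlinarith [norm_nonneg z]
  have hsmall : η ^ 2 / 16 ≤ η / 16 := by nlinarith
  have hP := pairConst_pos
  have := norm_image_sub_le_of_norm_deriv_le_segment_01'
    (f := fun t : ℝ => pairConv κ u v (z + t • b))
    (C := 72 * ((η ^ 4 / 32)⁻¹ ^ 2 * B ^ 2 * θ) * (2 * pairConst / η))
    (fun t _ => (hasDerivAt_pairConv hκ hu hv z b t).hasDerivWithinAt) ?_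
  · simpa using this
  · intro t ht
    have htb : ‖t • b‖ ≤ θ := by
      rw [norm_smul, Real.norm_of_nonneg ht.1]
      nlinarith [ht.2, norm_nonneg b]
    have hl : η / 2 ≤ ‖z + t • b‖ := by
      have := norm_sub_le_norm_add z (t • b)
      linarith
    have hz0 : z + t • b ≠ 0 := fun h => by
      rw [h, norm_zero] at hl
      linarith
    refine (norm_integral_dbump_le hκ (τ := η ^ 4 / 32) (by positivity) ?_ b hu hv ?_).trans ?_
    · nlinarith [pow_le_one₀ hη.le hη1 (n := 4)]
    · intro a ha c hc hac
      have e : z - (a + c) = (z + t • b - a - c) - t • b := by abel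
      have h3 : ‖z - (a + c)‖ ≤ η ^ 2 / 16 := by
        rw [e]
        exact (norm_sub_le _ _).trans (by linarith)
      have h4 := norm_sub_norm_le z (a + c)
      have h5 := norm_sub_norm_le (a + c) z
      rw [norm_sub_rev] at h5
      refine transversal_of_norm_add ha hc hη (by linarith) ?_
      have h6 : ‖a + c‖ ≤ ‖z‖ + η ^ 2 / 16 := by linarith
      have h7 : η ^ 2 ≤ 1 := by nlinarith
      calc ‖a + c‖ ^ 2 ≤ (‖z‖ + η ^ 2 / 16) ^ 2 := by gcongr
        _ = ‖z‖ ^ 2 + ‖z‖ * η ^ 2 / 8 + η ^ 2 * η ^ 2 / 256 := by ring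
        _ ≤ _ := by nlinarith [sq_nonneg η]
    · have hpm := pairMass_nonneg hκ (z + t • b)
      gcongr
      refine (pairMass_le hκ hκ1 hz0).trans ?_
      rw [mul_comm 2, mul_div_assoc, div_eq_mul_inv]
      gcongr
      rw [inv_le_comm₀ (norm_pos_iff.2 hz0) (by positivity), inv_div]
      exact hl

lemma nrm_le_of_kernel {W : E3 → E3 → ℝ≥0∞} (hW : Measurable (Function.uncurry W)) {S : ℝ≥0∞}
    (h₁ : ∀ᵐ x ∂sphMeasure, ∫⁻ y, W x y ∂sphMeasure ≤ S)
    (h₂ : ∀ᵐ y ∂sphMeasure, ∫⁻ x, W x y ∂sphMeasure ≤ S) {F G : E3 → ℝ≥0∞} (hF : Measurable F)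
    (hG : Measurable G) (hFt : nrm F ≠ ⊤)
    (h : ∀ᵐ x ∂sphMeasure, F x ≤ ∫⁻ y, W x y * G y ∂sphMeasure) : nrm F ≤ S * nrm G := by
  refine nrm_le_of_sq_le hFt ?_
  have hs : S ^ (1 / 2 : ℝ) * S ^ (1 / 2 : ℝ) = S := by
    rw [← ENNReal.rpow_add_of_nonneg _ _ (by norm_num) (by norm_num)]
    norm_num
  calc ∫⁻ x, F x ^ (2 : ℝ) ∂sphMeasure
      ≤ ∫⁻ x, ∫⁻ y, W x y * (F x * G y) ∂sphMeasure ∂sphMeasure := by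
        refine lintegral_mono_ae (h.mono fun x hx => ?_)
        have hm : Measurable fun y => W x y * G y :=
          (hW.comp (measurable_const.prodMk measurable_id)).mul hG
        rw [ENNReal.rpow_two, sq]
        calc F x * F x ≤ F x * ∫⁻ y, W x y * G y ∂sphMeasure := by gcongr
          _ = ∫⁻ y, F x * (W x y * G y) ∂sphMeasure := (lintegral_const_mul _ hm).symm
          _ = _ := lintegral_congr fun y => by ring
    _ ≤ _ := schur_test hW h₁ h₂ hF hG
    _ = S * nrm G * nrm F := by rw [hs, nrm, nrm]; ring

/-- The truncated Newtonian kernel. -/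
def newt (η : ℝ) (w : E3) : ℝ≥0∞ := (closedBall (0 : E3) η).indicator
  (fun w => ENNReal.ofReal ‖w‖⁻¹) w

lemma measurable_newt (η : ℝ) : Measurable (newt η) :=
  Measurable.indicator (by fun_prop) measurableSet_closedBall

lemma newt_neg (η : ℝ) (w : E3) : newt η (-w) = newt η w := by
  simp [newt, Set.indicator]

lemma newt_eq {η : ℝ} {w : E3} (h : ‖w‖ ≤ η) : newt η w = ENNReal.ofReal ‖w‖⁻¹ :=
  Set.indicator_of_mem (by simpa using h) _

lemma lintegral_newt_le (x : E3) {η : ℝ} (hη : 0 < η) :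
    ∫⁻ y, newt η (x - y) ∂sphMeasure ≤ ENNReal.ofReal (3456 * η) := by
  refine le_trans (le_of_eq ?_) (setLIntegral_inv_norm_le x hη)
  rw [← lintegral_indicator measurableSet_closedBall]
  refine lintegral_congr fun y => ?_
  simp only [newt, Set.indicator, mem_closedBall, dist_zero_right, dist_comm y x, dist_eq_norm x y]

lemma lintegral_newt_iso_le (Θ : E3 ≃ₗᵢ[ℝ] E3) (x : E3) {η : ℝ} (hη : 0 < η) :
    ∫⁻ y, newt η (x - Θ y) ∂sphMeasure ≤ ENNReal.ofReal (3456 * η) := by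
  have hm : Measurable fun y => newt η (x - y) := (measurable_newt η).comp (by fun_prop)
  rw [(measurePreserving_sph Θ).lintegral_comp hm]
  exact lintegral_newt_le x hη

lemma lintegral_newt_left_le (y : E3) {η : ℝ} (hη : 0 < η) :
    ∫⁻ x, newt η (x - y) ∂sphMeasure ≤ ENNReal.ofReal (3456 * η) := by
  refine le_trans (le_of_eq (lintegral_congr fun x => ?_)) (lintegral_newt_le y hη)
  rw [← newt_neg, neg_sub]

lemma lintegral_cap_le (x : E3) {η : ℝ} (hη : 0 ≤ η) :
    ∫⁻ y, (closedBall (0 : E3) η).indicator (fun _ => (1 : ℝ≥0∞)) (x + y) ∂sphMeasure ≤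
      ENNReal.ofReal (864 * η ^ 2) := by
  refine le_trans (le_of_eq ?_) (sphMeasure_closedBall_le (-x) hη)
  rw [← lintegral_indicator_one measurableSet_closedBall]
  refine lintegral_congr fun y => ?_
  simp only [Set.indicator, mem_closedBall, dist_eq_norm, sub_neg_eq_add,
    add_comm x y, Pi.one_apply, sub_zero]

lemma sphMeasure_univ_le : sphMeasure Set.univ ≤ ENNReal.ofReal 864 := by
  rw [sphMeasure_inter_sph, Set.univ_inter]
  refine (measure_mono sphere_subset_closedBall).trans
    ((sphMeasure_closedBall_le 0 zero_le_one).trans (by norm_num))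

/-- Majorant of the kernel of the smoothed difference operator. -/
def majKernel (η G P : ℝ) (Θ : E3 ≃ₗᵢ[ℝ] E3) (x y : E3) : ℝ≥0∞ :=
  ENNReal.ofReal G + ENNReal.ofReal P * (newt (2 * η) (x - y) + newt (2 * η) (x - Θ y) +
    2 * (closedBall (0 : E3) η).indicator (fun _ => (1 : ℝ≥0∞)) (x + y))

lemma measurable_majKernel (η G P : ℝ) (Θ : E3 ≃ₗᵢ[ℝ] E3) :
    Measurable (Function.uncurry (majKernel η G P Θ)) := by
  have h1 : Measurable fun p : E3 × E3 => newt (2 * η) (p.1 - p.2) :=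
    (measurable_newt _).comp (by fun_prop)
  have h2 : Measurable fun p : E3 × E3 => newt (2 * η) (p.1 - Θ p.2) :=
    (measurable_newt _).comp (measurable_fst.sub (Θ.continuous.measurable.comp measurable_snd))
  have h3 : Measurable fun p : E3 × E3 =>
      (closedBall (0 : E3) η).indicator (fun _ => (1 : ℝ≥0∞)) (p.1 + p.2) :=
    (measurable_const.indicator measurableSet_closedBall).comp (by fun_prop)
  exact ((h1.add h2).add (h3.const_mul 2)).const_mul _ |>.const_add _

lemma lintegral_maj_le {η G P : ℝ} (hη : 0 < η) (hη1 : η ≤ 1) (hG : 0 ≤ G) (hP : 0 ≤ P)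
    {A B C : E3 → ℝ≥0∞} (mA : Measurable A) (mB : Measurable B)
    (hA : ∫⁻ y, A y ∂sphMeasure ≤ ENNReal.ofReal (3456 * (2 * η)))
    (hB : ∫⁻ y, B y ∂sphMeasure ≤ ENNReal.ofReal (3456 * (2 * η)))
    (hC : ∫⁻ y, C y ∂sphMeasure ≤ ENNReal.ofReal (864 * η ^ 2)) :
    ∫⁻ y, (ENNReal.ofReal G + ENNReal.ofReal P * (A y + B y + 2 * C y)) ∂sphMeasure ≤
      ENNReal.ofReal (864 * G + 16000 * P * η) := by
  have mAB : Measurable fun y => A y + B y := mA.add mB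
  rw [lintegral_add_left measurable_const, lintegral_const,
    lintegral_const_mul' _ _ ENNReal.ofReal_ne_top, lintegral_add_left mAB,
    lintegral_add_left mA, lintegral_const_mul' _ _ ENNReal.ofNat_ne_top]
  calc _ ≤ ENNReal.ofReal G * ENNReal.ofReal 864 + ENNReal.ofReal P *
        (ENNReal.ofReal (3456 * (2 * η)) + ENNReal.ofReal (3456 * (2 * η)) +
          ENNReal.ofReal 2 * ENNReal.ofReal (864 * η ^ 2)) := by
        gcongr
        · exact sphMeasure_univ_le
        · simp
    _ = ENNReal.ofReal (G * 864 + P * (3456 * (2 * η) + 3456 * (2 * η) + 2 * (864 * η ^ 2))) := by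
        rw [← ENNReal.ofReal_mul hG, ← ENNReal.ofReal_mul (by norm_num : (0 : ℝ) ≤ 2),
          ← ENNReal.ofReal_add (by positivity) (by positivity),
          ← ENNReal.ofReal_add (by positivity) (by positivity), ← ENNReal.ofReal_mul hP,
          ← ENNReal.ofReal_add (by positivity) (by positivity)]
    _ ≤ _ := by
        refine ENNReal.ofReal_le_ofReal ?_
        have : P * η ^ 2 ≤ P * η := by gcongr; nlinarith
        nlinarith [mul_nonneg hP hη.le]

lemma lintegral_majKernel_right {η G P : ℝ} (hη : 0 < η) (hη1 : η ≤ 1) (hG : 0 ≤ G) (hP : 0 ≤ P)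
    (Θ : E3 ≃ₗᵢ[ℝ] E3) (x : E3) :
    ∫⁻ y, majKernel η G P Θ x y ∂sphMeasure ≤ ENNReal.ofReal (864 * G + 16000 * P * η) :=
  lintegral_maj_le hη hη1 hG hP ((measurable_newt _).comp (by fun_prop))
    ((measurable_newt _).comp (measurable_const.sub Θ.continuous.measurable))
    (lintegral_newt_le x (by positivity)) (lintegral_newt_iso_le Θ x (by positivity))
    (lintegral_cap_le x hη.le)

lemma lintegral_majKernel_left {η G P : ℝ} (hη : 0 < η) (hη1 : η ≤ 1) (hG : 0 ≤ G) (hP : 0 ≤ P)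
    (Θ : E3 ≃ₗᵢ[ℝ] E3) (y : E3) :
    ∫⁻ x, majKernel η G P Θ x y ∂sphMeasure ≤ ENNReal.ofReal (864 * G + 16000 * P * η) := by
  refine lintegral_maj_le hη hη1 hG hP ((measurable_newt _).comp (by fun_prop))
    ((measurable_newt _).comp (by fun_prop))
    (lintegral_newt_left_le y (by positivity)) (lintegral_newt_left_le (Θ y) (by positivity)) ?_
  simp only [add_comm _ y]
  exact lintegral_cap_le y hη.le

lemma integral_tri_fiber (κ : ℝ) (g u v : E3 → ℂ) (x y : E3) :
    ∫ p, (bump κ (x - y - p.1 - p.2) : ℂ) * (g y * (u p.1 * v p.2)) ∂sph2 =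
      g y * pairConv κ u v (x - y) := by
  rw [pairConv, ← integral_const_mul]
  exact integral_congr_ae (Eventually.of_forall fun p => by ring)

lemma tri_eq_integral {κ : ℝ} (hκ : 0 < κ) {g u v : E3 → ℂ} (hg : Integrable g sphMeasure)
    (hu : Integrable u sphMeasure) (hv : Integrable v sphMeasure) (x : E3) :
    tri κ g u v x = ∫ y, g y * pairConv κ u v (x - y) ∂sphMeasure := by
  have h := integrable_tri hκ hg hu hv x
  unfold tri sph3 at *
  rw [integral_prod _ h]
  exact integral_congr_ae (Eventually.of_forall fun y => integral_tri_fiber κ g u v x y)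

lemma integrable_mul_pairConv {κ : ℝ} (hκ : 0 < κ) {g u v : E3 → ℂ} (hg : Integrable g sphMeasure)
    (hu : Integrable u sphMeasure) (hv : Integrable v sphMeasure) (x : E3) :
    Integrable (fun y => g y * pairConv κ u v (x - y)) sphMeasure := by
  have h := integrable_tri hκ hg hu hv x
  unfold sph3 at h
  exact h.integral_prod_left.congr
    (Eventually.of_forall fun y => integral_tri_fiber κ g u v x y)

lemma integrable_comp_iso (Θ : E3 ≃ₗᵢ[ℝ] E3) {g : E3 → ℂ} (hg : Integrable g sphMeasure) :
    Integrable (g ∘ Θ) sphMeasure := (measurePreserving_sph Θ).integrable_comp_of_integrable hg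

lemma tri_comp_sub {κ : ℝ} (hκ : 0 < κ) (Θ : E3 ≃ₗᵢ[ℝ] E3) {g u v : E3 → ℂ}
    (hg : Integrable g sphMeasure)
    (hu : Integrable u sphMeasure) (hv : Integrable v sphMeasure) (x : E3) :
    tri κ (fun y => g (Θ y) - g y) u v x =
      ∫ y, g y * (pairConv κ u v (x - Θ.symm y) - pairConv κ u v (x - y)) ∂sphMeasure := by
  have hg' := integrable_comp_iso Θ hg
  have e : ∫ y, (g ∘ Θ) y * pairConv κ u v (x - y) ∂sphMeasure =
      ∫ y, g y * pairConv κ u v (x - Θ.symm y) ∂sphMeasure := by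
    have := (measurePreserving_sph Θ).integral_comp' (f := Θ.toMeasurableEquiv)
      (fun y => g y * pairConv κ u v (x - Θ.symm y))
    rw [← this]
    exact integral_congr_ae (Eventually.of_forall fun y => by simp)
  have hi : Integrable (fun y => g y * pairConv κ u v (x - Θ.symm y)) sphMeasure := by
    refine ((measurePreserving_sph Θ).integrable_comp_emb
      Θ.toMeasurableEquiv.measurableEmbedding).1 ?_
    refine (integrable_mul_pairConv hκ hg' hu hv x).congr (Eventually.of_forall fun y => by simp)
  have := tri_sub_left hκ hg' hg hu hv x
  simp only [Function.comp_apply] at this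
  rw [this, tri_eq_integral hκ hg hu hv]
  change tri κ (g ∘ Θ) u v x - _ = _
  rw [tri_eq_integral hκ hg' hu hv, e, ← integral_sub hi (integrable_mul_pairConv hκ hg hu hv x)]
  exact integral_congr_ae (Eventually.of_forall fun y => by ring)

lemma enorm_pairConv_le_newt {κ : ℝ} (hκ : 0 < κ) (hκ1 : κ ≤ 1) {B : ℝ} {u v : E3 → ℂ}
    (hu : RLip B B u) (hv : RLip B B v) {z : E3} (hz : z ≠ 0) :
    ‖pairConv κ u v z‖ ≤ B ^ 2 * pairConst * ‖z‖⁻¹ := by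
  refine (norm_pairConv_le hκ z hu hv).trans ?_
  rw [mul_assoc, ← div_eq_mul_inv]
  gcongr
  exact pairMass_le hκ hκ1 hz

lemma norm_add_sq_add_norm_sub_sq {x y : E3} (hx : x ∈ sph) (hy : y ∈ sph) :
    ‖x + y‖ ^ 2 + ‖x - y‖ ^ 2 = 4 := by
  rw [norm_add_sq_real, norm_sub_sq_real, norm_eq_one_of_mem_sph hx, norm_eq_one_of_mem_sph hy]
  ring

/-- The bound for the difference kernel in the nondegenerate zone. -/
def goodBound (η B θ : ℝ) : ℝ := 72 * ((η ^ 4 / 32)⁻¹ ^ 2 * B ^ 2 * θ) * (2 * pairConst / η)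

lemma enorm_pairConv_sub_le_majKernel {κ η : ℝ} (hκ : 0 < κ) (hκ1 : κ ≤ 1) (hη : 0 < η)
    (hη1 : η ≤ 1 / 2) (Θ : E3 ≃ₗᵢ[ℝ] E3) (hθη : O3dist Θ + κ ≤ η ^ 2 / 16) {B : ℝ} {u v : E3 → ℂ}
    (hu : RLip B B u) (hv : RLip B B v) {x y : E3} (hx : x ∈ sph) (hy : y ∈ sph) (hxy : x ≠ y)
    (hxy' : x ≠ Θ y) (hΘ : ‖Θ y - y‖ ≤ O3dist Θ) :
    ‖pairConv κ u v (x - Θ y) - pairConv κ u v (x - y)‖ₑ ≤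
      majKernel η (goodBound η B (O3dist Θ)) (B ^ 2 * pairConst) Θ x y := by
  have hP : 0 ≤ B ^ 2 * pairConst := mul_nonneg (sq_nonneg _) pairConst_pos.le
  have hθ := O3dist_nonneg Θ
  have hz : x - y ≠ 0 := sub_ne_zero.2 hxy
  have hz' : x - Θ y ≠ 0 := sub_ne_zero.2 hxy'
  have e : x - Θ y = (x - y) + (y - Θ y) := by abel
  have hb : ‖y - Θ y‖ ≤ O3dist Θ := by rw [norm_sub_rev]; exact hΘ
  have hsmall : O3dist Θ ≤ η / 2 := by nlinarith
  have b1 := enorm_pairConv_le_newt hκ hκ1 hu hv hz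
  have b2 := enorm_pairConv_le_newt hκ hκ1 hu hv hz'
  have htri : ‖pairConv κ u v (x - Θ y) - pairConv κ u v (x - y)‖ₑ ≤
      ENNReal.ofReal (B ^ 2 * pairConst) * (ENNReal.ofReal ‖x - y‖⁻¹ +
        ENNReal.ofReal ‖x - Θ y‖⁻¹) := by
    rw [← ENNReal.ofReal_add (by positivity) (by positivity), ← ENNReal.ofReal_mul hP,
      ← ofReal_norm]
    refine ENNReal.ofReal_le_ofReal ((norm_sub_le _ _).trans ?_)
    linarith
  unfold majKernel
  by_cases h1 : ‖x - y‖ < η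
  · have h2 : ‖x - Θ y‖ ≤ 2 * η := by
      rw [e]; exact (norm_add_le _ _).trans (by linarith)
    rw [newt_eq (by linarith : ‖x - y‖ ≤ 2 * η), newt_eq h2]
    refine htri.trans (le_trans ?_ le_add_self)
    exact mul_le_mul_right le_self_add _
  · push Not at h1
    by_cases h3 : ‖x - y‖ ^ 2 ≤ 4 - η ^ 2
    · refine le_trans ?_ le_self_add
      rw [← ofReal_norm]
      refine ENNReal.ofReal_le_ofReal ?_
      have := pairConv_sub_le hκ hκ1 hη (by linarith) hθ hθη hu hv hb h1 h3
      rwa [← e] at this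
    · push Not at h3
      have h4 := norm_add_sq_add_norm_sub_sq hx hy
      have h5 : ‖x + y‖ ≤ η := by
        refine (pow_le_pow_iff_left₀ (norm_nonneg _) hη.le two_ne_zero).1 ?_
        linarith
      have h6 : 3 / 2 ≤ ‖x - y‖ := by
        refine (pow_le_pow_iff_left₀ (by norm_num) (norm_nonneg _) two_ne_zero).1 ?_
        nlinarith
      have h7 : 1 ≤ ‖x - Θ y‖ := by
        have := norm_sub_norm_le (x - y) (-(y - Θ y))
        rw [sub_neg_eq_add, ← e, norm_neg] at this
        linarith
      have i1 : ENNReal.ofReal ‖x - y‖⁻¹ ≤ 1 :=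
        ENNReal.ofReal_le_one.2 (inv_le_one_of_one_le₀ (by linarith))
      have i2 : ENNReal.ofReal ‖x - Θ y‖⁻¹ ≤ 1 :=
        ENNReal.ofReal_le_one.2 (inv_le_one_of_one_le₀ h7)
      rw [Set.indicator_of_mem (by simpa using h5)]
      refine htri.trans (le_trans ?_ le_add_self)
      refine mul_le_mul_right (le_trans ?_ le_add_self) _
      rw [mul_one]
      exact (add_le_add i1 i2).trans one_add_one_eq_two.le

lemma goodBound_nonneg {η B θ : ℝ} (hη : 0 < η) (hθ : 0 ≤ θ) : 0 ≤ goodBound η B θ := by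
  have := pairConst_pos
  unfold goodBound; positivity

lemma norm_apply_sub_le_of_mem_sph (Θ : E3 ≃ₗᵢ[ℝ] E3) {y : E3} (hy : y ∈ sph) :
    ‖Θ y - y‖ ≤ O3dist Θ := by
  simpa [norm_eq_one_of_mem_sph hy] using norm_apply_sub_le Θ y

lemma O3dist_symm (Θ : E3 ≃ₗᵢ[ℝ] E3) : O3dist Θ.symm = O3dist Θ := by
  have key : ∀ Θ : E3 ≃ₗᵢ[ℝ] E3, O3dist Θ.symm ≤ O3dist Θ := fun Θ => by
    refine ContinuousLinearMap.opNorm_le_bound _ (O3dist_nonneg Θ) fun x => ?_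
    have h := norm_apply_sub_le Θ (Θ.symm x)
    rw [LinearIsometryEquiv.apply_symm_apply, LinearIsometryEquiv.norm_map, norm_sub_rev] at h
    exact h
  exact le_antisymm (key Θ) (by simpa using key Θ.symm)

lemma nrm_tri_comp_sub_le {κ η : ℝ} (hκ : 0 < κ) (hκ1 : κ ≤ 1) (hη : 0 < η)
    (hη1 : η ≤ 1 / 2) (Θ : E3 ≃ₗᵢ[ℝ] E3) (hθη : O3dist Θ + κ ≤ η ^ 2 / 16) {B : ℝ} {u v : E3 → ℂ}
    (hu : RLip B B u) (hv : RLip B B v) (g : HH) :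
    nrm (fun x => ‖tri κ (fun y => g (Θ y) - g y) u v x‖ₑ) ≤
      ENNReal.ofReal (864 * goodBound η B (O3dist Θ) + 16000 * (B ^ 2 * pairConst) * η) *
        nrm (fun x => ‖g x‖ₑ) := by
  have hP : 0 ≤ B ^ 2 * pairConst := mul_nonneg (sq_nonneg _) pairConst_pos.le
  have hG : 0 ≤ goodBound η B (O3dist Θ) := goodBound_nonneg hη (O3dist_nonneg _)
  have hgi : Integrable (fun y => g (Θ y) - g y) sphMeasure :=
    (integrable_comp_iso Θ g.integrable).sub g.integrable
  refine nrm_le_of_kernel (measurable_majKernel η _ _ Θ.symm)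
    (Eventually.of_forall fun x => lintegral_majKernel_right hη (by linarith) hG hP Θ.symm x)
    (Eventually.of_forall fun y => lintegral_majKernel_left hη (by linarith) hG hP Θ.symm y)
    (continuous_tri hκ hgi hu.integrable hv.integrable).measurable.enorm g.measurable_enorm ?_ ?_
  · rw [nrm_enorm]
    exact (memLp_tri hκ hgi hu.integrable hv.integrable).eLpNorm_ne_top
  · filter_upwards [ae_mem_sph] with x hx
    rw [tri_comp_sub hκ Θ g.integrable hu.integrable hv.integrable]
    refine (enorm_integral_le_lintegral_enorm _).trans (lintegral_mono_ae ?_)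
    have h1 : ∀ᵐ y ∂sphMeasure, y ≠ x := Measure.ae_ne _ _
    have h2 : ∀ᵐ y ∂sphMeasure, y ≠ Θ x := Measure.ae_ne _ _
    filter_upwards [ae_mem_sph, h1, h2] with y hy hy1 hy2
    rw [enorm_mul, mul_comm]
    gcongr
    rw [← O3dist_symm Θ] at hθη ⊢
    refine enorm_pairConv_sub_le_majKernel hκ hκ1 hη hη1 Θ.symm hθη hu hv hx hy hy1.symm ?_
      (norm_apply_sub_le_of_mem_sph _ hy)
    rintro rfl
    simp at hy2

/-- Hölder regularity of order `ε` along rotations, with constant `M`. -/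
structure Reg (ε M : ℝ) (f : HH) : Prop where
  norm_le : ‖f‖ ≤ M
  holder : ∀ Ψ : E3 ≃ₗᵢ[ℝ] E3, ‖rot Ψ f - f‖ ≤ M * O3dist Ψ ^ ε

lemma norm_sub_le_of_eLpNorm {w f : HH} {u : E3 → ℂ} (hw : w =ᵐ[sphMeasure] u) {E : ℝ} (hE : 0 ≤ E)
    (h : eLpNorm (fun x => u x - f x) 2 sphMeasure ≤ ENNReal.ofReal E) : ‖w - f‖ ≤ E := by
  rw [← ENNReal.ofReal_le_ofReal_iff hE, ofReal_norm, Lp.enorm_def]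
  refine le_trans (le_of_eq (eLpNorm_congr_ae ?_)) h
  filter_upwards [Lp.coeFn_sub w f, hw] with x h1 h2
  rw [h1, Pi.sub_apply, h2]

lemma exists_mollification_HH : ∃ C : ℝ, 0 ≤ C ∧ ∃ d : ℕ, ∀ l : ℝ, 0 < l → l ≤ 1 →
    ∀ (ε M : ℝ) (f : HH), 0 ≤ ε → Reg ε M f → ∃ (u : E3 → ℂ) (w : HH),
      RLip (C * l⁻¹ ^ d * M) (C * l⁻¹ ^ d * M) u ∧ w =ᵐ[sphMeasure] u ∧ ‖w - f‖ ≤ M * l ^ ε := by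
  obtain ⟨C, hC, d, H⟩ := exists_mollification
  refine ⟨C, hC, d, fun l hl hl1 ε M f hε hf => ?_⟩
  obtain ⟨u, hm, hb, hL, hE⟩ := H l hl hl1 f
  have hM : 0 ≤ M := (norm_nonneg f).trans hf.norm_le
  have hle : C * l⁻¹ ^ d * ‖f‖ ≤ C * l⁻¹ ^ d * M := by
    gcongr; exact hf.norm_le
  have hR : RLip (C * l⁻¹ ^ d * M) (C * l⁻¹ ^ d * M) u :=
    (RLip.mk hm hb hL).mono hle hle
  have hmem : MemLp u 2 sphMeasure := MemLp.of_bound hm.aestronglyMeasurable _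
    (ae_mem_sph.mono fun x hx => hb x hx)
  refine ⟨u, hmem.toLp, hR, hmem.coeFn_toLp, ?_⟩
  refine norm_sub_le_of_eLpNorm hmem.coeFn_toLp (by positivity) (hE _ fun Θ hΘ => ?_)
  refine (hf.holder Θ).trans ?_
  gcongr
  exact O3dist_nonneg Θ

lemma norm_rot_sub_le (Θ : E3 ≃ₗᵢ[ℝ] E3) (g : HH) : ‖rot Θ g - g‖ ≤ 2 * ‖g‖ := by
  refine (norm_sub_le _ _).trans ?_
  rw [norm_rot]; linarith

lemma norm_triLp_rot_sub_le_of_rlip {κ η : ℝ} (hκ : 0 < κ) (hκ1 : κ ≤ 1) (hη : 0 < η)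
    (hη1 : η ≤ 1 / 2) (Θ : E3 ≃ₗᵢ[ℝ] E3) (hθη : O3dist Θ + κ ≤ η ^ 2 / 16) {B : ℝ} {u v : E3 → ℂ}
    (hu : RLip B B u) (hv : RLip B B v) {u' v' : HH} (hu' : u' =ᵐ[sphMeasure] u)
    (hv' : v' =ᵐ[sphMeasure] v) (g : HH) :
    ‖triLp hκ (rot Θ g - g) u' v'‖ ≤
      (864 * goodBound η B (O3dist Θ) + 16000 * (B ^ 2 * pairConst) * η) * ‖g‖ := by
  have h := nrm_tri_comp_sub_le hκ hκ1 hη hη1 Θ hθη hu hv g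
  have hP := pairConst_pos
  have h0 : 0 ≤ 864 * goodBound η B (O3dist Θ) + 16000 * (B ^ 2 * pairConst) * η := by
    have := goodBound_nonneg (B := B) hη (O3dist_nonneg Θ)
    positivity
  rw [HH.nrm_eq, nrm_enorm, ← ofReal_norm g, ← ENNReal.ofReal_mul h0] at h
  rw [← ENNReal.ofReal_le_ofReal_iff (by positivity), ofReal_norm, Lp.enorm_def]
  refine le_trans (le_of_eq (eLpNorm_congr_ae ?_)) h
  refine (triLp_coe _ _ _ _).trans ?_
  rw [tri_congr_ae κ (g := u') (h := v') (f' := fun y => g (Θ y) - g y) ?_ hu' hv']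
  filter_upwards [Lp.coeFn_sub (rot Θ g) g, rot_coe Θ g] with x h1 h2
  rw [h1, Pi.sub_apply, h2, Function.comp_apply]

lemma exists_root_scale {θ : ℝ} (hθ : 0 < θ) (hθ1 : θ ≤ 1 / 1024) {m : ℕ} (hm : 0 < m) {ε : ℝ} :
    ∃ l : ℝ, 0 < l ∧ l ≤ 1 ∧ l ^ m ≤ 1 / 2 ∧ (l ^ m) ^ 10 = θ ∧
      l ^ ε = θ ^ (ε / (10 * m)) := by
  have hm' : (0 : ℝ) < m := by exact_mod_cast hm
  have e1 : (θ ^ (1 / (10 * m) : ℝ)) ^ m = θ ^ (1 / 10 : ℝ) := by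
    rw [← Real.rpow_natCast, ← Real.rpow_mul hθ.le]
    congr 1; field_simp
  refine ⟨θ ^ (1 / (10 * m) : ℝ), Real.rpow_pos_of_pos hθ _,
    Real.rpow_le_one hθ.le (by linarith) (by positivity), ?_, ?_, ?_⟩
  · rw [e1]
    calc θ ^ (1 / 10 : ℝ) ≤ (1 / 1024) ^ (1 / 10 : ℝ) := by gcongr
      _ = ((1 / 2 : ℝ) ^ (10 : ℝ)) ^ (1 / 10 : ℝ) := by norm_num
      _ = _ := by rw [← Real.rpow_mul (by norm_num)]; norm_num
  · rw [e1, ← Real.rpow_natCast, ← Real.rpow_mul hθ.le]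
    norm_num
  · rw [← Real.rpow_mul hθ.le]
    congr 1; field_simp

lemma triLp_sub_le {κ : ℝ} (hκ : 0 < κ) (hκ1 : κ ≤ 1 / 10) {M E : ℝ} {G f₂ f₃ u v : HH}
    (h₂ : ‖f₂‖ ≤ M) (h₃ : ‖f₃‖ ≤ M) (hu : ‖u - f₂‖ ≤ E) (hv : ‖v - f₃‖ ≤ E) (hEM : E ≤ M) :
    ‖triLp hκ G f₂ f₃ - triLp hκ G u v‖ ≤ 6 * pairConst * ‖G‖ * (3 * M * E) := by
  have hP := pairConst_pos
  have hM : 0 ≤ M := (norm_nonneg _).trans h₂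
  have hE : 0 ≤ E := (norm_nonneg _).trans hu
  have e : triLp hκ G f₂ f₃ - triLp hκ G u v = triLp hκ G f₂ (f₃ - v) + triLp hκ G (f₂ - u) v := by
    rw [triLp_sub_mid, triLp_sub_right]; abel
  have hv' : ‖v‖ ≤ 2 * M := by
    calc ‖v‖ = ‖(v - f₃) + f₃‖ := by rw [sub_add_cancel]
      _ ≤ _ := (norm_add_le _ _).trans (by linarith)
  rw [e]
  calc _ ≤ _ := norm_add_le _ _
    _ ≤ 6 * pairConst * (‖G‖ * (‖f₂‖ * ‖f₃ - v‖)) + 6 * pairConst * (‖G‖ * (‖f₂ - u‖ * ‖v‖)) :=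
      add_le_add (norm_triLp_le hκ hκ1 _ _ _) (norm_triLp_le hκ hκ1 _ _ _)
    _ ≤ 6 * pairConst * (‖G‖ * (M * E)) + 6 * pairConst * (‖G‖ * (E * (2 * M))) := by
      rw [norm_sub_rev f₃, norm_sub_rev f₂]
      gcongr
    _ = _ := by ring

lemma goodBound_root_le {η B : ℝ} (hη : 0 < η) :
    864 * goodBound η B (η ^ 10) + 16000 * (B ^ 2 * pairConst) * η =
      127417984 * (pairConst * B ^ 2 * η) := by
  unfold goodBound
  field_simp
  ring

theorem smoothing {ε : ℝ} (hε : 0 < ε) (hε1 : ε ≤ 1) : ∃ C δ : ℝ, 0 ≤ C ∧ 0 < δ ∧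
    ∀ (κ : ℝ) (hκ : 0 < κ), κ ≤ 1 / 10 → ∀ Θ : E3 ≃ₗᵢ[ℝ] E3, κ ≤ O3dist Θ →
    ∀ (M : ℝ) (f₂ f₃ : HH), Reg ε M f₂ → Reg ε M f₃ → ∀ g : HH,
      ‖triLp hκ (rot Θ g - g) f₂ f₃‖ ≤ C * M ^ 2 * O3dist Θ ^ δ * ‖g‖ := by
  obtain ⟨C, hC, d, H⟩ := exists_mollification_HH
  have hP := pairConst_pos
  set m : ℕ := 4 * (d + 1) with hm
  set δ : ℝ := ε / (10 * m) with hδ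
  have hm0 : 0 < m := by omega
  have hmR : (1 : ℝ) ≤ m := by exact_mod_cast hm0
  have hδ0 : 0 < δ := by positivity
  have hδ1 : δ ≤ 1 := by
    rw [hδ, div_le_one (by positivity)]; linarith
  refine ⟨12 * 1024 * pairConst + 36 * pairConst + 127417984 * (pairConst * C ^ 2), δ,
    by positivity, hδ0, fun κ hκ hκ1 Θ hκΘ M f₂ f₃ hf₂ hf₃ g => ?_⟩
  have hM : 0 ≤ M := (norm_nonneg _).trans hf₂.norm_le
  set θ := O3dist Θ with hθ
  have hθ0 : 0 < θ := hκ.trans_le hκΘ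
  have hG := norm_rot_sub_le Θ g
  rcases le_or_gt θ (1 / 1024) with hs | hs
  · obtain ⟨l, hl, hl1, hη1, hη10, hlε⟩ := exists_root_scale hθ0 hs hm0 (ε := ε)
    set η := l ^ m with hη
    have hη0 : 0 < η := by positivity
    obtain ⟨u, u', hu, hu', hue⟩ := H l hl hl1 ε M f₂ hε.le hf₂
    obtain ⟨v, v', hv, hv', hve⟩ := H l hl hl1 ε M f₃ hε.le hf₃
    have hlε1 : l ^ ε ≤ 1 := Real.rpow_le_one hl.le hl1 hε.le
    have hη8 : η ^ 8 ≤ (1 / 2) ^ 8 := by gcongr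
    have hcond : O3dist Θ + κ ≤ η ^ 2 / 16 := by
      have : η ^ 10 = η ^ 2 * η ^ 8 := by ring
      have h2 : η ^ 2 * η ^ 8 ≤ η ^ 2 * (1 / 2) ^ 8 := by gcongr
      rw [← hθ]
      nlinarith [sq_nonneg η]
    have main := norm_triLp_rot_sub_le_of_rlip hκ (by linarith) hη0 hη1 Θ hcond hu hv hu' hv' g
    rw [← hθ, ← hη10, goodBound_root_le hη0] at main
    have err := triLp_sub_le hκ hκ1 (G := rot Θ g - g) hf₂.norm_le hf₃.norm_le hue hve
      (mul_le_of_le_one_right hM hlε1)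
    have hBη : (C * l⁻¹ ^ d * M) ^ 2 * η ≤ C ^ 2 * M ^ 2 * l ^ ε := by
      have e1 : (C * l⁻¹ ^ d * M) ^ 2 * η = C ^ 2 * M ^ 2 * l ^ (2 * d + 4) := by
        have h1 : l⁻¹ ^ d * l ^ d = 1 := by rw [← mul_pow, inv_mul_cancel₀ hl.ne', one_pow]
        rw [hη, hm, show 4 * (d + 1) = d + d + (2 * d + 4) by ring, pow_add, pow_add l d d]
        linear_combination (C ^ 2 * M ^ 2 * l ^ (2 * d + 4)) * (l⁻¹ ^ d * l ^ d + 1) * h1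
      rw [e1]
      gcongr
      rw [← Real.rpow_natCast]
      refine Real.rpow_le_rpow_of_exponent_ge hl hl1 ?_
      push_cast
      have : (0 : ℝ) ≤ d := Nat.cast_nonneg d
      linarith
    rw [← hlε]
    calc ‖triLp hκ (rot Θ g - g) f₂ f₃‖ = ‖triLp hκ (rot Θ g - g) u' v' +
        (triLp hκ (rot Θ g - g) f₂ f₃ - triLp hκ (rot Θ g - g) u' v')‖ := by rw [add_sub_cancel]
      _ ≤ _ := norm_add_le _ _
      _ ≤ 127417984 * (pairConst * (C * l⁻¹ ^ d * M) ^ 2 * η) * ‖g‖ +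
          6 * pairConst * (2 * ‖g‖) * (3 * M * (M * l ^ ε)) := by
        refine add_le_add main (err.trans ?_)
        gcongr
      _ ≤ 127417984 * (pairConst * (C ^ 2 * M ^ 2 * l ^ ε)) * ‖g‖ +
          6 * pairConst * (2 * ‖g‖) * (3 * M * (M * l ^ ε)) := by
        rw [mul_assoc pairConst]
        gcongr
      _ ≤ _ := by
        have : 0 ≤ pairConst * M ^ 2 * l ^ ε * ‖g‖ := by positivity
        nlinarith
  · have h1 : 1 / 1024 ≤ θ ^ δ := by
      calc (1 / 1024 : ℝ) = (1 / 1024) ^ (1 : ℝ) := by rw [Real.rpow_one]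
        _ ≤ (1 / 1024) ^ δ := Real.rpow_le_rpow_of_exponent_ge (by norm_num) (by norm_num) hδ1
        _ ≤ θ ^ δ := by gcongr
    calc _ ≤ _ := norm_triLp_le hκ hκ1 _ _ _
      _ ≤ 6 * pairConst * (2 * ‖g‖ * (M * M)) := by
        gcongr
        exacts [hf₂.norm_le, hf₃.norm_le]
      _ ≤ 12 * 1024 * pairConst * M ^ 2 * θ ^ δ * ‖g‖ := by
        have : 0 ≤ 12 * pairConst * M ^ 2 * ‖g‖ := by positivity
        nlinarith
      _ ≤ _ := by
        gcongr
        have : 0 ≤ pairConst * C ^ 2 := by positivity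
        nlinarith

/-- The difference operator `f ↦ f ∘ Θ - f` on `L²(σ)`. -/
def dif (Θ : E3 ≃ₗᵢ[ℝ] E3) : HH →L[ℂ] HH := rot Θ - 1

lemma dif_apply (Θ : E3 ≃ₗᵢ[ℝ] E3) (f : HH) : dif Θ f = rot Θ f - f := by
  simp [dif]

lemma norm_dif_apply_le (Θ : E3 ≃ₗᵢ[ℝ] E3) (f : HH) : ‖dif Θ f‖ ≤ 2 * ‖f‖ := by
  rw [dif_apply]; exact norm_rot_sub_le Θ f

lemma norm_pow_dif_apply_le (Θ : E3 ≃ₗᵢ[ℝ] E3) (n : ℕ) (f : HH) :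
    ‖(dif Θ ^ n) f‖ ≤ 2 ^ n * ‖f‖ := by
  induction n with
  | zero => simp
  | succ n ih =>
    rw [pow_succ', mul_apply_eq_comp, pow_succ', mul_assoc]
    exact (norm_dif_apply_le Θ _).trans (by gcongr)

lemma commute_dif_rot (Θ : E3 ≃ₗᵢ[ℝ] E3) : Commute (dif Θ) (rot Θ) :=
  (Commute.refl (rot Θ)).sub_left (Commute.one_left _)

lemma rot_sq (Θ : E3 ≃ₗᵢ[ℝ] E3) : rot Θ * rot Θ = rot (Θ.trans Θ) := by
  ext1 f
  exact (rot_trans Θ Θ f).symm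

lemma O3dist_le_two (Θ : E3 ≃ₗᵢ[ℝ] E3) : O3dist Θ ≤ 2 := by
  refine ContinuousLinearMap.opNorm_le_bound _ (by norm_num) fun x => ?_
  calc ‖Θ x - x‖ ≤ ‖Θ x‖ + ‖x‖ := norm_sub_le _ _
    _ = 2 * ‖x‖ := by rw [LinearIsometryEquiv.norm_map]; ring

lemma O3dist_trans_le (Θ Ψ : E3 ≃ₗᵢ[ℝ] E3) : O3dist (Θ.trans Ψ) ≤ O3dist Θ + O3dist Ψ := by
  refine ContinuousLinearMap.opNorm_le_bound _
    (add_nonneg (O3dist_nonneg _) (O3dist_nonneg _)) fun x => ?_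
  calc ‖Ψ (Θ x) - x‖ = ‖(Ψ (Θ x) - Θ x) + (Θ x - x)‖ := by rw [sub_add_sub_cancel]
    _ ≤ O3dist Ψ * ‖Θ x‖ + O3dist Θ * ‖x‖ := (norm_add_le _ _).trans
      (add_le_add (norm_apply_sub_le _ _) (norm_apply_sub_le _ _))
    _ = _ := by rw [LinearIsometryEquiv.norm_map]; ring

lemma norm_rot_add_one_le (Θ : E3 ≃ₗᵢ[ℝ] E3) : ‖rot Θ + 1‖ ≤ 2 := by
  refine ContinuousLinearMap.opNorm_le_bound _ (by norm_num) fun f => ?_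
  calc ‖rot Θ f + f‖ ≤ ‖rot Θ f‖ + ‖f‖ := norm_add_le _ _
    _ = 2 * ‖f‖ := by rw [norm_rot]; ring

lemma norm_pow_dif_le_double (Θ : E3 ≃ₗᵢ[ℝ] E3) (n : ℕ) (F : HH) :
    ‖(dif Θ ^ n) F‖ ≤ (2 ^ n)⁻¹ * ‖(dif (Θ.trans Θ) ^ n) F‖ +
      n / 2 * ‖(dif Θ ^ (n + 1)) F‖ := by
  rcases Nat.eq_zero_or_pos n with rfl | hn
  · simp
  set V := rot Θ + 1 with hV
  set R : HH →L[ℂ] HH := ∑ i ∈ Finset.range n, V ^ i * (2 : HH →L[ℂ] HH) ^ (n - 1 - i) with hR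
  have htwo : (2 : HH →L[ℂ] HH) = 1 + 1 := one_add_one_eq_two.symm
  have c2 : Commute V 2 := Commute.ofNat_right V 2
  have hVD : Commute V (dif Θ) := ((commute_dif_rot Θ).symm).add_left (Commute.one_left _)
  have e1 : R * dif Θ = V ^ n - 2 ^ n := by
    have := c2.geom_sum₂_mul n
    rw [← this]
    congr 1
    rw [hV, dif, htwo]; abel
  have e2 : dif (Θ.trans Θ) ^ n = V ^ n * dif Θ ^ n := by
    rw [← hVD.mul_pow]
    congr 1
    rw [dif, ← rot_sq, hV, dif]
    noncomm_ring
  have e3 : (2 : HH →L[ℂ] HH) ^ n * dif Θ ^ n = dif (Θ.trans Θ) ^ n - R * dif Θ ^ (n + 1) := by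
    rw [e2, pow_succ', ← mul_assoc R, e1, sub_mul]; abel
  have h1 : ‖(1 : HH →L[ℂ] HH)‖ ≤ 1 := ContinuousLinearMap.norm_id_le
  have h2 : ‖(2 : HH →L[ℂ] HH)‖ ≤ 2 := by
    rw [htwo]
    exact (norm_add_le _ _).trans (by linarith)
  have hpow : ∀ (A : HH →L[ℂ] HH), ‖A‖ ≤ 2 → ∀ k : ℕ, ‖A ^ k‖ ≤ 2 ^ k := fun A hA k => by
    induction k with
    | zero => simpa using h1
    | succ k ih =>
      rw [pow_succ, pow_succ]
      exact (norm_mul_le _ _).trans (by gcongr)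
  have hRn : ‖R‖ ≤ n * 2 ^ (n - 1) := by
    refine (norm_sum_le _ _).trans ?_
    calc _ ≤ ∑ i ∈ Finset.range n, (2 : ℝ) ^ (n - 1) := by
          refine Finset.sum_le_sum fun i hi => ?_
          rw [Finset.mem_range] at hi
          calc _ ≤ ‖V ^ i‖ * ‖(2 : HH →L[ℂ] HH) ^ (n - 1 - i)‖ := norm_mul_le _ _
            _ ≤ 2 ^ i * 2 ^ (n - 1 - i) := by
              gcongr
              exacts [hpow _ (norm_rot_add_one_le Θ) _, hpow _ h2 _]
            _ = _ := by rw [← pow_add]; congr 1; omega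
      _ = _ := by simp
  have e4 : (2 : ℂ) ^ n • (dif Θ ^ n) F = (dif (Θ.trans Θ) ^ n) F - R ((dif Θ ^ (n + 1)) F) := by
    have := congrArg (fun A : HH →L[ℂ] HH => A F) e3
    simp only [mul_apply_eq_comp, sub_apply] at this
    rw [← this]
    have h3 : (2 : HH →L[ℂ] HH) ^ n = (2 : ℂ) ^ n • (1 : HH →L[ℂ] HH) := by
      rw [show (2 : HH →L[ℂ] HH) = (2 : ℂ) • (1 : HH →L[ℂ] HH) by
        rw [two_smul, one_add_one_eq_two], smul_pow, one_pow]
    rw [h3]; rfl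
  have e5 : 2 ^ n * ‖(dif Θ ^ n) F‖ ≤ ‖(dif (Θ.trans Θ) ^ n) F‖ +
      n * 2 ^ (n - 1) * ‖(dif Θ ^ (n + 1)) F‖ := by
    have := congrArg norm e4
    rw [norm_smul, norm_pow, Complex.norm_ofNat] at this
    rw [this]
    refine (norm_sub_le _ _).trans (by gcongr; exact R.le_of_opNorm_le hRn _)
  have e6 : (2 : ℝ) ^ n = 2 * 2 ^ (n - 1) := by
    rw [← pow_succ']; congr 1; omega
  have hp : (0 : ℝ) < 2 ^ n := by positivity
  have hq : (0 : ℝ) < 2 ^ (n - 1) := by positivity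
  refine le_of_mul_le_mul_left (e5.trans (le_of_eq ?_)) hp
  rw [mul_add, ← mul_assoc, mul_inv_cancel₀ hp.ne', one_mul]
  rw [e6]; ring

/-- Marchaud-type inequality: the order of the difference may be lowered. -/
lemma marchaud {n : ℕ} {t C : ℝ} (ht0 : 0 < t) (ht : t < n) (hC : 0 ≤ C) {F : HH}
    (h : ∀ Θ : E3 ≃ₗᵢ[ℝ] E3, ‖(dif Θ ^ (n + 1)) F‖ ≤ C * O3dist Θ ^ t) :
    ∃ C' : ℝ, 0 ≤ C' ∧ ∀ Θ : E3 ≃ₗᵢ[ℝ] E3, ‖(dif Θ ^ n) F‖ ≤ C' * O3dist Θ ^ t := by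
  set q : ℝ := (2 ^ n)⁻¹ * 2 ^ t with hq
  have hp : (0 : ℝ) < 2 ^ n := by positivity
  have hq1 : q < 1 := by
    rw [hq, inv_mul_lt_iff₀ hp, mul_one, ← Real.rpow_natCast 2 n]
    exact Real.rpow_lt_rpow_of_exponent_lt (by norm_num) ht
  have hn : 0 < n := by
    have : (0 : ℝ) < n := ht0.trans ht
    exact_mod_cast this
  set C' := n / 2 * C / (1 - q) with hC'
  have hC'0 : 0 ≤ C' := div_nonneg (by positivity) (by linarith)
  have hfix : q * C' + n / 2 * C = C' := by
    rw [hC']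
    have : 1 - q ≠ 0 := by linarith
    field_simp
    ring
  have key : ∀ K : ℕ, ∀ Θ : E3 ≃ₗᵢ[ℝ] E3,
      ‖(dif Θ ^ n) F‖ ≤ C' * O3dist Θ ^ t + ((2 ^ n)⁻¹) ^ K * (2 ^ n * ‖F‖) := by
    intro K
    induction K with
    | zero =>
      intro Θ
      have := Real.rpow_nonneg (O3dist_nonneg Θ) t
      rw [pow_zero, one_mul]
      exact (norm_pow_dif_apply_le Θ n F).trans (le_add_of_nonneg_left (by positivity))
    | succ K ih =>
      intro Θ
      have h0 := O3dist_nonneg Θ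
      have hdd : O3dist (Θ.trans Θ) ^ t ≤ 2 ^ t * O3dist Θ ^ t := by
        rw [← Real.mul_rpow (by norm_num) h0]
        refine Real.rpow_le_rpow (O3dist_nonneg _) ?_ ht0.le
        linarith [O3dist_trans_le Θ Θ]
      calc _ ≤ _ := norm_pow_dif_le_double Θ n F
        _ ≤ (2 ^ n)⁻¹ * (C' * (2 ^ t * O3dist Θ ^ t) + ((2 ^ n)⁻¹) ^ K * (2 ^ n * ‖F‖)) +
            n / 2 * (C * O3dist Θ ^ t) := by
          gcongr
          · exact (ih _).trans (by gcongr)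
          · exact h Θ
        _ = (q * C' + n / 2 * C) * O3dist Θ ^ t + ((2 ^ n)⁻¹) ^ (K + 1) * (2 ^ n * ‖F‖) := by
          rw [hq]; ring
        _ = _ := by rw [hfix]
  refine ⟨C', hC'0, fun Θ => ?_⟩
  have hlim : Tendsto (fun K : ℕ => C' * O3dist Θ ^ t + ((2 ^ n : ℝ)⁻¹) ^ K * (2 ^ n * ‖F‖)) atTop
      (nhds (C' * O3dist Θ ^ t + 0 * (2 ^ n * ‖F‖))) := by
    refine tendsto_const_nhds.add
      ((tendsto_pow_atTop_nhds_zero_of_lt_one (by positivity) ?_).mul_const _)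
    exact inv_lt_one_of_one_lt₀ (one_lt_pow₀ (by norm_num) hn.ne')
  rw [zero_mul, add_zero] at hlim
  exact ge_of_tendsto' hlim fun K => key K Θ

lemma marchaud_iterate {n k : ℕ} {t C : ℝ} (ht0 : 0 < t) (ht : t < n) (hC : 0 ≤ C) {F : HH}
    (h : ∀ Θ : E3 ≃ₗᵢ[ℝ] E3, ‖(dif Θ ^ (n + k)) F‖ ≤ C * O3dist Θ ^ t) :
    ∃ C' : ℝ, 0 ≤ C' ∧ ∀ Θ : E3 ≃ₗᵢ[ℝ] E3, ‖(dif Θ ^ n) F‖ ≤ C' * O3dist Θ ^ t := by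
  induction k generalizing C with
  | zero => exact ⟨C, hC, h⟩
  | succ k ih =>
    obtain ⟨C₁, hC₁, h₁⟩ := marchaud (n := n + k) ht0
      (ht.trans_le (by exact_mod_cast Nat.le_add_right n k)) hC h
    exact ih hC₁ h₁

lemma rpow_O3dist_le (Θ : E3 ≃ₗᵢ[ℝ] E3) {t s : ℝ} (ht : 0 < t) (hts : t ≤ s) :
    O3dist Θ ^ s ≤ 2 ^ (s - t) * O3dist Θ ^ t := by
  have h0 := O3dist_nonneg Θ
  rcases h0.eq_or_lt with h | h
  · rw [← h, Real.zero_rpow (by linarith), Real.zero_rpow ht.ne', mul_zero]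
  · calc O3dist Θ ^ s = O3dist Θ ^ (s - t) * O3dist Θ ^ t := by
          rw [← Real.rpow_add h]; congr 1; ring
      _ ≤ _ := by
        gcongr
        exact O3dist_le_two Θ

/-- Smoothness of order `s`, measured by differences of order `n`. -/
def Smooth (s : ℝ) (n : ℕ) (F : HH) : Prop :=
  ∃ C : ℝ, 0 ≤ C ∧ ∀ Θ : E3 ≃ₗᵢ[ℝ] E3, ‖(dif Θ ^ n) F‖ ≤ C * O3dist Θ ^ s

lemma Smooth.lower_exponent {s t : ℝ} {n : ℕ} {F : HH} (h : Smooth s n F) (ht : 0 < t)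
    (hts : t ≤ s) : Smooth t n F := by
  obtain ⟨C, hC, hF⟩ := h
  refine ⟨C * 2 ^ (s - t), by positivity, fun Θ => (hF Θ).trans ?_⟩
  rw [mul_assoc]
  gcongr
  exact rpow_O3dist_le Θ ht hts

lemma Smooth.raise_order {s : ℝ} {n m : ℕ} {F : HH} (h : Smooth s n F) (hnm : n ≤ m) :
    Smooth s m F := by
  obtain ⟨C, hC, hF⟩ := h
  refine ⟨2 ^ (m - n) * C, by positivity, fun Θ => ?_⟩
  rw [← Nat.sub_add_cancel hnm, pow_add, mul_apply_eq_comp]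
  refine (norm_pow_dif_apply_le Θ _ _).trans ?_
  rw [mul_assoc, Nat.add_sub_cancel]
  gcongr
  exact hF Θ

lemma Smooth.lower_order {s : ℝ} {n m : ℕ} {F : HH} (h : Smooth s m F) (hs : 0 < s) (hsn : s < n) :
    Smooth s n F := by
  rcases le_total m n with hmn | hmn
  · exact h.raise_order hmn
  · obtain ⟨C, hC, hF⟩ := h
    obtain ⟨k, rfl⟩ := Nat.exists_eq_add_of_le hmn
    exact marchaud_iterate hs hsn hC hF

lemma Smooth.reg {s ε : ℝ} {n : ℕ} {F : HH} (h : Smooth s n F) (hε : 0 < ε) (hε1 : ε < 1)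
    (hεs : ε ≤ s) : ∃ M, Reg ε M F := by
  obtain ⟨C, hC, hF⟩ := (h.lower_exponent hε hεs).lower_order (n := 1) hε (by simpa using hε1)
  refine ⟨‖F‖ + C, le_add_of_nonneg_right hC, fun Ψ => ?_⟩
  have := hF Ψ
  rw [pow_one, dif_apply] at this
  refine this.trans ?_
  gcongr
  · exact Real.rpow_nonneg (O3dist_nonneg _) _
  · exact le_add_of_nonneg_left (norm_nonneg _)

lemma dif_triLp {κ : ℝ} (hκ : 0 < κ) (Θ : E3 ≃ₗᵢ[ℝ] E3) (f g h : HH) :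
    dif Θ (triLp hκ f g h) = triLp hκ (dif Θ f) (rot Θ g) (rot Θ h) +
      triLp hκ f (dif Θ g) (rot Θ h) + triLp hκ f g (dif Θ h) := by
  simp only [dif_apply, rot_triLp, triLp_sub_left, triLp_sub_mid, triLp_sub_right]
  abel

lemma norm_pow_rot (Θ : E3 ≃ₗᵢ[ℝ] E3) (a : ℕ) (f : HH) : ‖(rot Θ ^ a) f‖ = ‖f‖ := by
  induction a with
  | zero => simp
  | succ a ih => rw [pow_succ', mul_apply_eq_comp, norm_rot, ih]

lemma O3dist_conj (Θ Ψ : E3 ≃ₗᵢ[ℝ] E3) :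
    O3dist (Θ.symm.trans (Ψ.trans Θ)) ≤ O3dist Ψ := by
  refine ContinuousLinearMap.opNorm_le_bound _ (O3dist_nonneg Ψ) fun x => ?_
  have h := norm_apply_sub_le Ψ (Θ.symm x)
  rw [LinearIsometryEquiv.norm_map] at h
  refine le_trans (le_of_eq ?_) h
  rw [← Θ.norm_map (Ψ (Θ.symm x) - Θ.symm x), map_sub, LinearIsometryEquiv.apply_symm_apply]
  rfl

lemma Reg.rot {ε M : ℝ} (hε : 0 ≤ ε) {f : HH} (hf : Reg ε M f) (Θ : E3 ≃ₗᵢ[ℝ] E3) :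
    Reg ε M (rot Θ f) := by
  have hM : 0 ≤ M := (norm_nonneg f).trans hf.norm_le
  refine ⟨by rw [norm_rot]; exact hf.norm_le, fun Ψ => ?_⟩
  have e : _root_.rot Ψ (_root_.rot Θ f) =
      _root_.rot Θ (_root_.rot (Θ.symm.trans (Ψ.trans Θ)) f) := by
    rw [← rot_trans, ← rot_trans]
    congr 2
    ext1 x
    simp
  rw [e, ← map_sub, norm_rot]
  refine (hf.holder _).trans ?_
  gcongr
  · exact O3dist_nonneg _
  · exact O3dist_conj Θ Ψ

lemma Reg.sub {ε M M' : ℝ} {f g : HH} (hf : Reg ε M f) (hg : Reg ε M' g) :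
    Reg ε (M + M') (f - g) := by
  refine ⟨(norm_sub_le _ _).trans (add_le_add hf.norm_le hg.norm_le), fun Ψ => ?_⟩
  have e : _root_.rot Ψ (f - g) - (f - g) = (_root_.rot Ψ f - f) - (_root_.rot Ψ g - g) := by
    rw [map_sub]; abel
  rw [e, add_mul]
  exact (norm_sub_le _ _).trans (add_le_add (hf.holder Ψ) (hg.holder Ψ))

lemma Reg.mono {ε M M' : ℝ} {f : HH} (hf : Reg ε M f) (h : M ≤ M') : Reg ε M' f :=
  ⟨hf.norm_le.trans h, fun Ψ => (hf.holder Ψ).trans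
    (mul_le_mul_of_nonneg_right h (Real.rpow_nonneg (O3dist_nonneg _) _))⟩

lemma Reg.pow_dif {ε M : ℝ} (hε : 0 ≤ ε) {f : HH} (hf : Reg ε M f) (Θ : E3 ≃ₗᵢ[ℝ] E3) (j : ℕ) :
    Reg ε (2 ^ j * M) ((dif Θ ^ j) f) := by
  induction j with
  | zero => simpa using hf
  | succ j ih =>
    rw [pow_succ' (dif Θ), mul_apply_eq_comp, dif_apply, pow_succ']
    convert (ih.rot hε Θ).sub ih using 1
    ring

lemma Reg.pow_rot {ε M : ℝ} (hε : 0 ≤ ε) {f : HH} (hf : Reg ε M f) (Θ : E3 ≃ₗᵢ[ℝ] E3) (j : ℕ) :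
    Reg ε M ((_root_.rot Θ ^ j) f) := by
  induction j with
  | zero => simpa using hf
  | succ j ih =>
    rw [pow_succ', mul_apply_eq_comp]
    exact ih.rot hε Θ

/-- The mixed power `U^a D^i` applied to `f`. -/
def mix (Θ : E3 ≃ₗᵢ[ℝ] E3) (a i : ℕ) (f : HH) : HH := (rot Θ ^ a) ((dif Θ ^ i) f)

lemma rot_mix (Θ : E3 ≃ₗᵢ[ℝ] E3) (a i : ℕ) (f : HH) : rot Θ (mix Θ a i f) = mix Θ (a + 1) i f := by
  rw [mix, mix, pow_succ', mul_apply_eq_comp]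

lemma dif_mix (Θ : E3 ≃ₗᵢ[ℝ] E3) (a i : ℕ) (f : HH) : dif Θ (mix Θ a i f) = mix Θ a (i + 1) f := by
  rw [mix, mix, pow_succ', mul_apply_eq_comp, ← mul_apply_eq_comp,
    ((commute_dif_rot Θ).pow_right a).eq]
  rfl

lemma norm_mix (Θ : E3 ≃ₗᵢ[ℝ] E3) (a i : ℕ) (f : HH) : ‖mix Θ a i f‖ = ‖(dif Θ ^ i) f‖ :=
  norm_pow_rot Θ a _

lemma leibniz_bound {κ : ℝ} (hκ : 0 < κ) (Θ : E3 ≃ₗᵢ[ℝ] E3) (f : HH) {n : ℕ} {M : ℝ}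
    (hM : ∀ a b c i j k : ℕ, i + j + k = n →
      ‖triLp hκ (mix Θ a i f) (mix Θ b j f) (mix Θ c k f)‖ ≤ M) (N : ℕ) :
    ∀ a b c i j k : ℕ, i + j + k + N = n →
      ‖(dif Θ ^ N) (triLp hκ (mix Θ a i f) (mix Θ b j f) (mix Θ c k f))‖ ≤ 3 ^ N * M := by
  induction N with
  | zero => intro a b c i j k h; simpa using hM a b c i j k h
  | succ N ih =>
    intro a b c i j k h
    rw [pow_succ, mul_apply_eq_comp, dif_triLp, map_add, map_add]
    simp only [dif_mix, rot_mix]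
    have h1 := ih a (b + 1) (c + 1) (i + 1) j k (by omega)
    have h2 := ih a b (c + 1) i (j + 1) k (by omega)
    have h3 := ih a b c i j (k + 1) (by omega)
    refine (norm_add₃_le).trans ?_
    rw [pow_succ]
    linarith

lemma triLp_diff_bound {ε s : ℝ} (hε : 0 < ε) (hε1 : ε < 1) (hεs : ε ≤ s) {n : ℕ} {f : HH}
    {C δ : ℝ} (hC : 0 ≤ C)
    (hS : ∀ (κ : ℝ) (hκ : 0 < κ), κ ≤ 1 / 10 → ∀ Θ : E3 ≃ₗᵢ[ℝ] E3, κ ≤ O3dist Θ →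
      ∀ (M : ℝ) (f₂ f₃ : HH), Reg ε M f₂ → Reg ε M f₃ → ∀ g : HH,
      ‖triLp hκ (rot Θ g - g) f₂ f₃‖ ≤ C * M ^ 2 * O3dist Θ ^ δ * ‖g‖)
    (hf : Smooth s n f) : ∃ (A : ℝ), 0 ≤ A ∧
    ∀ (κ : ℝ) (hκ : 0 < κ), κ ≤ 1 / 10 → ∀ Θ : E3 ≃ₗᵢ[ℝ] E3, κ ≤ O3dist Θ →
      ‖(dif Θ ^ (3 * n + 1)) (triLp hκ f f f)‖ ≤ A * O3dist Θ ^ (s + δ) := by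
  obtain ⟨M, hM⟩ := hf.reg hε hε1 hεs
  have hM0 : 0 ≤ M := (norm_nonneg f).trans hM.norm_le
  obtain ⟨B, hB, hfB⟩ := hf
  set N := 3 * n + 1 with hN
  set A := C * (2 ^ N * M) ^ 2 * (2 ^ N * B) with hA
  have hA0 : 0 ≤ A := by positivity
  refine ⟨3 ^ N * A, by positivity, fun κ hκ hκ1 Θ hκΘ => ?_⟩
  have hθ : 0 < O3dist Θ := hκ.trans_le hκΘ
  have hreg : ∀ b j : ℕ, j ≤ N → Reg ε (2 ^ N * M) (mix Θ b j f) := fun b j hj => by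
    refine ((hM.pow_dif hε.le Θ j).pow_rot hε.le Θ b).mono ?_
    gcongr
    norm_num
  have key : ∀ a i : ℕ, n + 1 ≤ i → i ≤ N → ∀ G H : HH, Reg ε (2 ^ N * M) G →
      Reg ε (2 ^ N * M) H → ‖triLp hκ (mix Θ a i f) G H‖ ≤ A * O3dist Θ ^ (s + δ) := by
    intro a i hi hiN G H hG hH
    obtain ⟨m, rfl⟩ : ∃ m, i = m + 1 := ⟨i - 1, by omega⟩
    rw [← dif_mix, dif_apply]
    refine (hS κ hκ hκ1 Θ hκΘ _ G H hG hH _).trans ?_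
    have hg : ‖mix Θ a m f‖ ≤ 2 ^ N * (B * O3dist Θ ^ s) := by
      rw [norm_mix, ← Nat.sub_add_cancel (show n ≤ m by omega), pow_add, mul_apply_eq_comp]
      refine (norm_pow_dif_apply_le Θ _ _).trans ?_
      gcongr
      · norm_num
      · omega
      · exact hfB Θ
    rw [hA, Real.rpow_add hθ]
    calc _ ≤ C * (2 ^ N * M) ^ 2 * O3dist Θ ^ δ * (2 ^ N * (B * O3dist Θ ^ s)) := by gcongr
      _ = _ := by ring
  have h0 : f = mix Θ 0 0 f := by simp [mix]
  have h := leibniz_bound hκ Θ f (n := N) (M := A * O3dist Θ ^ (s + δ)) (fun a b c i j k hijk => ?_)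
    N 0 0 0 0 0 0 (by omega)
  · rw [← h0] at h
    rw [mul_assoc]
    exact h
  · by_cases h1 : n + 1 ≤ i
    · exact key a i h1 (by omega) _ _ (hreg b j (by omega)) (hreg c k (by omega))
    by_cases h2 : n + 1 ≤ j
    · rw [triLp_rotate]
      exact key b j h2 (by omega) _ _ (hreg c k (by omega)) (hreg a i (by omega))
    · rw [triLp_rotate, triLp_rotate]
      exact key c k (by omega) (by omega) _ _ (hreg a i (by omega)) (hreg b j (by omega))

/-- Almost everywhere limits inherit norm bounds in `L²(σ)`. -/
lemma norm_le_of_ae_tendsto {F : ℕ → HH} {G : HH} {A : ℝ} (hA : 0 ≤ A)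
    (hF : ∀ᶠ j in atTop, ‖F j‖ ≤ A)
    (h : ∀ᵐ x ∂sphMeasure, Tendsto (fun j => F j x) atTop (nhds (G x))) : ‖G‖ ≤ A := by
  rw [← ENNReal.ofReal_le_ofReal_iff hA, ofReal_norm, Lp.enorm_def]
  refine (Lp.eLpNorm_lim_le_liminf_eLpNorm (fun j => (Lp.aestronglyMeasurable (F j))) _ h).trans ?_
  refine liminf_le_of_frequently_le' (Eventually.frequently (hF.mono fun j hj => ?_))
  rw [← Lp.enorm_def, ← ofReal_norm]
  exact ENNReal.ofReal_le_ofReal hj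

lemma ae_tendsto_rot (Θ : E3 ≃ₗᵢ[ℝ] E3) {F : ℕ → HH} {G : HH}
    (h : ∀ᵐ x ∂sphMeasure, Tendsto (fun j => F j x) atTop (nhds (G x))) :
    ∀ᵐ x ∂sphMeasure, Tendsto (fun j => rot Θ (F j) x) atTop (nhds (rot Θ G x)) := by
  filter_upwards [(measurePreserving_sph Θ).quasiMeasurePreserving.ae h, rot_coe Θ G,
    ae_all_iff.2 fun j => rot_coe Θ (F j)] with x h1 h2 h3
  simpa only [h2, h3, Function.comp_apply] using h1

lemma ae_tendsto_pow_dif (Θ : E3 ≃ₗᵢ[ℝ] E3) (n : ℕ) {F : ℕ → HH} {G : HH}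
    (h : ∀ᵐ x ∂sphMeasure, Tendsto (fun j => F j x) atTop (nhds (G x))) :
    ∀ᵐ x ∂sphMeasure, Tendsto (fun j => (dif Θ ^ n) (F j) x) atTop (nhds ((dif Θ ^ n) G x)) := by
  induction n with
  | zero => simpa using h
  | succ n ih =>
    simp only [pow_succ', mul_apply_eq_comp, dif_apply]
    filter_upwards [ae_tendsto_rot Θ ih, ih,
      Lp.coeFn_sub (rot Θ ((dif Θ ^ n) G)) ((dif Θ ^ n) G),
      ae_all_iff.2 fun j => Lp.coeFn_sub (rot Θ ((dif Θ ^ n) (F j))) ((dif Θ ^ n) (F j))]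
      with x h1 h2 h3 h4
    simp only [h3, h4, Pi.sub_apply]
    exact h1.sub h2

/-- Gain of regularity for limits of the mollified threefold convolutions. -/
theorem smooth_limit {ε : ℝ} (hε : 0 < ε) (hε1 : ε < 1) : ∃ δ : ℝ, 0 < δ ∧
    ∀ (s : ℝ) (n : ℕ) (f G : HH) (κ : ℕ → ℝ) (hκ : ∀ j, 0 < κ j), ε ≤ s → Smooth s n f →
      Tendsto κ atTop (nhds 0) →
      (∀ᵐ x ∂sphMeasure, Tendsto (fun j => triLp (hκ j) f f f x) atTop (nhds (G x))) →
      Smooth (s + δ) (3 * n + 1) G := by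
  obtain ⟨C, δ, hC, hδ, hS⟩ := smoothing hε hε1.le
  refine ⟨δ, hδ, fun s n f G κ hκ hεs hf hκ0 hlim => ?_⟩
  obtain ⟨A, hA, H⟩ := triLp_diff_bound hε hε1 hεs hC hS hf
  refine ⟨A, hA, fun Θ => ?_⟩
  have hr := Real.rpow_nonneg (O3dist_nonneg Θ) (s + δ)
  rcases (O3dist_nonneg Θ).eq_or_lt with h0 | h0
  · have : dif Θ = 0 := by
      have hΘ : Θ = LinearIsometryEquiv.refl ℝ E3 := by
        ext1 x
        have := norm_apply_sub_le Θ x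
        rw [← h0, zero_mul] at this
        exact sub_eq_zero.1 (norm_le_zero_iff.1 this)
      ext1 g
      rw [dif_apply, hΘ]
      simp only [zero_apply, sub_eq_zero]
      apply Lp.ext
      exact rot_coe _ g
    rw [this, zero_pow (by omega)]
    simpa using by positivity
  · refine norm_le_of_ae_tendsto (by positivity) ?_ (ae_tendsto_pow_dif Θ (3 * n + 1) hlim)
    filter_upwards [hκ0.eventually_le_const h0,
      hκ0.eventually_le_const (show (0:ℝ) < 1 / 10 by norm_num)]
      with j h1 h2
    exact H (κ j) (hκ j) h2 Θ h1

lemma hasDerivAt_iterate_rotDiff (Θ : E3 ≃ₗᵢ[ℝ] E3) (k : ℕ) {h : ℝ → E3 → ℂ} {h' : E3 → ℂ} {τ : ℝ}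
    (hd : ∀ x, HasDerivAt (fun τ => h τ x) (h' x) τ) (x : E3) :
    HasDerivAt (fun τ => (rotDiff Θ)^[k] (h τ) x) ((rotDiff Θ)^[k] h' x) τ := by
  induction k generalizing x with
  | zero => exact hd x
  | succ k ih =>
    simp only [Function.iterate_succ_apply', rotDiff]
    exact (ih _).sub (ih _)

lemma iterate_rotDiff_const_mul (Θ : E3 ≃ₗᵢ[ℝ] E3) (k : ℕ) (c : ℂ) (h : E3 → ℂ) (x : E3) :
    (rotDiff Θ)^[k] (fun x => c * h x) x = c * (rotDiff Θ)^[k] h x := by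
  induction k generalizing x with
  | zero => rfl
  | succ k ih =>
    simp only [Function.iterate_succ_apply', rotDiff, ih]
    ring

lemma iterate_rotDiff_sub (Θ : E3 ≃ₗᵢ[ℝ] E3) (k : ℕ) (h g : E3 → ℂ) (x : E3) :
    (rotDiff Θ)^[k] (fun x => h x - g x) x = (rotDiff Θ)^[k] h x - (rotDiff Θ)^[k] g x := by
  induction k generalizing x with
  | zero => rfl
  | succ k ih =>
    simp only [Function.iterate_succ_apply', rotDiff, ih]
    ring

/-- The iterated rotation differences of a smooth family are of the expected order. -/
lemma iterate_rotDiff_smooth_le (j : ℕ) : ∀ (P : Type) [NormedAddCommGroup P] [NormedSpace ℝ P]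
    [FiniteDimensional ℝ P] (a : P × E3 → ℂ), ContDiff ℝ (⊤ : ℕ∞) a → ∀ R : ℝ,
    ∃ C : ℝ, 0 ≤ C ∧ ∀ p : P, ‖p‖ ≤ R → ∀ x ∈ sph, ∀ Θ : E3 ≃ₗᵢ[ℝ] E3,
      ‖(rotDiff Θ)^[j] (fun x => a (p, x)) x‖ ≤ C * O3dist Θ ^ j := by
  induction j with
  | zero =>
    intro P _ _ _ a ha R
    have : ProperSpace P := FiniteDimensional.proper ℝ P
    have hK : IsCompact (closedBall (0 : P) R ×ˢ sph) :=
      (isCompact_closedBall _ _).prod (isCompact_sphere _ _)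
    obtain ⟨C, hC⟩ := hK.exists_bound_of_continuousOn ha.continuous.continuousOn
    refine ⟨max C 0, le_max_right _ _, fun p hp x hx Θ => ?_⟩
    simp only [Function.iterate_zero, id, pow_zero, mul_one]
    exact (hC (p, x) ⟨by simpa using hp, hx⟩).trans (le_max_left _ _)
  | succ j ih =>
    intro P _ _ _ a ha R
    let L := E3 →L[ℝ] E3
    let a' : (P × L × L × ℝ) × E3 → ℂ := fun q =>
      fderiv ℝ a (q.1.1, q.2 + q.1.2.2.2 • q.1.2.1 q.2) (0, q.1.2.2.1 q.2)
    have ha' : ContDiff ℝ (⊤ : ℕ∞) a' := by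
      have h1 : ContDiff ℝ (⊤ : ℕ∞) (fderiv ℝ a) := ha.fderiv_right (by simp)
      refine (h1.comp ?_).clm_apply ?_
      · fun_prop
      · fun_prop
    obtain ⟨C, hC, H⟩ := ih (P × L × L × ℝ) a' ha' (max R 2)
    refine ⟨C, hC, fun p hp x hx Θ => ?_⟩
    rcases (O3dist_nonneg Θ).eq_or_lt with h0 | h0
    · have hΘ : ∀ x, Θ x = x := fun x => by
        have := norm_apply_sub_le Θ x
        rw [← h0, zero_mul] at this
        exact sub_eq_zero.1 (norm_le_zero_iff.1 this)
      rw [Function.iterate_succ_apply', rotDiff, hΘ, sub_self, norm_zero]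
      exact mul_nonneg hC (pow_nonneg (O3dist_nonneg _) _)
    · set θ := O3dist Θ with hθ
      set B : L := Θ.toLinearIsometry.toContinuousLinearMap - ContinuousLinearMap.id ℝ E3 with hB
      have hBn : ‖B‖ = θ := rfl
      have hBx : ∀ x, B x = Θ x - x := fun x => rfl
      have hder : ∀ τ ∈ Set.Icc (0 : ℝ) 1, HasDerivWithinAt
          (fun τ => (rotDiff Θ)^[j] (fun x => a (p, x + τ • B x)) x)
          ((rotDiff Θ)^[j] (fun x => θ * a' ((p, B, θ⁻¹ • B, τ), x)) x) (Set.Icc 0 1) τ := by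
        intro τ _
        refine (hasDerivAt_iterate_rotDiff Θ j (fun x => ?_) x).hasDerivWithinAt
        have hcurve : HasDerivAt (fun τ : ℝ => (p, x + τ • B x)) (0, B x) τ := by
          have h2 : HasDerivAt (fun τ : ℝ => x + τ • B x) (B x) τ := by
            simpa using ((hasDerivAt_id τ).smul_const (B x)).const_add x
          exact (hasDerivAt_const τ p).prodMk h2
        have :=
          ((ha.differentiable (by simp)) (p, x + τ • B x)).hasFDerivAt.comp_hasDerivAt τ hcurve
        have e : ((0 : P), B x) = θ • ((0 : P), (θ⁻¹ • B) x) := by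
          simp [smul_smul, mul_inv_cancel₀ h0.ne']
        rw [e, map_smul, Complex.real_smul] at this
        exact this
      have hbound : ∀ τ ∈ Set.Ico (0 : ℝ) 1,
          ‖(rotDiff Θ)^[j] (fun x => θ * a' ((p, B, θ⁻¹ • B, τ), x)) x‖ ≤ C * θ ^ (j + 1) := by
        intro τ hτ
        rw [iterate_rotDiff_const_mul, norm_mul, Complex.norm_real, Real.norm_of_nonneg h0.le]
        have hn : ‖((p, B, θ⁻¹ • B, τ) : P × L × L × ℝ)‖ ≤ max R 2 := by
          refine norm_prod_le_iff.2 ⟨hp.trans (le_max_left _ _), norm_prod_le_iff.2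
            ⟨le_trans (O3dist_le_two Θ) (le_max_right _ _), norm_prod_le_iff.2 ⟨?_, ?_⟩⟩⟩
          · refine le_trans ?_ (le_max_right _ _)
            simp only
            rw [norm_smul, norm_inv, Real.norm_of_nonneg h0.le, hBn, inv_mul_cancel₀ h0.ne']
            norm_num
          · refine le_trans ?_ (le_max_right _ _)
            simp only
            rw [Real.norm_of_nonneg hτ.1]; linarith [hτ.2]
        have := H _ hn x hx Θ
        calc _ ≤ θ * (C * θ ^ j) := by gcongr
          _ = _ := by ring
      have := norm_image_sub_le_of_norm_deriv_le_segment_01' hder hbound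
      simp only [one_smul, zero_smul, add_zero, hBx, add_sub_cancel] at this
      rw [Function.iterate_succ_apply]
      refine le_trans (le_of_eq ?_) this
      rw [← iterate_rotDiff_sub]
      rfl

lemma exists_rotDiff_bound {a : E3 → ℂ} (ha : ContDiff ℝ (⊤ : ℕ∞) a) (j : ℕ) :
    ∃ C : ℝ, 0 ≤ C ∧ ∀ x ∈ sph, ∀ Θ : E3 ≃ₗᵢ[ℝ] E3,
      ‖(rotDiff Θ)^[j] a x‖ ≤ C * O3dist Θ ^ j := by
  obtain ⟨C, hC, H⟩ := iterate_rotDiff_smooth_le j ℝ (fun q => a q.2) (ha.comp contDiff_snd) 0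
  exact ⟨C, hC, fun x hx Θ => H 0 (by simp) x hx Θ⟩

lemma memLp_mul {b : E3 → ℂ} (hb : Continuous b) (F : HH) :
    MemLp (fun x => b x * F x) 2 sphMeasure := by
  obtain ⟨K, hK⟩ := (isCompact_sphere (0 : E3) 1).exists_bound_of_continuousOn hb.continuousOn
  refine (Lp.memLp F).of_le_mul (c := K)
    (hb.aestronglyMeasurable.mul (Lp.aestronglyMeasurable F)) ?_
  filter_upwards [ae_mem_sph] with x hx
  rw [norm_mul]
  exact mul_le_mul_of_nonneg_right (hK x hx) (norm_nonneg _)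

/-- Multiplication of an `L²(σ)` function by a continuous function. -/
def mulLp {b : E3 → ℂ} (hb : Continuous b) (F : HH) : HH := (memLp_mul hb F).toLp

lemma mulLp_coe {b : E3 → ℂ} (hb : Continuous b) (F : HH) :
    mulLp hb F =ᵐ[sphMeasure] fun x => b x * F x := MemLp.coeFn_toLp _

lemma norm_mulLp_le {b : E3 → ℂ} (hb : Continuous b) (F : HH) {K : ℝ}
    (h : ∀ x ∈ sph, ‖b x‖ ≤ K) : ‖mulLp hb F‖ ≤ K * ‖F‖ := by
  refine Lp.norm_le_mul_norm_of_ae_le_mul ?_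
  filter_upwards [ae_mem_sph, mulLp_coe hb F] with x hx h1
  rw [h1, norm_mul]
  exact mul_le_mul_of_nonneg_right (h x hx) (norm_nonneg _)

lemma continuous_rotDiff {b : E3 → ℂ} (hb : Continuous b) (Θ : E3 ≃ₗᵢ[ℝ] E3) :
    Continuous (rotDiff Θ b) := (hb.comp Θ.continuous).sub hb

lemma dif_mulLp {b : E3 → ℂ} (hb : Continuous b) (Θ : E3 ≃ₗᵢ[ℝ] E3) (F : HH) :
    dif Θ (mulLp hb F) =
      mulLp (continuous_rotDiff hb Θ) (rot Θ F) + mulLp hb (dif Θ F) := by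
  rw [dif_apply, dif_apply]
  apply Lp.ext
  filter_upwards [Lp.coeFn_sub (rot Θ (mulLp hb F)) (mulLp hb F), rot_coe Θ (mulLp hb F),
    comp_ae_eq Θ (mulLp_coe hb F), mulLp_coe hb F, rot_coe Θ F, Lp.coeFn_sub (rot Θ F) F,
    mulLp_coe (continuous_rotDiff hb Θ) (rot Θ F), mulLp_coe hb (rot Θ F - F),
    Lp.coeFn_add (mulLp (continuous_rotDiff hb Θ) (rot Θ F)) (mulLp hb (rot Θ F - F))]
    with x h1 h2 h3 h4 h5 h6 h7 h8 h9
  rw [h1, h9, Pi.sub_apply, Pi.add_apply, h2, h3, h4, h7, h8, h6, Pi.sub_apply, h5]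
  simp only [Function.comp_apply, rotDiff]
  ring

lemma continuous_iterate_rotDiff {b : E3 → ℂ} (hb : Continuous b) (Θ : E3 ≃ₗᵢ[ℝ] E3) (i : ℕ) :
    Continuous ((rotDiff Θ)^[i] b) := by
  induction i with
  | zero => exact hb
  | succ i ih => rw [Function.iterate_succ_apply']; exact continuous_rotDiff ih Θ

lemma mulLp_congr {b b' : E3 → ℂ} (hb : Continuous b) (hb' : Continuous b') (h : b = b') (F : HH) :
    mulLp hb F = mulLp hb' F := by
  subst h; rfl

lemma leibniz_mul_bound {b : E3 → ℂ} (hb : Continuous b) (Θ : E3 ≃ₗᵢ[ℝ] E3) (F : HH) {n : ℕ}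
    {M : ℝ} (hM : ∀ d i k : ℕ, i + k = n →
      ‖mulLp (continuous_iterate_rotDiff hb Θ i) (mix Θ d k F)‖ ≤ M) (N : ℕ) :
    ∀ d i k : ℕ, i + k + N = n →
      ‖(dif Θ ^ N) (mulLp (continuous_iterate_rotDiff hb Θ i) (mix Θ d k F))‖ ≤ 2 ^ N * M := by
  induction N with
  | zero => intro d i k h; simpa using hM d i k h
  | succ N ih =>
    intro d i k h
    rw [pow_succ, mul_apply_eq_comp, dif_mulLp, map_add, dif_mix, rot_mix,
      mulLp_congr _ (continuous_iterate_rotDiff hb Θ (i + 1))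
        (Function.iterate_succ_apply' (rotDiff Θ) i b).symm]
    have h1 := ih (d + 1) (i + 1) k (by omega)
    have h2 := ih d i (k + 1) (by omega)
    refine (norm_add_le _ _).trans ?_
    rw [pow_succ]
    linarith

lemma Smooth.exists_mul_le {t : ℝ} {m : ℕ} {F : HH} (h : Smooth t m F) (ht : 0 < t) {i k : ℕ}
    (hik : t + 1 ≤ (i + k : ℕ)) : ∃ C : ℝ, 0 ≤ C ∧ ∀ Θ : E3 ≃ₗᵢ[ℝ] E3,
      O3dist Θ ^ i * ‖(dif Θ ^ k) F‖ ≤ C * O3dist Θ ^ t := by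
  rcases lt_or_ge t k with hk | hk
  · obtain ⟨C, hC, H⟩ := h.lower_order ht hk
    refine ⟨2 ^ i * C, by positivity, fun Θ => ?_⟩
    have := O3dist_nonneg Θ
    rw [mul_assoc]
    gcongr
    exacts [O3dist_le_two Θ, H Θ]
  · rcases Nat.eq_zero_or_pos k with rfl | hk0
    · refine ⟨2 ^ ((i : ℝ) - t) * ‖F‖, by positivity, fun Θ => ?_⟩
      have := rpow_O3dist_le Θ ht (show t ≤ (i : ℝ) by push_cast at hik; linarith)
      rw [Real.rpow_natCast] at this
      rw [pow_zero, one_apply_eq_self, mul_right_comm]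
      gcongr
    · have hk1 : (1 : ℝ) ≤ k := by exact_mod_cast hk0
      obtain ⟨C, hC, H⟩ := (h.lower_exponent (t := (k : ℝ) - 1 / 2) (by linarith)
        (by linarith)).lower_order (n := k) (by linarith) (by linarith)
      refine ⟨C * 2 ^ ((i : ℝ) + (k - 1 / 2) - t), by positivity, fun Θ => ?_⟩
      have h0 := O3dist_nonneg Θ
      have hik' : t ≤ (i : ℝ) + (k - 1 / 2) := by push_cast at hik; linarith
      have := rpow_O3dist_le Θ ht hik'
      rw [Real.rpow_add_of_nonneg h0 (Nat.cast_nonneg i) (by linarith), Real.rpow_natCast] at this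
      calc _ ≤ O3dist Θ ^ i * (C * O3dist Θ ^ ((k : ℝ) - 1 / 2)) := by gcongr; exact H Θ
        _ = C * (O3dist Θ ^ i * O3dist Θ ^ ((k : ℝ) - 1 / 2)) := by ring
        _ ≤ _ := by rw [mul_assoc]; gcongr

lemma Smooth.mul {t : ℝ} {m : ℕ} {F : HH} (h : Smooth t m F) (ht : 0 < t) {a : E3 → ℂ}
    (ha : ContDiff ℝ (⊤ : ℕ∞) a) {n : ℕ} (hn : t < n) : Smooth t n (mulLp ha.continuous F) := by
  obtain ⟨N, hN⟩ := exists_nat_ge (t + 1)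
  suffices Smooth t N (mulLp ha.continuous F) from this.lower_order ht hn
  choose A hA0 hA using exists_rotDiff_bound ha
  have hex : ∀ k : ℕ, ∃ C : ℝ, 0 ≤ C ∧ (k ≤ N → ∀ Θ : E3 ≃ₗᵢ[ℝ] E3,
      O3dist Θ ^ (N - k) * ‖(dif Θ ^ k) F‖ ≤ C * O3dist Θ ^ t) := fun k => by
    by_cases hk : k ≤ N
    · obtain ⟨C, hC, H⟩ := h.exists_mul_le ht (i := N - k) (k := k)
        (by rw [Nat.sub_add_cancel hk]; exact hN)
      exact ⟨C, hC, fun _ => H⟩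
    · exact ⟨0, le_rfl, fun h => absurd h hk⟩
  choose C hC0 hC using hex
  set M := ∑ k ∈ Finset.range (N + 1), A (N - k) * C k with hM
  have hM0 : 0 ≤ M := Finset.sum_nonneg fun k _ => mul_nonneg (hA0 _) (hC0 _)
  refine ⟨2 ^ N * M, by positivity, fun Θ => ?_⟩
  have hθ := O3dist_nonneg Θ
  have hr := Real.rpow_nonneg hθ t
  have key := leibniz_mul_bound ha.continuous Θ F (n := N) (M := M * O3dist Θ ^ t)
    (fun d i k hik => ?_) N 0 0 0 (by omega)
  · rw [mul_assoc]
    simpa [mix] using key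
  · have hkN : k ≤ N := by omega
    obtain rfl : i = N - k := by omega
    refine (norm_mulLp_le _ _
      fun x hx => hA (N - k) x hx Θ).trans ?_
    rw [norm_mix, mul_assoc]
    calc _ ≤ A (N - k) * (C k * O3dist Θ ^ t) :=
        mul_le_mul_of_nonneg_left (hC k hkN Θ) (hA0 _)
      _ = A (N - k) * C k * O3dist Θ ^ t := by ring
      _ ≤ _ := by
        gcongr
        exact Finset.single_le_sum (f := fun k => A (N - k) * C k)
          (fun k _ => mul_nonneg (hA0 _) (hC0 _)) (Finset.mem_range.2 (by omega))

/-! ### Comparison with the norm of `ℋ^s` -/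

lemma coe_pow_dif (Θ : E3 ≃ₗᵢ[ℝ] E3) (n : ℕ) {f : E3 → ℂ} {F : HH} (h : F =ᵐ[sphMeasure] f) :
    (dif Θ ^ n) F =ᵐ[sphMeasure] (rotDiff Θ)^[n] f := by
  induction n with
  | zero => simpa using h
  | succ n ih =>
    rw [pow_succ', mul_apply_eq_comp, dif_apply, Function.iterate_succ_apply']
    filter_upwards [Lp.coeFn_sub (rot Θ ((dif Θ ^ n) F)) ((dif Θ ^ n) F),
      rot_coe Θ ((dif Θ ^ n) F), comp_ae_eq Θ ih, ih] with x h1 h2 h3 h4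
    rw [h1, Pi.sub_apply, h2, h3, h4]
    rfl

lemma eLpNorm_iterate_rotDiff (Θ : E3 ≃ₗᵢ[ℝ] E3) (n : ℕ) {f : E3 → ℂ} {F : HH}
    (h : F =ᵐ[sphMeasure] f) :
    eLpNorm ((rotDiff Θ)^[n] f) 2 sphMeasure = ENNReal.ofReal ‖(dif Θ ^ n) F‖ := by
  rw [ofReal_norm, Lp.enorm_def]
  exact (eLpNorm_congr_ae (coe_pow_dif Θ n h)).symm

lemma O3dist_pos {Θ : E3 ≃ₗᵢ[ℝ] E3} (h : Θ ≠ LinearIsometryEquiv.refl ℝ E3) : 0 < O3dist Θ := by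
  refine (O3dist_nonneg Θ).lt_of_ne fun h0 => h ?_
  ext1 x
  have := norm_apply_sub_le Θ x
  rw [← h0, zero_mul] at this
  exact sub_eq_zero.1 (norm_le_zero_iff.1 this)

lemma dif_refl : dif (LinearIsometryEquiv.refl ℝ E3) = 0 := by
  ext1 g
  rw [dif_apply, zero_apply, sub_eq_zero]
  exact Lp.ext (rot_coe _ g)

lemma smooth_of_scriptHNorm {s : ℝ} {f : E3 → ℂ} {F : HH} (h : F =ᵐ[sphMeasure] f)
    (hf : scriptHNorm s f < ⊤) : Smooth s (Nat.floor s + 1) F := by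
  set S := scriptHNorm s f with hS
  refine ⟨S.toReal, ENNReal.toReal_nonneg, fun Θ => ?_⟩
  have hr := Real.rpow_nonneg (O3dist_nonneg Θ) s
  by_cases hΘ : Θ = LinearIsometryEquiv.refl ℝ E3
  · rw [hΘ, dif_refl, zero_pow (by omega), ← hΘ]
    simpa using mul_nonneg ENNReal.toReal_nonneg hr
  · have h0 := O3dist_pos hΘ
    have h1 : ENNReal.ofReal (O3dist Θ ^ (-s)) *
        eLpNorm ((rotDiff Θ)^[Nat.floor s + 1] f) 2 sphMeasure ≤ S :=
      (le_iSup₂ (f := fun (Θ : E3 ≃ₗᵢ[ℝ] E3) (_ : Θ ≠ LinearIsometryEquiv.refl ℝ E3) =>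
        ENNReal.ofReal (O3dist Θ ^ (-s)) *
        eLpNorm ((rotDiff Θ)^[Nat.floor s + 1] f) 2 sphMeasure) Θ hΘ).trans le_add_self
    rw [eLpNorm_iterate_rotDiff Θ _ h, ← ENNReal.ofReal_mul (by positivity)] at h1
    have h2 := (ENNReal.ofReal_le_iff_le_toReal hf.ne).1 h1
    rw [Real.rpow_neg h0.le, inv_mul_le_iff₀ (by positivity)] at h2
    linarith

lemma Smooth.scriptHNorm_lt_top {s : ℝ} {f : E3 → ℂ} {F : HH} (h : F =ᵐ[sphMeasure] f)
    (hF : Smooth s (Nat.floor s + 1) F) : scriptHNorm s f < ⊤ := by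
  obtain ⟨C, hC, H⟩ := hF
  refine ENNReal.add_lt_top.2 ⟨?_, ?_⟩
  · rw [← eLpNorm_congr_ae h]; exact Lp.eLpNorm_lt_top F
  · refine lt_of_le_of_lt (iSup₂_le fun Θ hΘ => ?_) (ENNReal.ofReal_lt_top (r := C))
    have h0 := O3dist_pos hΘ
    rw [eLpNorm_iterate_rotDiff Θ _ h, ← ENNReal.ofReal_mul (by positivity)]
    refine ENNReal.ofReal_le_ofReal ?_
    rw [Real.rpow_neg h0.le, inv_mul_le_iff₀ (by positivity)]
    linarith [H Θ]

/-! ### Removal of the regularization -/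

lemma lintegral_bump {κ : ℝ} (hκ : 0 < κ) (w : E3) :
    ∫⁻ z, ENNReal.ofReal (bump κ (w - z)) = 1 := by
  rw [lintegral_sub_left_eq_self (fun z => ENNReal.ofReal (bump κ z)),
    ← ofReal_integral_eq_lintegral_ofReal
      ((continuous_bump κ).integrable_of_hasCompactSupport (hasCompactSupport_bump hκ))
      (Eventually.of_forall fun z => bump_nonneg hκ.le z), integral_bump hκ, ENNReal.ofReal_one]

lemma setLIntegral_bump_of_closedBall_subset {κ : ℝ} (hκ : 0 < κ) {w : E3} {V : Set E3}
    (hV : MeasurableSet V) (h : closedBall w κ ⊆ V) :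
    ∫⁻ z in V, ENNReal.ofReal (bump κ (w - z)) = 1 := by
  rw [← lintegral_bump hκ w, ← lintegral_indicator hV]
  refine lintegral_congr fun z => ?_
  by_cases hz : z ∈ V
  · rw [Set.indicator_of_mem hz]
  · rw [Set.indicator_of_notMem hz, bump_eq_zero hκ, ENNReal.ofReal_zero]
    by_contra hlt
    refine hz (h ?_)
    rw [mem_closedBall_iff_norm']
    exact (not_le.1 hlt).le

lemma lintegral_setLIntegral_bump_le {κ η : ℝ} (hκ : 0 < κ) (hκ1 : κ ≤ 1) (hη : 0 < η) {V : Set E3}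
    (hVη : ∀ z ∈ V, η ≤ ‖z‖) :
    ∫⁻ p, (∫⁻ z in V, ENNReal.ofReal (bump κ (p.1 - p.2 - z))) ∂sph2 ≤
      ENNReal.ofReal (pairConst / η) * volume V := by
  have hb := measurable_bump κ
  rw [lintegral_lintegral_swap (by fun_prop), ← setLIntegral_const]
  refine setLIntegral_mono measurable_const fun z hz => ?_
  have m : Measurable fun p : E3 × E3 => ENNReal.ofReal (bump κ (p.1 - p.2 - z)) := by fun_prop
  have hz0 : z ≠ 0 := by
    rintro rfl
    have := hVη 0 hz
    rw [norm_zero] at this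
    linarith
  unfold sph2
  rw [lintegral_prod _ m.aemeasurable]
  refine (lintegral_bump_pair_sub_le hz0 hκ hκ1).trans (ENNReal.ofReal_le_ofReal ?_)
  have := pairConst_pos
  gcongr
  exact hVη z hz

lemma sph2_sub_preimage_le {η : ℝ} (hη : 0 < η) {V : Set E3} (hV : IsOpen V)
    (hVη : ∀ z ∈ V, η ≤ ‖z‖) :
    sph2 ((fun p => p.1 - p.2) ⁻¹' V) ≤ ENNReal.ofReal (pairConst / η) * volume V := by
  have hsub : Measurable fun p : E3 × E3 => p.1 - p.2 := by fun_prop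
  set κ : ℕ → ℝ := fun j => 1 / ((j : ℝ) + 1) with hκdef
  have hκ0 : ∀ j, 0 < κ j := fun j => Nat.one_div_pos_of_nat
  have hκ1 : ∀ j, κ j ≤ 1 := fun j => by
    rw [hκdef]
    exact (div_le_one (by positivity)).2 (by linarith [Nat.cast_nonneg (α := ℝ) j])
  have hκt : Tendsto κ atTop (nhds 0) := tendsto_one_div_add_atTop_nhds_zero_nat
  set I : ℕ → E3 × E3 → ℝ≥0∞ := fun j p =>
    ∫⁻ z in V, ENNReal.ofReal (bump (κ j) (p.1 - p.2 - z)) with hI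
  have hIm : ∀ j, Measurable (I j) := fun j => by
    have hb := measurable_bump (κ j)
    refine Measurable.lintegral_prod_right' (f := fun q : (E3 × E3) × E3 =>
      ENNReal.ofReal (bump (κ j) (q.1.1 - q.1.2 - q.2))) ?_
    fun_prop
  rw [← lintegral_indicator_one (hsub hV.measurableSet)]
  calc _ ≤ ∫⁻ p, liminf (fun j => I j p) atTop ∂sph2 := by
        refine lintegral_mono fun p => ?_
        by_cases hp : p.1 - p.2 ∈ V
        · rw [Set.indicator_of_mem (by exact hp), Pi.one_apply]
          refine le_liminf_of_le (by isBoundedDefault) ?_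
          obtain ⟨r, hr, hrV⟩ := Metric.isOpen_iff.1 hV _ hp
          filter_upwards [hκt.eventually_lt_const hr] with j hj
          exact (setLIntegral_bump_of_closedBall_subset (hκ0 j) hV.measurableSet
            ((closedBall_subset_ball hj).trans hrV)).ge
        · rw [Set.indicator_of_notMem (by exact hp)]
          exact zero_le
    _ ≤ liminf (fun j => ∫⁻ p, I j p ∂sph2) atTop := lintegral_liminf_le hIm
    _ ≤ liminf (fun _ : ℕ => ENNReal.ofReal (pairConst / η) * volume V) atTop :=
        liminf_le_liminf (Eventually.of_forall fun j =>
          lintegral_setLIntegral_bump_le (hκ0 j) (hκ1 j) hη hVη)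
    _ = _ := by simp

lemma sph2_sub_preimage_eq_zero {N : Set E3} (hN : volume N = 0) :
    sph2 ((fun p => p.1 - p.2) ⁻¹' N) = 0 := by
  have hfar : ∀ n : ℕ, sph2 ((fun p => p.1 - p.2) ⁻¹' (N ∩ {z | 1 / ((n : ℝ) + 1) < ‖z‖})) = 0 := by
    intro n
    have hη : (0 : ℝ) < 1 / ((n : ℝ) + 1) := Nat.one_div_pos_of_nat
    set η := 1 / ((n : ℝ) + 1)
    have hopen : IsOpen {z : E3 | η < ‖z‖} := isOpen_lt continuous_const continuous_norm
    refine le_antisymm (ENNReal.le_of_forall_pos_le_add fun r hr _ => ?_) zero_le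
    have hc : (0 : ℝ) < pairConst / η := div_pos pairConst_pos hη
    obtain ⟨V, hNV, hVo, hVr⟩ := Set.exists_isOpen_lt_of_lt N
      ((r : ℝ≥0∞) / ENNReal.ofReal (pairConst / η)) (by
        rw [hN]
        exact ENNReal.div_pos (by exact_mod_cast hr.ne') ENNReal.ofReal_ne_top)
    calc _ ≤ sph2 ((fun p => p.1 - p.2) ⁻¹' (V ∩ {z | η < ‖z‖})) :=
          measure_mono (Set.preimage_mono (Set.inter_subset_inter_left _ hNV))
      _ ≤ ENNReal.ofReal (pairConst / η) * volume (V ∩ {z | η < ‖z‖}) :=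
          sph2_sub_preimage_le hη (hVo.inter hopen) fun z hz => (le_of_lt hz.2)
      _ ≤ ENNReal.ofReal (pairConst / η) * (r / ENNReal.ofReal (pairConst / η)) := by
          gcongr
          exact (measure_mono Set.inter_subset_left).trans hVr.le
      _ ≤ 0 + r := by
          rw [zero_add]
          exact ENNReal.mul_div_le
  have hdiag : sph2 {p : E3 × E3 | p.1 = p.2} = 0 := by
    unfold sph2
    rw [Measure.prod_apply (measurableSet_eq_fun measurable_fst measurable_snd)]
    refine (lintegral_congr fun x => ?_).trans lintegral_zero
    have : Prod.mk x ⁻¹' {p : E3 × E3 | p.1 = p.2} = {x} := by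
      ext y
      simp [eq_comm]
    rw [this, measure_singleton]
  refine measure_mono_null (t := (⋃ n : ℕ, (fun p : E3 × E3 => p.1 - p.2) ⁻¹'
    (N ∩ {z | 1 / ((n : ℝ) + 1) < ‖z‖})) ∪ {p | p.1 = p.2}) (fun p hp => ?_)
    (measure_union_null (measure_iUnion_null hfar) hdiag)
  rcases eq_or_ne p.1 p.2 with h | h
  · exact Or.inr h
  · obtain ⟨n, hn⟩ := exists_nat_one_div_lt (norm_pos_iff.2 (sub_ne_zero.2 h))
    exact Or.inl (Set.mem_iUnion.2 ⟨n, hp, hn⟩)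

lemma quasiMeasurePreserving_sub :
    Measure.QuasiMeasurePreserving (fun p : E3 × E3 => p.1 - p.2) sph2 volume :=
  ⟨by fun_prop, Measure.AbsolutelyContinuous.mk fun N hNm hN => by
    rw [Measure.map_apply (by fun_prop) hNm]
    exact sph2_sub_preimage_eq_zero hN⟩

lemma tendsto_integral_bump_mul {Q : E3 → ℂ} (hQ : Integrable Q) {κ : ℕ → ℝ} (hκ : ∀ j, 0 < κ j)
    (hκt : Tendsto κ atTop (nhds 0)) :
    ∀ᵐ z, Tendsto (fun j => ∫ w, (bump (κ j) (z - w) : ℂ) * Q w) atTop (nhds (Q z)) := by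
  have hκt' : Tendsto κ atTop (nhdsWithin 0 (Set.Ioi 0)) :=
    tendsto_nhdsWithin_iff.2 ⟨hκt, Eventually.of_forall hκ⟩
  filter_upwards [IsUnifLocDoublingMeasure.ae_tendsto_average_norm_sub volume
    hQ.locallyIntegrable 1] with z hz
  have h := hz (fun _ => z) κ hκt' (Eventually.of_forall fun j =>
    mem_closedBall_self (by have := hκ j; linarith))
  rw [tendsto_iff_norm_sub_tendsto_zero]
  set v := volume.real (closedBall (0 : E3) 1)
  refine squeeze_zero (fun j => norm_nonneg _) (fun j => ?_)
    (by simpa using h.const_mul (bumpMass⁻¹ * v))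
  have hκj := hκ j
  have hbi : Integrable fun w => (bump (κ j) (z - w) : ℂ) :=
    (((continuous_bump (κ j)).integrable_of_hasCompactSupport
      (hasCompactSupport_bump hκj)).comp_sub_left z).ofReal
  have hb1 : ∫ w, (bump (κ j) (z - w) : ℂ) = 1 := by
    rw [integral_complex_ofReal, integral_sub_left_eq_self (bump (κ j)), integral_bump hκj,
      Complex.ofReal_one]
  have hbQ : Integrable fun w => (bump (κ j) (z - w) : ℂ) * Q w :=
    hQ.bdd_mul (c := (κ j)⁻¹ ^ 3 * bumpMass⁻¹)
      ((continuous_bumpC (κ j)).comp (by fun_prop)).aestronglyMeasurable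
      (Eventually.of_forall fun p => norm_bump_le hκj _)
  have hsub : (∫ w, (bump (κ j) (z - w) : ℂ) * Q w) - Q z =
      ∫ w, (bump (κ j) (z - w) : ℂ) * (Q w - Q z) := by
    simp only [mul_sub]
    rw [integral_sub hbQ (hbi.mul_const _), integral_mul_const, hb1, one_mul]
  have hloc : IntegrableOn (fun w => ‖Q w - Q z‖) (closedBall z (κ j)) :=
    (hQ.integrableOn.sub (integrableOn_const measure_closedBall_lt_top.ne)).norm
  rw [hsub, setAverage_eq, Measure.addHaar_real_closedBall' volume z hκj.le]
  calc _ ≤ ∫ w in closedBall z (κ j), (κ j)⁻¹ ^ 3 * bumpMass⁻¹ * ‖Q w - Q z‖ := by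
        rw [← setIntegral_eq_integral_of_forall_compl_eq_zero (s := closedBall z (κ j))]
        · refine norm_integral_le_of_norm_le (hloc.const_mul _) (Eventually.of_forall fun w => ?_)
          rw [norm_mul]
          gcongr
          exact norm_bump_le hκj _
        · intro w hw
          rw [bump_eq_zero hκj, Complex.ofReal_zero, zero_mul]
          rw [mem_closedBall_iff_norm'] at hw
          exact (not_le.1 hw).le
    _ = _ := by
        have hv : 0 < v := ENNReal.toReal_pos (measure_closedBall_pos _ _ one_pos).ne'
          measure_closedBall_lt_top.ne
        rw [integral_const_mul, finrank_euclideanSpace_fin, smul_eq_mul]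
        change _ = bumpMass⁻¹ * v * ((κ j ^ 3 * v)⁻¹ * _)
        field_simp

lemma pairConv_eq_integral {κ : ℝ} (hκ : 0 < κ) {u v Q : E3 → ℂ} (hu : Integrable u sphMeasure)
    (hv : Integrable v sphMeasure) (hQ : IsConvPairDensity u v Q) (z : E3) :
    pairConv κ u v z = ∫ w, (bump κ (z - w) : ℂ) * Q w := by
  have hc : Continuous fun w => (bump κ (z - w) : ℂ) := (continuous_bumpC κ).comp (by fun_prop)
  have hs : HasCompactSupport fun w => (bump κ (z - w) : ℂ) := by
    refine HasCompactSupport.of_support_subset_isCompact (isCompact_closedBall z κ) fun w hw => ?_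
    rw [mem_closedBall_iff_norm']
    by_contra hlt
    exact hw (by simp [bump_eq_zero hκ (not_le.1 hlt).le])
  have hi := integrable_pairConv hκ (w := fun p : E3 × E3 => u p.1 * v p.2) (hu.mul_prod hv) z
  rw [hQ.2 _ hc hs, pairConv]
  unfold sph2 at *
  rw [integral_prod _ hi]
  simp only [sub_sub]

/-- The nonnegative counterpart of `pairConv`. -/
def absPair (κ : ℝ) (U V : E3 → ℝ≥0∞) (z : E3) : ℝ≥0∞ :=
  ∫⁻ p, ENNReal.ofReal (bump κ (z - p.1 - p.2)) * (U p.1 * V p.2) ∂sph2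

lemma measurable_absPair (κ : ℝ) {U V : E3 → ℝ≥0∞} (hU : Measurable U) (hV : Measurable V) :
    Measurable (absPair κ U V) := by
  have := measurable_bump κ
  refine Measurable.lintegral_prod_right' (f := fun q : E3 × E3 × E3 =>
    ENNReal.ofReal (bump κ (q.1 - q.2.1 - q.2.2)) * (U q.2.1 * V q.2.2)) ?_
  fun_prop

lemma enorm_pairConv_le {κ : ℝ} (hκ : 0 < κ) (u v : E3 → ℂ) (z : E3) :
    ‖pairConv κ u v z‖ₑ ≤ absPair κ (fun x => ‖u x‖ₑ) (fun x => ‖v x‖ₑ) z := by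
  refine (enorm_integral_le_lintegral_enorm _).trans (le_of_eq ?_)
  refine lintegral_congr fun p => ?_
  rw [enorm_mul, enorm_mul]
  congr 1
  rw [← ofReal_norm, Complex.norm_real, Real.norm_of_nonneg (bump_nonneg hκ.le _)]

lemma absPair_le_of_le {κ : ℝ} (hκ : 0 < κ) (hκ1 : κ ≤ 1) {U V : E3 → ℝ≥0∞} {c : ℝ≥0∞}
    (hU : ∀ x, U x ≤ c) (hV : ∀ x, V x ≤ c) {z : E3} (hz : z ≠ 0) :
    absPair κ U V z ≤ ENNReal.ofReal (pairConst / ‖z‖) * (c * c) := by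
  have hb := measurable_bump κ
  have m : Measurable fun p : E3 × E3 => ENNReal.ofReal (bump κ (z - p.1 - p.2)) := by fun_prop
  calc absPair κ U V z ≤ ∫⁻ p, ENNReal.ofReal (bump κ (z - p.1 - p.2)) * (c * c) ∂sph2 :=
        lintegral_mono fun p => by
          gcongr
          exacts [hU _, hV _]
    _ = (∫⁻ p, ENNReal.ofReal (bump κ (z - p.1 - p.2)) ∂sph2) * (c * c) :=
        lintegral_mul_const _ m
    _ ≤ _ := by
        gcongr
        unfold sph2
        rw [lintegral_prod _ m.aemeasurable]
        exact lintegral_bump_pair_le hz hκ hκ1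

lemma lintegral_mul_absPair (κ : ℝ) {F U V : E3 → ℝ≥0∞} (hF : Measurable F) (hU : Measurable U)
    (hV : Measurable V) : ∫⁻ p, F p.2 * absPair κ U V (p.1 - p.2) ∂sph2 =
      ∫⁻ x, absTri κ F U V x ∂sphMeasure := by
  have hb := measurable_bump κ
  have hP := measurable_absPair κ hU hV
  have m : Measurable fun p : E3 × E3 => F p.2 * absPair κ U V (p.1 - p.2) := by fun_prop
  nth_rewrite 1 [sph2]
  rw [lintegral_prod _ m.aemeasurable]
  refine lintegral_congr fun x => ?_
  have m' : Measurable fun p : E3 × E3 × E3 =>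
    ENNReal.ofReal (bump κ (x - p.1 - p.2.1 - p.2.2)) * (F p.1 * (U p.2.1 * V p.2.2)) := by
    fun_prop
  rw [absTri, sph3, lintegral_prod _ m'.aemeasurable]
  refine lintegral_congr fun y => ?_
  rw [absPair, ← lintegral_const_mul _ (by fun_prop)]
  exact lintegral_congr fun p => by ring

lemma lintegral_mul_absPair_le {κ : ℝ} (hκ : 0 < κ) (hκ1 : κ ≤ 1 / 10) {F U V : E3 → ℝ≥0∞}
    (hF : Measurable F) (hU : Measurable U) (hV : Measurable V) (hF' : nrm F ≠ ⊤)
    (hU' : nrm U ≠ ⊤) (hV' : nrm V ≠ ⊤) :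
    ∫⁻ p, F p.2 * absPair κ U V (p.1 - p.2) ∂sph2 ≤
      ENNReal.ofReal (6 * pairConst) * (nrm F * (nrm U * nrm V)) * nrm (fun _ => 1) := by
  rw [lintegral_mul_absPair κ hF hU hV]
  refine (lintegral_le_nrm (measurable_absTri κ hF hU hV)).trans ?_
  gcongr
  exact nrm_absTri_le hκ hκ1 hF hU hV hF' hU' hV'

lemma lintegral_inv_norm_le {y : E3} (hy : y ∈ sph) :
    ∫⁻ x, ENNReal.ofReal (‖x - y‖⁻¹) ∂sphMeasure ≤ ENNReal.ofReal (3456 * 2) := by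
  refine le_trans ?_ (setLIntegral_inv_norm_le y two_pos)
  rw [← lintegral_indicator measurableSet_closedBall]
  refine lintegral_mono_ae ?_
  filter_upwards [ae_mem_sph] with x hx
  rw [Set.indicator_of_mem, norm_sub_rev]
  rw [mem_closedBall, dist_eq_norm]
  refine (norm_sub_le _ _).trans ?_
  rw [norm_eq_one_of_mem_sph hx, norm_eq_one_of_mem_sph hy]
  norm_num

lemma lintegral_mul_inv_norm_lt_top {F : E3 → ℝ≥0∞} (hF : Measurable F) (hF' : nrm F < ⊤) :
    ∫⁻ p, F p.2 * ENNReal.ofReal (‖p.1 - p.2‖⁻¹) ∂sph2 < ⊤ := by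
  have m : Measurable fun p : E3 × E3 => F p.2 * ENNReal.ofReal (‖p.1 - p.2‖⁻¹) := by fun_prop
  unfold sph2
  rw [lintegral_prod_symm _ m.aemeasurable]
  calc _ ≤ ∫⁻ y, F y * ENNReal.ofReal (3456 * 2) ∂sphMeasure := by
        refine lintegral_mono_ae ?_
        filter_upwards [ae_mem_sph] with y hy
        rw [lintegral_const_mul _ (by fun_prop)]
        gcongr
        exact lintegral_inv_norm_le hy
    _ = (∫⁻ y, F y ∂sphMeasure) * ENNReal.ofReal (3456 * 2) := lintegral_mul_const _ hF
    _ < ⊤ := ENNReal.mul_lt_top ((lintegral_le_nrm hF).trans_lt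
        (ENNReal.mul_lt_top hF' nrm_one_lt_top)) ENNReal.ofReal_lt_top

lemma absPair_truncate_le (κ : ℝ) {U : E3 → ℝ≥0∞} (hU : Measurable U) {T : Set E3}
    (hT : MeasurableSet T) (z : E3) :
    absPair κ U U z ≤ absPair κ (Tᶜ.indicator U) (Tᶜ.indicator U) z +
      (absPair κ (T.indicator U) U z + absPair κ U (T.indicator U) z) := by
  have hb := measurable_bump κ
  have h1 := hU.indicator hT
  have h2 := hU.indicator hT.compl
  unfold absPair
  rw [← lintegral_add_left (by fun_prop), ← lintegral_add_left (by fun_prop)]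
  refine lintegral_mono fun p => ?_
  rw [← mul_add, ← mul_add]
  gcongr
  by_cases ha : p.1 ∈ T
  · simp only [Set.indicator_of_mem ha]
    exact le_add_left (le_add_right le_rfl)
  · by_cases hb : p.2 ∈ T
    · simp only [Set.indicator_of_mem hb]
      exact le_add_left (le_add_left le_rfl)
    · rw [Set.indicator_of_mem (show p.1 ∈ Tᶜ from ha),
        Set.indicator_of_mem (show p.2 ∈ Tᶜ from hb)]
      exact le_add_right le_rfl

lemma continuous_pairConv {κ : ℝ} (hκ : 0 < κ) {u v : E3 → ℂ} (hu : Integrable u sphMeasure)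
    (hv : Integrable v sphMeasure) : Continuous (pairConv κ u v) := by
  have hw : Integrable (fun p : E3 × E3 => u p.1 * v p.2) sph2 := hu.mul_prod hv
  unfold pairConv
  refine continuous_of_dominated (bound := fun p => κ⁻¹ ^ 3 * bumpMass⁻¹ * ‖u p.1 * v p.2‖)
    (fun z => (integrable_pairConv hκ hw z).1) ?_ ?_ ?_
  · intro z
    refine Eventually.of_forall fun p => ?_
    rw [norm_mul]
    gcongr
    exact norm_bump_le hκ _
  · exact hw.norm.const_mul _
  · refine Eventually.of_forall fun p => ?_
    exact ((continuous_bumpC κ).comp (by fun_prop)).mul continuous_const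

lemma aestronglyMeasurable_mul_pairConv {κ : ℝ} (hκ : 0 < κ) (f : HH) :
    AEStronglyMeasurable (fun p : E3 × E3 => f p.2 * pairConv κ f f (p.1 - p.2)) sph2 := by
  refine ((Lp.stronglyMeasurable f).comp_measurable measurable_snd).aestronglyMeasurable.mul ?_
  exact ((continuous_pairConv hκ f.integrable f.integrable).comp (by fun_prop)).aestronglyMeasurable

lemma enorm_mul_pairConv_le {κ : ℝ} (hκ : 0 < κ) (f : HH) (p : E3 × E3) :
    ‖f p.2 * pairConv κ f f (p.1 - p.2)‖ₑ ≤
      ‖f p.2‖ₑ * absPair κ (fun x => ‖f x‖ₑ) (fun x => ‖f x‖ₑ) (p.1 - p.2) := by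
  rw [enorm_mul]
  gcongr
  exact enorm_pairConv_le hκ _ _ _

lemma HH.nrm_ne_top (f : HH) : nrm (fun x => ‖f x‖ₑ) ≠ ⊤ := by
  rw [f.nrm_eq]
  exact enorm_ne_top

lemma ae_sub_ne_zero : ∀ᵐ p ∂sph2, p.1 - p.2 ≠ 0 :=
  quasiMeasurePreserving_sub.ae (Measure.ae_ne volume (0 : E3))

/-- Truncating `f` at a high level makes the contribution of its large values uniformly small. -/
lemma exists_truncation (f : HH) {η : ℝ≥0∞} (hη : η ≠ 0) : ∃ (T : Set E3) (M : ℝ≥0∞),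
    MeasurableSet T ∧ M ≠ ⊤ ∧ (∀ x ∉ T, ‖f x‖ₑ ≤ M) ∧
    ∀ κ : ℝ, 0 < κ → κ ≤ 1 / 10 →
      ∫⁻ p, ‖f p.2‖ₑ * (absPair κ (T.indicator fun x => ‖f x‖ₑ) (fun x => ‖f x‖ₑ) (p.1 - p.2) +
        absPair κ (fun x => ‖f x‖ₑ) (T.indicator fun x => ‖f x‖ₑ) (p.1 - p.2)) ∂sph2 ≤ η := by
  have hfm := f.measurable_enorm
  have hft := f.nrm_ne_top
  set C : ℝ≥0∞ := 2 * (ENNReal.ofReal (6 * pairConst) * (nrm (fun x => ‖f x‖ₑ) *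
    nrm (fun x => ‖f x‖ₑ)) * nrm (fun _ => 1)) + 1 with hC
  have hCt : C ≠ ⊤ := by
    have := nrm_one_lt_top.ne
    finiteness
  have hC0 : C ≠ 0 := by simp [hC]
  obtain ⟨r, hr0, hr⟩ : ∃ r : ℝ, 0 < r ∧ C * ENNReal.ofReal r ≤ η := by
    have hpos : 0 < min (η / C) 1 := lt_min (ENNReal.div_pos hη hCt) one_pos
    have hmt : min (η / C) 1 ≠ ⊤ := ((min_le_right _ _).trans_lt ENNReal.one_lt_top).ne
    refine ⟨(min (η / C) 1).toReal, ENNReal.toReal_pos hpos.ne' hmt, ?_⟩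
    rw [ENNReal.ofReal_toReal hmt]
    exact (mul_le_mul_right (min_le_left _ _) C).trans ENNReal.mul_div_le
  obtain ⟨M, hM0, hM⟩ := (Lp.memLp f).eLpNorm_indicator_norm_ge_pos_le (Lp.stronglyMeasurable f) hr0
  set T : Set E3 := {x | M ≤ ‖f x‖₊} with hT
  have hTm : MeasurableSet T :=
    measurableSet_le measurable_const (Lp.stronglyMeasurable f).measurable.nnnorm.coe_nnreal_real
  have hind : (T.indicator fun x => ‖f x‖ₑ) = fun x => ‖T.indicator f x‖ₑ := by
    ext x
    exact (enorm_indicator_eq_indicator_enorm _ _).symm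
  have hT1 : nrm (T.indicator fun x => ‖f x‖ₑ) ≤ ENNReal.ofReal r := by
    rw [hind, nrm_enorm]
    exact hM
  have hTt : nrm (T.indicator fun x => ‖f x‖ₑ) ≠ ⊤ := (hT1.trans_lt ENNReal.ofReal_lt_top).ne
  have hfTm := hfm.indicator hTm
  refine ⟨T, ENNReal.ofReal M, hTm, ENNReal.ofReal_ne_top, fun x hx => ?_, fun κ hκ hκ1 => ?_⟩
  · rw [← ofReal_norm]
    refine ENNReal.ofReal_le_ofReal ?_
    exact (not_le.1 hx).le
  · have m1 := measurable_absPair κ hfTm hfm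
    have m2 := measurable_absPair κ hfm hfTm
    simp only [mul_add]
    rw [lintegral_add_left (by fun_prop)]
    refine (add_le_add (lintegral_mul_absPair_le hκ hκ1 hfm hfTm hfm hft hTt hft)
      (lintegral_mul_absPair_le hκ hκ1 hfm hfm hfTm hft hft hTt)).trans (le_trans ?_ hr)
    generalize nrm (T.indicator fun x => ‖f x‖ₑ) = t at hT1
    calc _ = 2 * (ENNReal.ofReal (6 * pairConst) * (nrm (fun x => ‖f x‖ₑ) *
          nrm (fun x => ‖f x‖ₑ)) * nrm (fun _ => 1)) * t := by ring
      _ ≤ C * ENNReal.ofReal r := mul_le_mul' le_self_add hT1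

lemma unifIntegrable_mul_pairConv (f : HH) {κ : ℕ → ℝ} (hκ : ∀ j, 0 < κ j)
    (hκ1 : ∀ j, κ j ≤ 1 / 10) :
    UnifIntegrable (fun j (p : E3 × E3) => f p.2 * pairConv (κ j) f f (p.1 - p.2)) 1 sph2 := by
  intro η hη
  have hη2 : ENNReal.ofReal (η / 2) ≠ 0 := by simpa using hη
  obtain ⟨T, M, hT, hMt, hM, hG⟩ := exists_truncation f hη2
  have hfm := f.measurable_enorm
  set H : E3 × E3 → ℝ≥0∞ := fun p => ‖f p.2‖ₑ * ENNReal.ofReal (‖p.1 - p.2‖⁻¹) *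
    (ENNReal.ofReal pairConst * (M * M)) with hH
  have hHt : ∫⁻ p, H p ∂sph2 ≠ ⊤ := by
    have m : Measurable fun p : E3 × E3 => ‖f p.2‖ₑ * ENNReal.ofReal (‖p.1 - p.2‖⁻¹) := by fun_prop
    rw [lintegral_mul_const _ m]
    exact (ENNReal.mul_lt_top (lintegral_mul_inv_norm_lt_top hfm f.nrm_ne_top.lt_top)
      (by finiteness)).ne
  obtain ⟨δ, hδ, hδH⟩ := exists_pos_setLIntegral_lt_of_measure_lt hHt hη2
  have hδ' : 0 < min δ 1 := lt_min hδ one_pos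
  have hδt : min δ 1 ≠ ⊤ := ((min_le_right _ _).trans_lt ENNReal.one_lt_top).ne
  refine ⟨(min δ 1).toReal / 2, half_pos (ENNReal.toReal_pos hδ'.ne' hδt), fun j s hs hsδ => ?_⟩
  have hsδ' : sph2 s < δ := by
    refine hsδ.trans_lt (lt_of_lt_of_le ?_ (min_le_left δ 1))
    rw [ENNReal.ofReal_lt_iff_lt_toReal (by positivity) hδt]
    exact half_lt_self (ENNReal.toReal_pos hδ'.ne' hδt)
  set U : E3 → ℝ≥0∞ := fun x => ‖f x‖ₑ with hU
  set G : E3 × E3 → ℝ≥0∞ := fun p => U p.2 * (absPair (κ j) (T.indicator U) U (p.1 - p.2) +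
    absPair (κ j) U (T.indicator U) (p.1 - p.2)) with hGdef
  have hHm : Measurable H := by rw [hH]; fun_prop
  rw [eLpNorm_indicator_eq_eLpNorm_restrict hs, eLpNorm_one_eq_lintegral_enorm]
  have hbd : ∀ x, Tᶜ.indicator U x ≤ M := fun x => by
    by_cases hx : x ∈ T
    · rw [Set.indicator_of_notMem (by simpa using hx)]
      exact zero_le
    · rw [Set.indicator_of_mem (by exact hx)]
      exact hM x hx
  calc _ ≤ ∫⁻ p in s, (H p + G p) ∂sph2 := by
        refine lintegral_mono_ae (ae_restrict_of_ae ?_)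
        filter_upwards [ae_sub_ne_zero] with p hp
        refine (enorm_mul_pairConv_le (hκ j) f p).trans ?_
        refine (mul_le_mul_right (absPair_truncate_le (κ j) hfm hT (p.1 - p.2)) _).trans ?_
        rw [mul_add]
        refine add_le_add ?_ le_rfl
        refine (mul_le_mul_right (absPair_le_of_le (hκ j) ((hκ1 j).trans (by norm_num))
          hbd hbd hp) _).trans (le_of_eq ?_)
        rw [hH, div_eq_inv_mul, ENNReal.ofReal_mul (by positivity)]
        ring
    _ = ∫⁻ p in s, H p ∂sph2 + ∫⁻ p in s, G p ∂sph2 := lintegral_add_left hHm _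
    _ ≤ ENNReal.ofReal (η / 2) + ENNReal.ofReal (η / 2) :=
        add_le_add (hδH s hsδ').le ((setLIntegral_le_lintegral _ _).trans (hG _ (hκ j) (hκ1 j)))
    _ = ENNReal.ofReal η := by
        rw [← ENNReal.ofReal_add (by positivity) (by positivity), add_halves]

lemma exists_limit_triLp (f : HH) {Q : E3 → ℂ} (hQ : IsConvPairDensity f f Q) :
    ∃ (κ : ℕ → ℝ) (hκ : ∀ j, 0 < κ j) (G : HH), Tendsto κ atTop (nhds 0) ∧
      G =ᵐ[sphMeasure] (fun x => ∫ y, f y * Q (x - y) ∂sphMeasure) ∧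
      ∀ᵐ x ∂sphMeasure, Tendsto (fun j => triLp (hκ j) f f f x) atTop (nhds (G x)) := by
  obtain ⟨κ, hκ0, hκ1, hκt⟩ : ∃ κ : ℕ → ℝ, (∀ j, 0 < κ j) ∧ (∀ j, κ j ≤ 1 / 10) ∧
      Tendsto κ atTop (nhds 0) := by
    refine ⟨fun j => 1 / 10 * (1 / ((j : ℝ) + 1)), fun j => by positivity, fun j => ?_, ?_⟩
    · exact mul_le_of_le_one_right (by norm_num)
        ((div_le_one (by positivity)).2 (by linarith [Nat.cast_nonneg (α := ℝ) j]))
    · simpa using (tendsto_one_div_add_atTop_nhds_zero_nat (𝕜 := ℝ)).const_mul (10⁻¹)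
  have hfi := f.integrable
  have hfm := f.measurable_enorm
  set F : ℕ → E3 × E3 → ℂ := fun j p => f p.2 * pairConv (κ j) f f (p.1 - p.2) with hF
  set F0 : E3 × E3 → ℂ := fun p => f p.2 * Q (p.1 - p.2) with hF0
  have hFm : ∀ j, AEStronglyMeasurable (F j) sph2 := fun j =>
    aestronglyMeasurable_mul_pairConv (hκ0 j) f
  have hlim : ∀ᵐ p ∂sph2, Tendsto (fun j => F j p) atTop (nhds (F0 p)) := by
    filter_upwards [quasiMeasurePreserving_sub.ae (tendsto_integral_bump_mul hQ.1 hκ0 hκt)]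
      with p hp
    refine Tendsto.const_mul _ ?_
    simpa only [pairConv_eq_integral (hκ0 _) hfi hfi hQ] using hp
  set C := ENNReal.ofReal (6 * pairConst) * (nrm (fun x => ‖f x‖ₑ) * (nrm (fun x => ‖f x‖ₑ) *
    nrm (fun x => ‖f x‖ₑ))) * nrm (fun _ => 1) with hC
  have hCt : C < ⊤ := by
    have := nrm_one_lt_top.ne
    have := f.nrm_ne_top
    finiteness
  have hFC : ∀ j, eLpNorm (F j) 1 sph2 ≤ C := fun j => by
    rw [eLpNorm_one_eq_lintegral_enorm]
    exact (lintegral_mono fun p => enorm_mul_pairConv_le (hκ0 j) f p).trans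
      (lintegral_mul_absPair_le (hκ0 j) (hκ1 j) hfm hfm hfm f.nrm_ne_top f.nrm_ne_top f.nrm_ne_top)
  have hF0L : MemLp F0 1 sph2 := ⟨aestronglyMeasurable_of_tendsto_ae atTop hFm hlim,
    (Lp.eLpNorm_le_of_ae_tendsto (Eventually.of_forall hFC) hFm hlim).trans_lt hCt⟩
  have hconv := tendsto_Lp_finite_of_tendsto_ae le_rfl ENNReal.one_ne_top hFm hF0L
    (unifIntegrable_mul_pairConv f hκ0 hκ1) hlim
  have hF0i : Integrable F0 (sphMeasure.prod sphMeasure) := memLp_one_iff_integrable.1 hF0L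
  have hFm' : ∀ j, AEStronglyMeasurable (F j - F0) (sphMeasure.prod sphMeasure) := fun j =>
    (hFm j).sub hF0L.1
  set R : E3 → ℂ := fun x => ∫ y, f y * Q (x - y) ∂sphMeasure with hR
  have hRm : AEStronglyMeasurable R sphMeasure := hF0i.aestronglyMeasurable.integral_prod_right'
  have htm : ∀ j, AEStronglyMeasurable (tri (κ j) f f f) sphMeasure := fun j =>
    (continuous_tri (hκ0 j) hfi hfi hfi).aestronglyMeasurable
  have hRt : Tendsto (fun j => eLpNorm (tri (κ j) f f f - R) 1 sphMeasure) atTop (nhds 0) := by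
    refine tendsto_of_tendsto_of_tendsto_of_le_of_le tendsto_const_nhds hconv
      (fun j => zero_le) fun j => ?_
    change eLpNorm (tri (κ j) f f f - R) 1 sphMeasure ≤ eLpNorm (F j - F0) 1 sph2
    rw [eLpNorm_one_eq_lintegral_enorm, eLpNorm_one_eq_lintegral_enorm, sph2,
      lintegral_prod _ (hFm' j).enorm]
    refine lintegral_mono_ae ?_
    filter_upwards [hF0i.prod_right_ae] with x hx
    rw [Pi.sub_apply, tri_eq_integral (hκ0 j) hfi hfi hfi, hR,
      ← integral_sub (integrable_mul_pairConv (hκ0 j) hfi hfi hfi x) hx]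
    exact enorm_integral_le_lintegral_enorm _
  obtain ⟨ns, hns, hae⟩ := (tendstoInMeasure_of_tendsto_eLpNorm one_ne_zero htm hRm
    hRt).exists_seq_tendsto_ae
  have hRL : MemLp R 2 sphMeasure := ⟨hRm, (Lp.eLpNorm_le_of_ae_tendsto
    (Eventually.of_forall fun j => HH.eLpNorm_tri_le (hκ0 (ns j)) (hκ1 (ns j)) f f f)
    (fun j => htm (ns j)) hae).trans_lt (by finiteness)⟩
  refine ⟨fun j => κ (ns j), fun j => hκ0 (ns j), hRL.toLp R, hκt.comp hns.tendsto_atTop,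
    hRL.coeFn_toLp, ?_⟩
  filter_upwards [hae, hRL.coeFn_toLp, ae_all_iff.2 fun j => triLp_coe (hκ0 (ns j)) f f f]
    with x h1 h2 h3
  rw [h2]
  exact h1.congr fun j => (h3 j).symm

/-! ### Degenerate densities -/

lemma integral_eq_zero_of_not_aestronglyMeasurable {f : E3 → ℂ}
    (hf : ¬ AEStronglyMeasurable f sphMeasure) {φ : E3 → ℂ} (hφ : Continuous φ)
    (h0 : ∀ z ∈ closedBall (0 : E3) 2, φ z ≠ 0) :
    ∫ x, ∫ y, φ (x + y) * (f x * f y) ∂sphMeasure ∂sphMeasure = 0 := by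
  refine integral_eq_zero_of_ae ?_
  filter_upwards [ae_mem_sph] with x hx
  rcases eq_or_ne (f x) 0 with hfx | hfx
  · simp [hfx]
  · refine integral_undef fun hi => hf ?_
    have hc : AEStronglyMeasurable (fun y => (φ (x + y))⁻¹) sphMeasure :=
      (hφ.measurable.comp (measurable_const_add x)).inv.aestronglyMeasurable
    refine ((hc.mul hi.aestronglyMeasurable).const_mul (f x)⁻¹).congr ?_
    filter_upwards [ae_mem_sph] with y hy
    have hz : φ (x + y) ≠ 0 := h0 _ (by
      rw [mem_closedBall, dist_zero_right]
      refine (norm_add_le _ _).trans ?_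
      rw [norm_eq_one_of_mem_sph hx, norm_eq_one_of_mem_sph hy]
      norm_num)
    simp only [Pi.mul_apply]
    field_simp

lemma exists_cutoff : ∃ B : E3 → ℝ, Continuous B ∧ HasCompactSupport B ∧
    ∀ z ∈ closedBall (0 : E3) 2, B z = 1 := by
  let B : ContDiffBump (0 : E3) := ⟨2, 3, by norm_num, by norm_num⟩
  exact ⟨B, B.continuous, B.hasCompactSupport, fun z hz => B.one_of_mem_closedBall hz⟩

lemma IsConvPairDensity.ae_eq_zero {f Q : E3 → ℂ} (hQ : IsConvPairDensity f f Q)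
    (hf : ¬ AEStronglyMeasurable f sphMeasure) : ∀ᵐ z, Q z = 0 := by
  refine ae_eq_zero_of_integral_contDiff_smul_eq_zero hQ.1.locallyIntegrable fun g hg hgs => ?_
  obtain ⟨B, hB, hBsupp, hB1⟩ := exists_cutoff
  have hBc : Continuous fun z => ((B z : ℝ) : ℂ) := Complex.continuous_ofReal.comp hB
  have hBs : HasCompactSupport fun z => ((B z : ℝ) : ℂ) := hBsupp.comp_left Complex.ofReal_zero
  have hgc : Continuous fun z => ((g z : ℝ) : ℂ) := Complex.continuous_ofReal.comp hg.continuous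
  have hgs' : HasCompactSupport fun z => ((g z : ℝ) : ℂ) := hgs.comp_left Complex.ofReal_zero
  obtain ⟨C, hC⟩ := hgs.exists_bound_of_continuous hg.continuous
  have hC0 : 0 ≤ C := (norm_nonneg _).trans (hC 0)
  have e1 : ∫ z, ((B z : ℝ) : ℂ) * Q z = 0 := by
    rw [hQ.2 _ hBc hBs]
    refine integral_eq_zero_of_not_aestronglyMeasurable hf hBc fun z hz => ?_
    simp [hB1 z hz]
  have e2 : ∫ z, ((g z : ℂ) + (C + 1 : ℝ) * (B z : ℂ)) * Q z = 0 := by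
    have hc : Continuous fun z => (g z : ℂ) + (C + 1 : ℝ) * (B z : ℂ) :=
      hgc.add (hBc.const_mul ((C + 1 : ℝ) : ℂ))
    have hs : HasCompactSupport fun z => (g z : ℂ) + (C + 1 : ℝ) * (B z : ℂ) :=
      hgs'.add (hBs.mul_left (f := fun _ => ((C + 1 : ℝ) : ℂ)))
    rw [hQ.2 _ hc hs]
    refine integral_eq_zero_of_not_aestronglyMeasurable hf hc fun z hz => ?_
    rw [hB1 z hz, Complex.ofReal_one, mul_one, ← Complex.ofReal_add]
    refine Complex.ofReal_ne_zero.2 (ne_of_gt ?_)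
    have := neg_le_of_abs_le (hC z)
    linarith
  have hInt : ∀ {ψ : E3 → ℂ}, Continuous ψ → HasCompactSupport ψ →
      Integrable fun z => ψ z * Q z := fun {ψ} hψ hψs => by
    obtain ⟨K, hK⟩ := hψs.exists_bound_of_continuous hψ
    exact hQ.1.bdd_mul hψ.aestronglyMeasurable (Eventually.of_forall hK)
  simp only [add_mul, mul_assoc] at e2
  rw [integral_add (hInt hgc hgs') ((hInt hBc hBs).const_mul _), integral_const_mul, e1, mul_zero,
    add_zero] at e2
  simpa only [Complex.real_smul] using e2

lemma ae_integral_mul_eq_zero (f : E3 → ℂ) {Q : E3 → ℂ} (hQ : ∀ᵐ z, Q z = 0) :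
    ∀ᵐ x ∂sphMeasure, ∫ y, f y * Q (x - y) ∂sphMeasure = 0 := by
  have h := quasiMeasurePreserving_sub.ae hQ
  unfold sph2 at h
  filter_upwards [Measure.ae_ae_of_ae_prod h] with x hx
  refine integral_eq_zero_of_ae ?_
  filter_upwards [hx] with y hy
  simp [hy]

lemma smooth_zero (s : ℝ) (n : ℕ) : Smooth s n 0 := ⟨0, le_rfl, fun Θ => by simp⟩

lemma IsConvPairDensity.congr {f g Q : E3 → ℂ} (hQ : IsConvPairDensity f f Q)
    (h : g =ᵐ[sphMeasure] f) : IsConvPairDensity g g Q := by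
  refine ⟨hQ.1, fun φ hφ hφs => (hQ.2 φ hφ hφs).trans ?_⟩
  refine integral_congr_ae ?_
  filter_upwards [h] with x hx
  refine integral_congr_ae ?_
  filter_upwards [h] with y hy
  rw [hx, hy]

/-- **Bootstrap step.** Let `a ∈ C^∞(S²)` (realized as the restriction to the sphere of a
smooth function on `ℝ³`).  For any `ε > 0` there exists `δ > 0` such that for any
non-integer `s ∈ [ε,∞)` and any `f ∈ ℋ^s(S²)`, the function `a · (fσ*fσ*fσ)|_{S²}`
belongs to `ℋ^t(S²)` for every non-integer `t ∈ [0, s+δ]`.  Here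
`(fσ*fσ*fσ)|_{S²}(x) = ∫ f(y) Q(x-y) dσ(y)` with `Q` the density of `fσ*fσ`. -/
theorem bootstrap_scriptH (a : E3 → ℂ) (ha : ContDiff ℝ (⊤ : ℕ∞) a) (ε : ℝ) (hε : 0 < ε) :
    ∃ δ : ℝ, 0 < δ ∧
      ∀ s : ℝ, ε ≤ s → (∀ n : ℤ, (n : ℝ) ≠ s) →
      ∀ f : E3 → ℂ, scriptHNorm s f < ⊤ →
      ∀ Q : E3 → ℂ, IsConvPairDensity f f Q →
      ∀ t : ℝ, t ∈ Set.Icc 0 (s + δ) → (∀ n : ℤ, (n : ℝ) ≠ t) →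
        scriptHNorm t (fun x => a x * ∫ y, f y * Q (x - y) ∂sphMeasure) < ⊤ := by
  obtain ⟨δ, hδ, H⟩ := smooth_limit (ε := min ε (1 / 2)) (lt_min hε (by norm_num))
    ((min_le_right _ _).trans_lt (by norm_num))
  refine ⟨δ, hδ, fun s hs _ f hf Q hQ t ht htn => ?_⟩
  have ht0 : 0 < t := ht.1.lt_of_ne (by simpa using htn 0)
  by_cases hfm : AEStronglyMeasurable f sphMeasure
  · have hfL : MemLp f 2 sphMeasure := ⟨hfm, (le_self_add.trans_lt hf)⟩
    have hff : hfL.toLp f =ᵐ[sphMeasure] f := hfL.coeFn_toLp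
    obtain ⟨κ, hκ, G, hκt, hG, hlim⟩ := exists_limit_triLp (hfL.toLp f) (hQ.congr hff)
    have hGs := H s _ (hfL.toLp f) G κ hκ ((min_le_left _ _).trans hs)
      (smooth_of_scriptHNorm hff hf) hκt hlim
    refine Smooth.scriptHNorm_lt_top ?_ ((hGs.lower_exponent ht0 ht.2).mul ht0 ha
      (n := ⌊t⌋₊ + 1) (by exact_mod_cast Nat.lt_floor_add_one t))
    filter_upwards [mulLp_coe ha.continuous G, hG] with x h1 h2
    rw [h1, h2]
    congr 1
    refine integral_congr_ae ?_
    filter_upwards [hff] with y hy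
    rw [hy]
  · refine Smooth.scriptHNorm_lt_top ?_ (smooth_zero t _)
    filter_upwards [ae_integral_mul_eq_zero f (hQ.ae_eq_zero hfm),
      Lp.coeFn_zero ℂ 2 sphMeasure] with x h1 h2
    rw [h1, h2, mul_zero, Pi.zero_apply]

end
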